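/- Let 1 ≤ p < n, 0 ≤ a < n − p, an/(n−p) ≤ b < a + p, and set q = (n−b)p/(n−p−a) (so that q > p). Then for every u ∈ C_0^∞(ℝⁿ) the Hardy–Sobolev inequality ( ∫_{ℝⁿ} |u(x)|^q |x|^{−b} dx )^{1/q} ≤ C · ( ∫_{ℝⁿ} |∇u(x)|^p |x|^{−a} dx )^{1/p} holds with C = ( Γ(pq/(q−p)) / ( Γ(q/(q−p)) · Γ(p(q−1)/(q−p)) ) )^{1/p − 1/q} · ( (p−1)/(n−p−a) )^{1 − 1/p} · ( Γ(n/2) / ( 2π^{n/2} (n−b)^{(n−p−a)/(p+a−b)} ) )^{(p+a−b)/((n−b)p)}, and this constant is best possible (no smaller constant works for all u ∈ C_0^∞(ℝⁿ)). -/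

import Mathlib

open MeasureTheory
open scoped Real

noncomputable section

section BrunnMinkowski
open Set
open scoped ENNReal Pointwise

theorem volume_add_le_of_isCompact {K L C : Set ℝ} (hK : IsCompact K) (hL : IsCompact L)
    (hKn : K.Nonempty) (hLn : L.Nonempty) (h : ∀ x ∈ K, ∀ y ∈ L, x + y ∈ C) :
    volume K + volume L ≤ volume C := by
  obtain ⟨k, hk, hkmax⟩ := hK.exists_isGreatest hKn
  obtain ⟨l, hl, hlmin⟩ := hL.exists_isLeast hLn
  have h1 : volume ((fun x => x + l) '' K) = volume K := by
    rw [Set.image_add_right, measure_preimage_add_right]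
  have h2 : volume ((fun x => k + x) '' L) = volume L := by
    rw [Set.image_add_left, measure_preimage_add]
  have hm : MeasurableSet ((fun x => k + x) '' L) :=
    (hL.image (by fun_prop)).measurableSet
  have hi : ((fun x => x + l) '' K) ∩ ((fun x => k + x) '' L) ⊆ {k + l} := by
    rintro _ ⟨⟨x, hx, rfl⟩, ⟨y, hy, hxy⟩⟩
    have h3 := hkmax hx
    have h4 := hlmin hy
    simp only at hxy
    rw [Set.mem_singleton_iff]
    linarith
  have hnull : volume (((fun x => x + l) '' K) ∩ ((fun x => k + x) '' L)) = 0 :=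
    measure_mono_null hi (by simp)
  calc volume K + volume L
      = volume (((fun x => x + l) '' K) ∪ ((fun x => k + x) '' L)) := by
        rw [← add_zero (volume (_ ∪ _)), ← hnull, measure_union_add_inter _ hm, h1, h2]
    _ ≤ volume C := by
        apply measure_mono
        rintro _ (⟨x, hx, rfl⟩ | ⟨y, hy, rfl⟩)
        · exact h x hx l hl
        · exact h k hk y hy

theorem volume_add_le_of_measurableSet {A B C : Set ℝ} (hA : MeasurableSet A)
    (hB : MeasurableSet B) (hAn : A.Nonempty) (hBn : B.Nonempty)
    (h : ∀ x ∈ A, ∀ y ∈ B, x + y ∈ C) : volume A + volume B ≤ volume C := by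
  obtain ⟨a, ha⟩ := hAn
  obtain ⟨b, hb⟩ := hBn
  rw [hA.measure_eq_iSup_isCompact, hB.measure_eq_iSup_isCompact]
  simp only [iSup_and']
  refine ENNReal.biSup_add_biSup_le' ⟨∅, by simp⟩ ⟨∅, by simp⟩ ?_
  rintro K ⟨hKA, hK⟩ L ⟨hLB, hL⟩
  calc volume K + volume L ≤ volume (insert a K) + volume (insert b L) := by
        gcongr <;> exact subset_insert _ _
    _ ≤ volume C := by
        refine volume_add_le_of_isCompact (hK.insert a) (hL.insert b) (insert_nonempty _ _)
          (insert_nonempty _ _) fun x hx y hy => h x ?_ y ?_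
        · exact insert_subset ha hKA hx
        · exact insert_subset hb hLB hy

end BrunnMinkowski

section PrekopaLeindler
open Set Filter Topology
open scoped ENNReal Pointwise

theorem lintegral_eq_lintegral_Ioo_volume_lt {f : ℝ → ℝ≥0∞} (hf : Measurable f)
    (h1 : ∀ x, f x ≤ 1) :
    ∫⁻ x, f x = ∫⁻ r in Ioo (0 : ℝ) 1, volume {x | ENNReal.ofReal r < f x} := by
  have hne : ∀ x, f x ≠ ∞ := fun x => ne_top_of_le_ne_top ENNReal.one_ne_top (h1 x)
  have e1 : ∫⁻ x, f x = ∫⁻ x, ENNReal.ofReal (f x).toReal := by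
    simp_rw [ENNReal.ofReal_toReal (hne _)]
  rw [e1, lintegral_eq_lintegral_meas_lt volume (Eventually.of_forall fun x => by positivity)
    hf.ennreal_toReal.aemeasurable]
  have e2 : ∀ r ∈ Ioi (0 : ℝ), volume {x | r < (f x).toReal}
      = volume {x | ENNReal.ofReal r < f x} := by
    intro r hr
    congr 1
    ext x
    simp only [mem_ofPred_eq]
    rw [ENNReal.ofReal_lt_iff_lt_toReal (le_of_lt hr) (hne x)]
  rw [setLIntegral_congr_fun measurableSet_Ioi e2]
  rw [← lintegral_indicator measurableSet_Ioi, ← lintegral_indicator measurableSet_Ioo]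
  refine lintegral_congr fun r => ?_
  by_cases hr : r ∈ Ioo (0 : ℝ) 1
  · rw [indicator_of_mem hr, indicator_of_mem (Ioo_subset_Ioi_self hr)]
  rw [indicator_of_notMem hr]
  refine indicator_apply_eq_zero.mpr fun hr0 => ?_
  have hr1 : 1 ≤ r := not_lt.mp fun hlt => hr ⟨hr0, hlt⟩
  refine (measure_mono_null (t := ∅) ?_ measure_empty)
  intro x hx
  exact absurd (h1 x) (not_le.mpr (lt_of_le_of_lt (by simpa using hr1) hx))

theorem volume_const_mul_image (c : ℝ) (A : Set ℝ) :
    volume ((fun x => c * x) '' A) = ENNReal.ofReal |c| * volume A := by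
  have := Measure.addHaar_smul (volume : Measure ℝ) c A
  rwa [Module.finrank_self, pow_one, ← Set.image_smul] at this

theorem lintegral_add_le_of_iSup_eq_one {f g h : ℝ → ℝ≥0∞} (hf : Measurable f)
    (hg : Measurable g) (hh : Measurable h) {s t : ℝ} (hs : 0 < s) (ht : 0 < t)
    (hst : s + t = 1) (H : ∀ x y, f x ^ s * g y ^ t ≤ h (s * x + t * y))
    (hf1 : ⨆ x, f x = 1) (hg1 : ⨆ x, g x = 1) :
    ENNReal.ofReal s * (∫⁻ x, f x) + ENNReal.ofReal t * (∫⁻ x, g x) ≤ ∫⁻ x, h x := by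
  have hfle : ∀ x, f x ≤ 1 := fun x => hf1 ▸ le_iSup f x
  have hgle : ∀ x, g x ≤ 1 := fun x => hg1 ▸ le_iSup g x
  have hle : ∫⁻ x, min (h x) 1 ≤ ∫⁻ x, h x := lintegral_mono fun x => min_le_left _ _
  refine le_trans ?_ hle
  rw [lintegral_eq_lintegral_Ioo_volume_lt hf hfle, lintegral_eq_lintegral_Ioo_volume_lt hg hgle,
    lintegral_eq_lintegral_Ioo_volume_lt (hh.min measurable_const) (fun x => min_le_right _ _)]
  have meas : ∀ {k : ℝ → ℝ≥0∞}, Measurable fun r : ℝ => volume {x | ENNReal.ofReal r < k x} := by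
    intro k
    refine Antitone.measurable fun r r' hr => measure_mono fun x hx => ?_
    exact lt_of_le_of_lt (ENNReal.ofReal_le_ofReal hr) hx
  rw [← lintegral_const_mul _ meas, ← lintegral_const_mul _ meas,
    ← lintegral_add_left (meas.const_mul _)]
  refine setLIntegral_mono meas fun r hr => ?_
  obtain ⟨hr0, hr1⟩ := hr
  have hr1' : ENNReal.ofReal r < 1 := by simpa using hr1
  obtain ⟨x0, hx0⟩ := lt_iSup_iff.mp (hf1 ▸ hr1')
  obtain ⟨y0, hy0⟩ := lt_iSup_iff.mp (hg1 ▸ hr1')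
  have e : ∀ {c : ℝ}, 0 < c → ∀ {k : ℝ → ℝ≥0∞}, ENNReal.ofReal c *
      volume {x | ENNReal.ofReal r < k x}
      = volume ((fun x => c * x) '' {x | ENNReal.ofReal r < k x}) := by
    intro c hc k
    rw [volume_const_mul_image, abs_of_pos hc]
  rw [e hs, e ht]
  have mi : ∀ {c : ℝ}, 0 < c → ∀ {A : Set ℝ}, MeasurableSet A →
      MeasurableSet ((fun x => c * x) '' A) := by
    intro c hc A hA
    exact (measurableEmbedding_mulLeft₀ hc.ne').measurableSet_image.mpr hA
  refine volume_add_le_of_measurableSet (mi hs (measurableSet_lt measurable_const hf))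
    (mi ht (measurableSet_lt measurable_const hg)) (Set.Nonempty.image _ ⟨x0, hx0⟩)
    (Set.Nonempty.image _ ⟨y0, hy0⟩) ?_
  rintro _ ⟨x, hx, rfl⟩ _ ⟨y, hy, rfl⟩
  refine lt_min (lt_of_lt_of_le ?_ (H x y)) hr1'
  have hr00 : ENNReal.ofReal r ≠ 0 := by simpa using hr0
  calc ENNReal.ofReal r = ENNReal.ofReal r ^ s * ENNReal.ofReal r ^ t := by
        rw [← ENNReal.rpow_add _ _ hr00 ENNReal.ofReal_ne_top, hst, ENNReal.rpow_one]
    _ < f x ^ s * g y ^ t :=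
        ENNReal.mul_lt_mul (ENNReal.rpow_lt_rpow hx hs) (ENNReal.rpow_lt_rpow hy ht)

theorem rpow_mul_rpow_le_add (a b : ℝ≥0∞) {s t : ℝ} (hs : 0 < s) (ht : 0 < t)
    (hst : s + t = 1) : a ^ s * b ^ t ≤ ENNReal.ofReal s * a + ENNReal.ofReal t * b := by
  have hpq : (s⁻¹).HolderConjugate t⁻¹ := by
    refine Real.HolderConjugate.inv_inv hs ht hst
  have := ENNReal.young_inequality (a ^ s) (b ^ t) hpq
  rw [← ENNReal.rpow_mul, ← ENNReal.rpow_mul, mul_inv_cancel₀ hs.ne', mul_inv_cancel₀ ht.ne',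
    ENNReal.rpow_one, ENNReal.rpow_one, div_eq_mul_inv, div_eq_mul_inv,
    ← ENNReal.ofReal_inv_of_pos (inv_pos.mpr hs), ← ENNReal.ofReal_inv_of_pos (inv_pos.mpr ht),
    inv_inv, inv_inv] at this
  rwa [mul_comm a, mul_comm b] at this

theorem prekopa_leindler_real_of_bounded {f g h : ℝ → ℝ≥0∞} (hf : Measurable f)
    (hg : Measurable g) (hh : Measurable h) {s t : ℝ} (hs : 0 < s) (ht : 0 < t)
    (hst : s + t = 1) (H : ∀ x y, f x ^ s * g y ^ t ≤ h (s * x + t * y))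
    (hfb : ⨆ x, f x ≠ ∞) (hgb : ⨆ x, g x ≠ ∞) :
    (∫⁻ x, f x) ^ s * (∫⁻ x, g x) ^ t ≤ ∫⁻ x, h x := by
  set a := ⨆ x, f x with ha
  set b := ⨆ x, g x with hb
  rcases eq_or_ne a 0 with ha0 | ha0
  · have : ∀ x, f x = 0 := fun x => le_antisymm (ha0 ▸ le_iSup f x) bot_le
    simp [this, ENNReal.zero_rpow_of_pos hs]
  rcases eq_or_ne b 0 with hb0 | hb0
  · have : ∀ x, g x = 0 := fun x => le_antisymm (hb0 ▸ le_iSup g x) bot_le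
    simp [this, ENNReal.zero_rpow_of_pos ht]
  have hs0 := hs.le
  have ht0 := ht.le
  have hane : a ^ s ≠ 0 := by simp [ENNReal.rpow_eq_zero_iff, ha0, hs0]
  have hane' : a ^ s ≠ ∞ := ENNReal.rpow_ne_top_of_nonneg hs0 hfb
  have hbne : b ^ t ≠ 0 := by simp [ENNReal.rpow_eq_zero_iff, hb0, ht0]
  have hbne' : b ^ t ≠ ∞ := ENNReal.rpow_ne_top_of_nonneg ht0 hgb
  have key := lintegral_add_le_of_iSup_eq_one (f := fun x => a⁻¹ * f x) (g := fun x => b⁻¹ * g x)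
    (h := fun x => (a ^ s)⁻¹ * ((b ^ t)⁻¹ * h x)) (hf.const_mul _) (hg.const_mul _)
    ((hh.const_mul _).const_mul _) hs ht hst ?_ ?_ ?_
  · rw [lintegral_const_mul _ hf, lintegral_const_mul _ hg,
      lintegral_const_mul _ (hh.const_mul _), lintegral_const_mul _ hh] at key
    have k2 := (rpow_mul_rpow_le_add (a⁻¹ * ∫⁻ x, f x) (b⁻¹ * ∫⁻ x, g x) hs ht hst).trans key
    rw [ENNReal.mul_rpow_of_nonneg _ _ hs0, ENNReal.mul_rpow_of_nonneg _ _ ht0,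
      ENNReal.inv_rpow, ENNReal.inv_rpow] at k2
    calc (∫⁻ x, f x) ^ s * (∫⁻ x, g x) ^ t
        = (a ^ s * (a ^ s)⁻¹) * (b ^ t * (b ^ t)⁻¹) * ((∫⁻ x, f x) ^ s * (∫⁻ x, g x) ^ t) := by
          rw [ENNReal.mul_inv_cancel hane hane', ENNReal.mul_inv_cancel hbne hbne']; simp
      _ = a ^ s * b ^ t * ((a ^ s)⁻¹ * (∫⁻ x, f x) ^ s * ((b ^ t)⁻¹ * (∫⁻ x, g x) ^ t)) := by ring
      _ ≤ a ^ s * b ^ t * ((a ^ s)⁻¹ * ((b ^ t)⁻¹ * ∫⁻ x, h x)) := by gcongr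
      _ = (a ^ s * (a ^ s)⁻¹) * (b ^ t * (b ^ t)⁻¹) * (∫⁻ x, h x) := by ring
      _ = ∫⁻ x, h x := by
          rw [ENNReal.mul_inv_cancel hane hane', ENNReal.mul_inv_cancel hbne hbne']; simp
  · intro x y
    rw [ENNReal.mul_rpow_of_nonneg _ _ hs0, ENNReal.mul_rpow_of_nonneg _ _ ht0,
      ENNReal.inv_rpow, ENNReal.inv_rpow]
    calc _ = (a ^ s)⁻¹ * ((b ^ t)⁻¹ * (f x ^ s * g y ^ t)) := by ring
      _ ≤ _ := by gcongr; exact H x y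
  · rw [← ENNReal.mul_iSup, ← ha, ENNReal.inv_mul_cancel ha0 hfb]
  · rw [← ENNReal.mul_iSup, ← hb, ENNReal.inv_mul_cancel hb0 hgb]

theorem tendsto_lintegral_min_natCast {α : Type*} [MeasurableSpace α] {μ : Measure α}
    {f : α → ℝ≥0∞} (hf : Measurable f) :
    Tendsto (fun k : ℕ => ∫⁻ x, min (f x) k ∂μ) atTop (𝓝 (∫⁻ x, f x ∂μ)) := by
  refine lintegral_tendsto_of_tendsto_of_monotone
    (fun k => (hf.min measurable_const).aemeasurable) ?_ ?_
  · refine Eventually.of_forall fun x k l hkl => ?_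
    exact min_le_min_left _ (by exact_mod_cast hkl)
  · refine Eventually.of_forall fun x => ?_
    have : Tendsto (fun k : ℕ => min (f x) (k : ℝ≥0∞)) atTop (𝓝 (min (f x) ∞)) :=
      tendsto_const_nhds.min ENNReal.tendsto_nat_nhds_top
    simpa using this

theorem prekopa_leindler_real {f g h : ℝ → ℝ≥0∞} (hf : Measurable f)
    (hg : Measurable g) (hh : Measurable h) {s t : ℝ} (hs : 0 < s) (ht : 0 < t)
    (hst : s + t = 1) (H : ∀ x y, f x ^ s * g y ^ t ≤ h (s * x + t * y)) :
    (∫⁻ x, f x) ^ s * (∫⁻ x, g x) ^ t ≤ ∫⁻ x, h x := by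
  rcases eq_or_ne (∫⁻ x, f x) 0 with h0 | h0
  · simp [h0, ENNReal.zero_rpow_of_pos hs]
  rcases eq_or_ne (∫⁻ x, g x) 0 with h0' | h0'
  · simp [h0', ENNReal.zero_rpow_of_pos ht]
  have t1 := (ENNReal.continuous_rpow_const (y := s)).continuousAt.tendsto.comp
    (tendsto_lintegral_min_natCast (μ := volume) hf)
  have t2 := (ENNReal.continuous_rpow_const (y := t)).continuousAt.tendsto.comp
    (tendsto_lintegral_min_natCast (μ := volume) hg)
  refine le_of_tendsto' (ENNReal.Tendsto.mul t1 (Or.inl ?_) t2 (Or.inl ?_)) fun k => ?_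
  · simp [ENNReal.rpow_eq_zero_iff, h0, hs.le]
  · simp [ENNReal.rpow_eq_zero_iff, h0', ht.le]
  · have hb : ∀ u : ℝ → ℝ≥0∞, ⨆ x, min (u x) (k : ℝ≥0∞) ≠ ∞ := fun u =>
      ne_top_of_le_ne_top (ENNReal.natCast_ne_top k) (iSup_le fun x => min_le_right _ _)
    refine prekopa_leindler_real_of_bounded (hf.min measurable_const) (hg.min measurable_const)
      hh hs ht hst (fun x y => le_trans ?_ (H x y)) (hb f) (hb g)
    gcongr <;> exact min_le_left _ _

theorem prekopa_leindler_pi {s t : ℝ} (hs : 0 < s) (ht : 0 < t) (hst : s + t = 1) (n : ℕ)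
    {f g h : (Fin n → ℝ) → ℝ≥0∞} (hf : Measurable f) (hg : Measurable g) (hh : Measurable h)
    (H : ∀ x y, f x ^ s * g y ^ t ≤ h (s • x + t • y)) :
    (∫⁻ x, f x) ^ s * (∫⁻ x, g x) ^ t ≤ ∫⁻ x, h x := by
  induction n with
  | zero =>
    have e : ∀ k : (Fin 0 → ℝ) → ℝ≥0∞, ∫⁻ x, k x = k 0 := by
      intro k
      rw [lintegral_unique, Measure.volume_pi_eq_dirac (0 : Fin 0 → ℝ)]
      simp only [measure_univ, mul_one]
      exact congrArg k (Subsingleton.elim _ _)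
    rw [e, e, e]
    simpa using H 0 0
  | succ n ih =>
    have e : ∀ {k : (Fin (n + 1) → ℝ) → ℝ≥0∞}, Measurable k →
        ∫⁻ x, k x = ∫⁻ a : ℝ, ∫⁻ y : Fin n → ℝ, k (Fin.cons a y) := by
      intro k hk
      have mp := (volume_preserving_piFinSuccAbove (fun _ : Fin (n + 1) => ℝ) 0).symm
      rw [← mp.lintegral_comp hk, Measure.volume_eq_prod, lintegral_prod _ ?_]
      · refine lintegral_congr fun a => lintegral_congr fun y => ?_
        simp [MeasurableEquiv.piFinSuccAbove, Fin.consEquiv]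
      · exact (hk.comp mp.measurable).aemeasurable
    have hm : ∀ {k : (Fin (n + 1) → ℝ) → ℝ≥0∞}, Measurable k →
        Measurable fun z : ℝ × (Fin n → ℝ) => k (Fin.cons z.1 z.2) := by
      intro k hk
      refine hk.comp (measurable_pi_lambda _ fun i => ?_)
      refine Fin.cases ?_ (fun i => ?_) i
      · simpa using measurable_fst
      · simp only [Fin.cons_succ]
        exact (measurable_pi_apply i).comp measurable_snd
    rw [e hf, e hg, e hh]
    refine prekopa_leindler_real (hm hf).lintegral_prod_right' (hm hg).lintegral_prod_right'
      (hm hh).lintegral_prod_right' hs ht hst fun a b => ?_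
    refine ih ((hm hf).comp measurable_prodMk_left) ((hm hg).comp measurable_prodMk_left)
      ((hm hh).comp measurable_prodMk_left) fun x y => ?_
    refine (H _ _).trans (le_of_eq ?_)
    congr 1
    ext i
    refine Fin.cases ?_ (fun i => ?_) i <;> simp

end PrekopaLeindler

section BrunnMinkowskiEuclidean
open Set Filter Topology
open scoped ENNReal Pointwise

theorem prekopa_leindler_euclidean {s t : ℝ} (hs : 0 < s) (ht : 0 < t) (hst : s + t = 1) {n : ℕ}
    {f g h : EuclideanSpace ℝ (Fin n) → ℝ≥0∞} (hf : Measurable f) (hg : Measurable g)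
    (hh : Measurable h) (H : ∀ x y, f x ^ s * g y ^ t ≤ h (s • x + t • y)) :
    (∫⁻ x, f x) ^ s * (∫⁻ x, g x) ^ t ≤ ∫⁻ x, h x := by
  have mp := EuclideanSpace.volume_preserving_symm_measurableEquiv_toLp (Fin n)
  have mp' := mp.symm
  rw [← mp'.lintegral_comp hf, ← mp'.lintegral_comp hg, ← mp'.lintegral_comp hh]
  refine prekopa_leindler_pi hs ht hst n (hf.comp mp'.measurable) (hg.comp mp'.measurable)
    (hh.comp mp'.measurable) fun x y => ?_
  exact H _ _

theorem volume_ge_of_smul_add_subset {n : ℕ} {A B C : Set (EuclideanSpace ℝ (Fin n))}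
    (hA : MeasurableSet A) (hB : MeasurableSet B) (hC : MeasurableSet C) {s t : ℝ}
    (hs : 0 < s) (ht : 0 < t) (hst : s + t = 1) (hA1 : volume A = 1) (hB1 : volume B = 1)
    (h : ∀ x ∈ A, ∀ y ∈ B, s • x + t • y ∈ C) : 1 ≤ volume C := by
  have := prekopa_leindler_euclidean hs ht hst (measurable_one.indicator hA)
    (measurable_one.indicator hB) (measurable_one.indicator hC) (fun x y => ?_)
  · simpa [lintegral_indicator_one, hA, hB, hC, hA1, hB1] using this
  · by_cases hx : x ∈ A
    · by_cases hy : y ∈ B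
      · simp [hx, hy, h x hx y hy]
      · simp [hy, ht]
    · simp [hx, hs]

theorem volume_thickening_ge {n : ℕ} {A : Set (EuclideanSpace ℝ (Fin n))} (hA : MeasurableSet A)
    {α w ε : ℝ} (hα : 0 < α) (hw : 0 < w) (hε : 0 < ε)
    (hAv : volume A = ENNReal.ofReal (α ^ n))
    (hBv : volume (Metric.ball (0 : EuclideanSpace ℝ (Fin n)) 1) = ENNReal.ofReal (w ^ n)) :
    ENNReal.ofReal ((α + ε * w) ^ n) ≤ volume (Metric.thickening ε A) := by
  set β := ε * w with hβ
  have hβ0 : 0 < β := by positivity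
  have hsc : ∀ {c : ℝ}, 0 < c → ∀ S : Set (EuclideanSpace ℝ (Fin n)),
      volume (c⁻¹ • S) = ENNReal.ofReal (c⁻¹ ^ n) * volume S := by
    intro c hc S
    rw [Measure.addHaar_smul, finrank_euclideanSpace_fin, abs_of_pos (by positivity)]
  have hone : ∀ {c : ℝ}, 0 < c → ENNReal.ofReal (c⁻¹ ^ n) * ENNReal.ofReal (c ^ n) = 1 := by
    intro c hc
    rw [← ENNReal.ofReal_mul (by positivity), ← mul_pow, inv_mul_cancel₀ hc.ne', one_pow,
      ENNReal.ofReal_one]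
  have hball : volume (Metric.ball (0 : EuclideanSpace ℝ (Fin n)) ε) = ENNReal.ofReal (β ^ n) := by
    rw [Measure.addHaar_ball_of_pos _ _ hε, hBv, finrank_euclideanSpace_fin,
      ← ENNReal.ofReal_mul (by positivity), hβ, mul_pow]
  have key := volume_ge_of_smul_add_subset (A := α⁻¹ • A)
    (B := β⁻¹ • Metric.ball (0 : EuclideanSpace ℝ (Fin n)) ε)
    (C := (α + β)⁻¹ • Metric.thickening ε A) (s := α / (α + β)) (t := β / (α + β))
    (hA.const_smul₀ _) (measurableSet_ball.const_smul₀ _)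
    (Metric.isOpen_thickening.measurableSet.const_smul₀ _)
    (by positivity) (by positivity) (by field_simp) (by rw [hsc hα, hAv, hone hα])
    (by rw [hsc hβ0, hball, hone hβ0]) ?_
  · rw [hsc (by positivity)] at key
    calc ENNReal.ofReal ((α + β) ^ n) ≤ ENNReal.ofReal ((α + β) ^ n) *
          (ENNReal.ofReal ((α + β)⁻¹ ^ n) * volume (Metric.thickening ε A)) :=
          le_mul_of_one_le_right' key
      _ = (ENNReal.ofReal ((α + β)⁻¹ ^ n) * ENNReal.ofReal ((α + β) ^ n)) *
          volume (Metric.thickening ε A) := by ring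
      _ = _ := by rw [hone (by positivity), one_mul]
  · rintro _ ⟨x, hx, rfl⟩ _ ⟨y, hy, rfl⟩
    refine ⟨x + y, ?_, ?_⟩
    · rw [Metric.mem_thickening_iff]
      refine ⟨x, hx, ?_⟩
      simpa [dist_eq_norm] using hy
    · simp only [smul_smul, smul_add]
      congr 2 <;> field_simp

end BrunnMinkowskiEuclidean

section Isoperimetric
open Set Filter Topology
open scoped ENNReal Pointwise

theorem measure_le_of_forall_isClosed {ν₁ ν₂ : Measure ℝ} [IsFiniteMeasure ν₁]
    (h : ∀ F, IsClosed F → ν₁ F ≤ ν₂ F) : ν₁ ≤ ν₂ := by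
  refine Measure.le_iff.mpr fun A hA => ?_
  rw [hA.measure_eq_iSup_isClosed_of_ne_top (measure_ne_top _ _)]
  exact iSup₂_le fun F hFA => iSup_le fun hF => (h F hF).trans (measure_mono hFA)

theorem le_volume_thickening_diff {n : ℕ} (hn : 2 ≤ n) {A : Set (EuclideanSpace ℝ (Fin n))}
    (hA : MeasurableSet A) (hAf : volume A ≠ ∞) {w ε : ℝ} (hw : 0 < w) (hε : 0 < ε)
    (hBv : volume (Metric.ball (0 : EuclideanSpace ℝ (Fin n)) 1) = ENNReal.ofReal (w ^ n)) :
    ENNReal.ofReal ε * (ENNReal.ofReal (n * w) * volume A ^ (1 - 1 / (n : ℝ))) ≤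
      volume (Metric.thickening ε A \ A) := by
  have hn0 : (0 : ℝ) < n := by positivity
  have hn2 : (2 : ℝ) ≤ n := by exact_mod_cast hn
  have he : 0 < 1 - 1 / (n : ℝ) := by
    rw [sub_pos, div_lt_one hn0]; linarith
  rcases eq_or_ne (volume A) 0 with h0 | h0
  · rw [h0, ENNReal.zero_rpow_of_pos he]; simp
  set α := (volume A).toReal ^ (1 / (n : ℝ)) with hα
  have hpos : 0 < (volume A).toReal := ENNReal.toReal_pos h0 hAf
  have hα0 : 0 < α := by positivity
  have hαn : α ^ n = (volume A).toReal := by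
    rw [hα, ← Real.rpow_natCast, ← Real.rpow_mul hpos.le, one_div, inv_mul_cancel₀ hn0.ne',
      Real.rpow_one]
  have hAv : volume A = ENNReal.ofReal (α ^ n) := by rw [hαn, ENNReal.ofReal_toReal hAf]
  have key := volume_thickening_ge hA hα0 hw hε hAv hBv
  have hpow : volume A ^ (1 - 1 / (n : ℝ)) = ENNReal.ofReal (α ^ (n - 1)) := by
    rw [hAv, ENNReal.ofReal_rpow_of_pos (by positivity), ← Real.rpow_natCast, ← Real.rpow_natCast,
      ← Real.rpow_mul hα0.le, Nat.cast_sub (by omega), Nat.cast_one]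
    congr 2
    field_simp
  rw [measure_sdiff (Metric.self_subset_thickening hε A) hA.nullMeasurableSet hAf]
  refine ENNReal.le_sub_of_add_le_right hAf (le_trans ?_ key)
  rw [hpow, hAv, ← ENNReal.ofReal_mul (by positivity), ← ENNReal.ofReal_mul (by positivity),
    ← ENNReal.ofReal_add (by positivity) (by positivity)]
  apply ENNReal.ofReal_le_ofReal
  have hbern := one_add_mul_le_pow (a := ε * w / α)
    (le_trans (by norm_num) (show 0 ≤ ε * w / α by positivity)) n
  have hsplit : (α + ε * w) ^ n = α ^ n * (1 + ε * w / α) ^ n := by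
    rw [← mul_pow]; congr 1; field_simp
  have hαs : α ^ n = α ^ (n - 1) * α := by
    rw [← pow_succ]; congr 1; omega
  rw [hsplit]
  refine le_trans (le_of_eq ?_) (mul_le_mul_of_nonneg_left hbern (by positivity))
  rw [hαs]; field_simp; ring

variable {n : ℕ} {f G : EuclideanSpace ℝ (Fin n) → ℝ}

theorem measurableSet_thickened_levels (hf : Continuous f) {F : Set ℝ} (hF : IsClosed F) (ε : ℝ) :
    MeasurableSet {p : EuclideanSpace ℝ (Fin n) × ℝ | p.2 ∈ F ∧ 0 < p.2 ∧ f p.1 ≤ p.2 ∧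
      ∃ y, dist p.1 y < ε ∧ p.2 < f y} := by
  have ho : IsOpen {p : EuclideanSpace ℝ (Fin n) × ℝ | ∃ y, dist p.1 y < ε ∧ p.2 < f y} := by
    rw [show {p : EuclideanSpace ℝ (Fin n) × ℝ | ∃ y, dist p.1 y < ε ∧ p.2 < f y} =
      ⋃ y, {p | dist p.1 y < ε ∧ p.2 < f y} by ext; simp]
    refine isOpen_iUnion fun y => ?_
    exact (isOpen_lt (continuous_fst.dist continuous_const) continuous_const).inter
      (isOpen_lt continuous_snd continuous_const)
  have h1 : MeasurableSet {p : EuclideanSpace ℝ (Fin n) × ℝ | p.2 ∈ F} :=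
    measurable_snd hF.measurableSet
  have h2 : MeasurableSet {p : EuclideanSpace ℝ (Fin n) × ℝ | 0 < p.2} :=
    measurableSet_lt measurable_const measurable_snd
  have h3 : MeasurableSet {p : EuclideanSpace ℝ (Fin n) × ℝ | f p.1 ≤ p.2} :=
    measurableSet_le (hf.measurable.comp measurable_fst) measurable_snd
  exact h1.inter (h2.inter (h3.inter ho.measurableSet))

theorem limsup_volume_levels_le (hf : Continuous f) (hG0 : ∀ x, 0 ≤ G x)
    {x : EuclideanSpace ℝ (Fin n)}
    (hslope : ∀ η > 0, ∀ᶠ ε in 𝓝[>] (0 : ℝ), ∀ y, dist x y < ε → f y ≤ f x + ε * (G x + η))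
    {F : Set ℝ} (hF : IsClosed F) :
    limsup (fun k : ℕ => ((k : ℝ≥0∞) + 1) * volume {t | t ∈ F ∧ 0 < t ∧ f x ≤ t ∧
      ∃ y, dist x y < 1 / ((k : ℝ) + 1) ∧ t < f y}) atTop ≤
      (f ⁻¹' F).indicator (fun x => ENNReal.ofReal (G x)) x := by
  have hlim : Tendsto (fun k : ℕ => 1 / ((k : ℝ) + 1)) atTop (𝓝[>] 0) :=
    tendsto_nhdsWithin_iff.mpr ⟨tendsto_one_div_add_atTop_nhds_zero_nat,
      Eventually.of_forall fun k => by simp only [mem_Ioi]; positivity⟩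
  by_cases hx : f x ∈ F
  · rw [indicator_of_mem (by exact hx)]
    refine ENNReal.le_of_forall_pos_le_add fun η hη _ => ?_
    refine limsup_le_of_le (by isBoundedDefault) ?_
    filter_upwards [hlim.eventually (hslope η hη)] with k hk
    have hsub : {t | t ∈ F ∧ 0 < t ∧ f x ≤ t ∧ ∃ y, dist x y < 1 / ((k : ℝ) + 1) ∧ t < f y} ⊆
        Icc (f x) (f x + 1 / ((k : ℝ) + 1) * (G x + η)) := by
      rintro t ⟨_, _, h3, y, hy, hty⟩
      exact ⟨h3, hty.le.trans (hk y hy)⟩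
    have hk1 : (0 : ℝ) < (k : ℝ) + 1 := by positivity
    calc ((k : ℝ≥0∞) + 1) * volume _
        ≤ ((k : ℝ≥0∞) + 1) * volume (Icc (f x) (f x + 1 / ((k : ℝ) + 1) * (G x + η))) := by
          gcongr
      _ = ENNReal.ofReal ((k : ℝ) + 1) * ENNReal.ofReal (1 / ((k : ℝ) + 1) * (G x + η)) := by
          rw [Real.volume_Icc, ENNReal.ofReal_add (by positivity) zero_le_one,
              ENNReal.ofReal_natCast,
            ENNReal.ofReal_one]
          congr 2
          ring
      _ = ENNReal.ofReal (G x) + η := by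
          rw [← ENNReal.ofReal_mul hk1.le, ← mul_assoc, mul_one_div_cancel hk1.ne', one_mul,
            ENNReal.ofReal_add (hG0 x) (by positivity), ENNReal.ofReal_coe_nnreal]
  · rw [indicator_of_notMem (by exact hx)]
    obtain ⟨r, hr, hrF⟩ := Metric.isOpen_iff.mp hF.isOpen_compl (f x) hx
    obtain ⟨δ, hδ, hδf⟩ := Metric.continuousAt_iff.mp hf.continuousAt r hr
    refine limsup_le_of_le (by isBoundedDefault) ?_
    have hev : ∀ᶠ k : ℕ in atTop, 1 / ((k : ℝ) + 1) < δ :=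
      tendsto_one_div_add_atTop_nhds_zero_nat.eventually (gt_mem_nhds hδ)
    filter_upwards [hev] with k hk
    have hsub : {t | t ∈ F ∧ 0 < t ∧ f x ≤ t ∧
        ∃ y, dist x y < 1 / ((k : ℝ) + 1) ∧ t < f y} ⊆ ∅ := by
      rintro t ⟨h1, _, h3, y, hy, hty⟩
      have h4 := hδf (show dist y x < δ by rw [dist_comm]; exact hy.trans hk)
      refine hrF ?_ h1
      rw [Metric.mem_ball, Real.dist_eq, abs_of_nonneg (by linarith)]
      rw [Real.dist_eq] at h4
      linarith [le_abs_self (f y - f x)]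
    rw [measure_mono_null hsub measure_empty, mul_zero]

theorem setLIntegral_level_rpow_le (hn : 2 ≤ n) {w : ℝ} (hw : 0 < w)
    (hBv : volume (Metric.ball (0 : EuclideanSpace ℝ (Fin n)) 1) = ENNReal.ofReal (w ^ n))
    {K : NNReal} (hf : LipschitzWith K f) {R : ℝ}
    (hfs : ∀ x, R ≤ ‖x‖ → f x = 0) (hG0 : ∀ x, 0 ≤ G x)
    (hslope : ∀ x, ∀ η > 0, ∀ᶠ ε in 𝓝[>] (0 : ℝ), ∀ y, dist x y < ε → f y ≤ f x + ε * (G x + η))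
    {F : Set ℝ} (hF : IsClosed F) :
    ∫⁻ t in Ioi (0 : ℝ) ∩ F, ENNReal.ofReal (n * w) * volume {x | t < f x} ^ (1 - 1 / (n : ℝ)) ≤
      ∫⁻ x in f ⁻¹' F, ENNReal.ofReal (G x) := by
  have hfc := hf.continuous
  set P : ℕ → Set (EuclideanSpace ℝ (Fin n) × ℝ) := fun k =>
    {p | p.2 ∈ F ∧ 0 < p.2 ∧ f p.1 ≤ p.2 ∧ ∃ y, dist p.1 y < 1 / ((k : ℝ) + 1) ∧ p.2 < f y} with hP
  have hPm : ∀ k, MeasurableSet (P k) := fun k => measurableSet_thickened_levels hfc hF _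
  have hfin : ∀ t, 0 < t → volume {x | t < f x} ≠ ∞ := by
    intro t ht
    refine ne_top_of_le_ne_top (measure_ball_lt_top (x := 0) (r := R)).ne
      (measure_mono fun x hx => ?_)
    by_contra hcon
    simp only [Metric.mem_ball, dist_zero_right, not_lt] at hcon
    have := hfs x hcon
    simp only [mem_ofPred_eq] at hx
    linarith
  have hstep : ∀ k : ℕ, ∫⁻ t in Ioi (0 : ℝ) ∩ F,
      ENNReal.ofReal (n * w) * volume {x | t < f x} ^ (1 - 1 / (n : ℝ)) ≤
      ∫⁻ x, ((k : ℝ≥0∞) + 1) * volume (Prod.mk x ⁻¹' P k) := by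
    intro k
    have hk1 : (0 : ℝ) < 1 / ((k : ℝ) + 1) := by positivity
    have hkc : ((k : ℝ≥0∞) + 1) * ENNReal.ofReal (1 / ((k : ℝ) + 1)) = 1 := by
      rw [show ((k : ℝ≥0∞) + 1) = ENNReal.ofReal ((k : ℝ) + 1) by
        rw [ENNReal.ofReal_add (by positivity) zero_le_one]; simp,
        ← ENNReal.ofReal_mul (by positivity), mul_one_div_cancel (by positivity),
        ENNReal.ofReal_one]
    rw [lintegral_const_mul _ (measurable_measure_prodMk_left (hPm k)),
        ← Measure.prod_apply (hPm k),
      Measure.prod_apply_symm (hPm k),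
      ← lintegral_const_mul _ (measurable_measure_prodMk_right (hPm k)),
      ← lintegral_indicator (measurableSet_Ioi.inter hF.measurableSet)]
    refine lintegral_mono fun t => ?_
    by_cases ht : t ∈ Ioi (0 : ℝ) ∩ F
    · rw [indicator_of_mem ht]
      have h1 := le_volume_thickening_diff hn (A := {x | t < f x})
        (measurableSet_lt measurable_const hfc.measurable) (hfin t ht.1) hw hk1 hBv
      have h2 : Metric.thickening (1 / ((k : ℝ) + 1)) {x | t < f x} \ {x | t < f x} ⊆
          (fun x => (x, t)) ⁻¹' P k := by
        rintro x ⟨hx1, hx2⟩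
        obtain ⟨y, hy, hxy⟩ := Metric.mem_thickening_iff.mp hx1
        exact ⟨ht.2, ht.1, not_lt.mp hx2, y, hxy, hy⟩
      calc _ = ((k : ℝ≥0∞) + 1) * ENNReal.ofReal (1 / ((k : ℝ) + 1)) *
            (ENNReal.ofReal (n * w) * volume {x | t < f x} ^ (1 - 1 / (n : ℝ))) := by
            rw [hkc, one_mul]
        _ ≤ _ := by
            rw [mul_assoc]
            gcongr
            exact h1.trans (measure_mono h2)
    · rw [indicator_of_notMem ht]
      exact bot_le
  rw [← lintegral_indicator (hfc.measurable hF.measurableSet)]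
  refine le_trans ?_ (lintegral_mono fun x => limsup_volume_levels_le hfc hG0 (hslope x) hF)
  refine le_trans ?_ (limsup_lintegral_le
    ((Metric.ball (0 : EuclideanSpace ℝ (Fin n)) (R + 1)).indicator fun _ => ENNReal.ofReal K)
    (fun k => (measurable_measure_prodMk_left (hPm k)).const_mul _) ?_ ?_)
  · exact le_limsup_of_frequently_le (Frequently.of_forall hstep) (by isBoundedDefault)
  · intro k
    refine Eventually.of_forall fun x => ?_
    have hk0 : (0 : ℝ) < (k : ℝ) + 1 := by positivity
    have hk1 : 1 / ((k : ℝ) + 1) ≤ 1 := by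
      rw [div_le_one hk0]; linarith [(Nat.cast_nonneg k : (0 : ℝ) ≤ k)]
    by_cases hx : x ∈ Metric.ball (0 : EuclideanSpace ℝ (Fin n)) (R + 1)
    · rw [indicator_of_mem hx]
      have hsub : Prod.mk x ⁻¹' P k ⊆ Icc (f x) (f x + K * (1 / ((k : ℝ) + 1))) := by
        rintro t ⟨_, _, h3, y, hy, hty⟩
        refine ⟨h3, ?_⟩
        have h5 := hf.dist_le_mul y x
        rw [Real.dist_eq, dist_comm y x] at h5
        have h6 : (K : ℝ) * dist x y ≤ K * (1 / ((k : ℝ) + 1)) := by gcongr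
        simp only at hty
        linarith [le_abs_self (f y - f x)]
      calc ((k : ℝ≥0∞) + 1) * volume (Prod.mk x ⁻¹' P k)
          ≤ ((k : ℝ≥0∞) + 1) * volume (Icc (f x) (f x + K * (1 / ((k : ℝ) + 1)))) := by gcongr
        _ = ENNReal.ofReal ((k : ℝ) + 1) * ENNReal.ofReal (K * (1 / ((k : ℝ) + 1))) := by
            rw [Real.volume_Icc, ENNReal.ofReal_add (by positivity) zero_le_one,
              ENNReal.ofReal_natCast, ENNReal.ofReal_one]
            congr 2
            ring
        _ = ENNReal.ofReal K := by
            rw [← ENNReal.ofReal_mul hk0.le]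
            congr 1
            field_simp
        _ ≤ _ := le_rfl
    · have hsub : Prod.mk x ⁻¹' P k ⊆ ∅ := by
        rintro t ⟨_, h2, h3, y, hy, hty⟩
        simp only [Metric.mem_ball, dist_zero_right, not_lt] at hx
        have h7 : R ≤ ‖y‖ := by
          have : ‖x‖ ≤ ‖y‖ + dist x y := by
            rw [dist_eq_norm]; linarith [norm_sub_norm_le x y]
          simp only at hy
          linarith
        have := hfs y h7
        simp only at hty h2
        linarith
      have h8 : volume (Prod.mk x ⁻¹' P k) = 0 := measure_mono_null hsub measure_empty
      change _ * volume (Prod.mk x ⁻¹' P k) ≤ _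
      rw [h8, mul_zero]
      exact bot_le
  · rw [lintegral_indicator measurableSet_ball, setLIntegral_const]
    exact ENNReal.mul_ne_top ENNReal.ofReal_ne_top measure_ball_lt_top.ne

theorem lintegral_level_rpow_mul_le (hn : 2 ≤ n) {w : ℝ} (hw : 0 < w)
    (hBv : volume (Metric.ball (0 : EuclideanSpace ℝ (Fin n)) 1) = ENNReal.ofReal (w ^ n))
    {K : NNReal} (hf : LipschitzWith K f) {R : ℝ}
    (hfs : ∀ x, R ≤ ‖x‖ → f x = 0) (hG0 : ∀ x, 0 ≤ G x) (hGm : Measurable G)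
    (hGi : ∫⁻ x, ENNReal.ofReal (G x) ≠ ∞)
    (hslope : ∀ x, ∀ η > 0, ∀ᶠ ε in 𝓝[>] (0 : ℝ), ∀ y, dist x y < ε → f y ≤ f x + ε * (G x + η))
    {h : ℝ → ℝ≥0∞} (hh : Measurable h) :
    ∫⁻ t in Ioi (0 : ℝ), ENNReal.ofReal (n * w) * volume {x | t < f x} ^ (1 - 1 / (n : ℝ)) * h t ≤
      ∫⁻ x, ENNReal.ofReal (G x) * h (f x) := by
  have hfc := hf.continuous
  have hVm : Measurable fun t : ℝ =>
      ENNReal.ofReal (n * w) * volume {x | t < f x} ^ (1 - 1 / (n : ℝ)) := by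
    have : Antitone fun t : ℝ => volume {x | t < f x} := fun t t' htt => measure_mono fun x hx =>
      lt_of_le_of_lt htt hx
    exact (this.measurable.pow_const _).const_mul _
  set ν₁ : Measure ℝ := (volume.restrict (Ioi 0)).withDensity fun t =>
      ENNReal.ofReal (n * w) * volume {x | t < f x} ^ (1 - 1 / (n : ℝ)) with hν₁
  set ν₂ : Measure ℝ := (volume.withDensity fun x => ENNReal.ofReal (G x)).map f with hν₂
  have hcl : ∀ F, IsClosed F → ν₁ F ≤ ν₂ F := by
    intro F hF
    rw [hν₁, hν₂, Measure.map_apply hfc.measurable hF.measurableSet,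
      withDensity_apply _ hF.measurableSet, withDensity_apply _ (hfc.measurable hF.measurableSet),
      Measure.restrict_restrict hF.measurableSet, inter_comm]
    exact setLIntegral_level_rpow_le hn hw hBv hf hfs hG0 hslope hF
  have : IsFiniteMeasure ν₁ := by
    refine ⟨lt_of_le_of_lt (hcl univ isClosed_univ) ?_⟩
    rw [hν₂, Measure.map_apply hfc.measurable MeasurableSet.univ, preimage_univ,
      withDensity_apply _ MeasurableSet.univ, setLIntegral_univ]
    exact hGi.lt_top
  have hle : ν₁ ≤ ν₂ := measure_le_of_forall_isClosed hcl
  have := lintegral_mono' hle (le_refl h)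
  have e : ∫⁻ x, h (f x) ∂(volume.withDensity fun x => ENNReal.ofReal (G x)) =
      ∫⁻ x, ENNReal.ofReal (G x) * h (f x) :=
    lintegral_withDensity_eq_lintegral_mul _ hGm.ennreal_ofReal (hh.comp hfc.measurable)
  rw [hν₁, hν₂, lintegral_map hh hfc.measurable,
    lintegral_withDensity_eq_lintegral_mul _ hVm hh, e] at this
  exact this

end Isoperimetric

section Polar
open Set Filter Topology
open scoped ENNReal Pointwise

variable {n : ℕ}

theorem lintegral_polar (hn : 1 ≤ n) {φ : EuclideanSpace ℝ (Fin n) → ℝ≥0∞} (hφ : Measurable φ) :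
    ∫⁻ x, φ x = ∫⁻ s, (∫⁻ r in Ioi (0 : ℝ), ENNReal.ofReal (r ^ (n - 1)) *
      φ (r • (s : EuclideanSpace ℝ (Fin n))))
        ∂(volume : Measure (EuclideanSpace ℝ (Fin n))).toSphere := by
  have : NeZero n := ⟨by omega⟩
  set μ : Measure (EuclideanSpace ℝ (Fin n)) := volume with hμ
  have hsc : Measurable fun z : Metric.sphere (0 : EuclideanSpace ℝ (Fin n)) 1 × Ioi (0 : ℝ) =>
      φ ((z.2 : ℝ) • (z.1 : EuclideanSpace ℝ (Fin n))) := by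
    apply hφ.comp
    fun_prop
  have h1 : ∫⁻ x, φ x ∂μ = ∫⁻ x : ({0}ᶜ : Set (EuclideanSpace ℝ (Fin n))), φ x ∂(μ.comap (↑)) := by
    rw [lintegral_subtype_comap (measurableSet_singleton _).compl, restrict_compl_singleton]
  have h2 := μ.measurePreserving_homeomorphUnitSphereProd.lintegral_comp hsc
  rw [h1]
  have h3 : ∀ x : ({0}ᶜ : Set (EuclideanSpace ℝ (Fin n))), φ x =
      φ (((homeomorphUnitSphereProd (EuclideanSpace ℝ (Fin n)) x).2 : ℝ) •
        ((homeomorphUnitSphereProd (EuclideanSpace ℝ (Fin n)) x).1 :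
          EuclideanSpace ℝ (Fin n))) := by
    intro x
    have hx : ‖(x : EuclideanSpace ℝ (Fin n))‖ ≠ 0 := norm_ne_zero_iff.mpr x.2
    simp [smul_smul, hx]
  rw [lintegral_congr h3, h2, lintegral_prod _ hsc.aemeasurable]
  refine lintegral_congr fun s => ?_
  have hpm : Measurable fun r : Ioi (0 : ℝ) => ENNReal.ofReal ((r : ℝ) ^ (n - 1)) := by fun_prop
  have hps : Measurable fun r : Ioi (0 : ℝ) => φ ((r : ℝ) • (s : EuclideanSpace ℝ (Fin n))) := by
    apply hφ.comp
    fun_prop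
  rw [finrank_euclideanSpace_fin, Measure.volumeIoiPow,
    lintegral_withDensity_eq_lintegral_mul _ hpm hps,
    ← lintegral_subtype_comap measurableSet_Ioi]
  rfl

theorem lintegral_radial (hn : 1 ≤ n) {φ : ℝ → ℝ≥0∞} (hφ : Measurable φ) :
    ∫⁻ x : EuclideanSpace ℝ (Fin n), φ ‖x‖ =
      (n * volume (Metric.ball (0 : EuclideanSpace ℝ (Fin n)) 1)) *
        ∫⁻ r in Ioi (0 : ℝ), ENNReal.ofReal (r ^ (n - 1)) * φ r := by
  rw [lintegral_polar (φ := fun x => φ ‖x‖) hn (hφ.comp measurable_norm)]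
  have : ∀ s : Metric.sphere (0 : EuclideanSpace ℝ (Fin n)) 1,
      ∫⁻ r in Ioi (0 : ℝ), ENNReal.ofReal (r ^ (n - 1)) *
        φ ‖r • (s : EuclideanSpace ℝ (Fin n))‖ =
      ∫⁻ r in Ioi (0 : ℝ), ENNReal.ofReal (r ^ (n - 1)) * φ r := by
    intro s
    refine setLIntegral_congr_fun measurableSet_Ioi fun r hr => ?_
    rw [norm_smul, Real.norm_of_nonneg (le_of_lt hr), norm_eq_of_mem_sphere, mul_one]
  rw [lintegral_congr this, lintegral_const, Measure.toSphere_apply_univ,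
      finrank_euclideanSpace_fin,
    mul_comm]

theorem lintegral_Ioi_rpow_substitution {m : ℝ} (hm : 0 < m) (g : ℝ → ℝ≥0∞) :
    ∫⁻ ρ in Ioi (0 : ℝ), g ρ =
      ∫⁻ r in Ioi (0 : ℝ), ENNReal.ofReal (m * r ^ (m - 1)) * g (r ^ m) := by
  have himg : (fun r : ℝ => r ^ m) '' Ioi 0 = Ioi 0 := by
    ext y
    constructor
    · rintro ⟨x, hx, rfl⟩
      exact Real.rpow_pos_of_pos hx m
    · intro hy
      exact ⟨y ^ m⁻¹, Real.rpow_pos_of_pos hy _, Real.rpow_inv_rpow (le_of_lt hy) hm.ne'⟩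
  have hd : ∀ x ∈ Ioi (0 : ℝ), HasDerivWithinAt (fun r : ℝ => r ^ m) (m * x ^ (m - 1)) (Ioi 0) x :=
    fun x hx => (Real.hasDerivAt_rpow_const (Or.inl (ne_of_gt hx))).hasDerivWithinAt
  have hinj : InjOn (fun r : ℝ => r ^ m) (Ioi 0) := fun x hx y hy h =>
    (Real.rpow_left_inj (le_of_lt hx) (le_of_lt hy) hm.ne').mp h
  have := lintegral_image_eq_lintegral_abs_deriv_mul measurableSet_Ioi hd hinj g
  rw [himg] at this
  rw [this]
  refine setLIntegral_congr_fun measurableSet_Ioi fun r hr => ?_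
  have : 0 ≤ m * r ^ (m - 1) := mul_nonneg hm.le (Real.rpow_nonneg (le_of_lt hr) _)
  simp only [abs_of_nonneg this]

/-- The radial map `y ↦ |y|^{m-1} y`. -/
def radialPow (m : ℝ) (y : EuclideanSpace ℝ (Fin n)) : EuclideanSpace ℝ (Fin n) :=
  ‖y‖ ^ (m - 1) • y

theorem measurable_radialPow (m : ℝ) : Measurable (radialPow (n := n) m) := by
  unfold radialPow
  fun_prop

theorem norm_radialPow {m : ℝ} (hm : 0 < m) (y : EuclideanSpace ℝ (Fin n)) :
    ‖radialPow m y‖ = ‖y‖ ^ m := by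
  rcases eq_or_ne y 0 with rfl | hy
  · simp [radialPow, Real.zero_rpow hm.ne']
  have h := norm_pos_iff.mpr hy
  rw [radialPow, norm_smul, Real.norm_of_nonneg (by positivity), Real.rpow_sub_one h.ne']
  field_simp

theorem lintegral_comp_radialPow (hn : 1 ≤ n) {m : ℝ} (hm : 0 < m)
    {φ : EuclideanSpace ℝ (Fin n) → ℝ≥0∞} (hφ : Measurable φ) :
    ∫⁻ x, φ x = ∫⁻ y, ENNReal.ofReal (m * ‖y‖ ^ (n * (m - 1))) * φ (radialPow m y) := by
  rw [lintegral_polar hn hφ, lintegral_polar hn (by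
    exact Measurable.mul (by fun_prop) (hφ.comp (measurable_radialPow (n := n) m)))]
  refine lintegral_congr fun s => ?_
  rw [lintegral_Ioi_rpow_substitution hm]
  refine setLIntegral_congr_fun measurableSet_Ioi fun r hr => ?_
  have hr0 : 0 < r := hr
  have hs : ‖r • (s : EuclideanSpace ℝ (Fin n))‖ = r := by
    rw [norm_smul, Real.norm_of_nonneg hr0.le, norm_eq_of_mem_sphere, mul_one]
  have e1 : radialPow m (r • (s : EuclideanSpace ℝ (Fin n))) =
      r ^ m • (s : EuclideanSpace ℝ (Fin n)) := by
    rw [radialPow, hs, smul_smul, Real.rpow_sub_one hr0.ne', div_mul_cancel₀ _ hr0.ne']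
  rw [hs, e1, ← mul_assoc, ← mul_assoc, ← ENNReal.ofReal_mul (by positivity),
    ← ENNReal.ofReal_mul (by positivity)]
  congr 2
  rw [← Real.rpow_natCast, ← Real.rpow_natCast, ← Real.rpow_mul hr0.le, mul_assoc,
    ← Real.rpow_add hr0, mul_left_comm, ← Real.rpow_add hr0, Nat.cast_sub hn, Nat.cast_one]
  congr 2
  ring

theorem setLIntegral_ball_norm_rpow (hn : 1 ≤ n) {c : ℝ} (hc : c < n) {R : ℝ} (hR : 0 ≤ R) :
    ∫⁻ x in Metric.ball (0 : EuclideanSpace ℝ (Fin n)) R, ENNReal.ofReal (‖x‖ ^ (-c)) =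
      (n * volume (Metric.ball (0 : EuclideanSpace ℝ (Fin n)) 1)) *
        ENNReal.ofReal (R ^ (n - c) / (n - c)) := by
  have hcn : (0 : ℝ) < n - c := by linarith
  have hm : Measurable ((Iio R).indicator fun r : ℝ => ENNReal.ofReal (r ^ (-c))) :=
    Measurable.indicator (by fun_prop) measurableSet_Iio
  have h := lintegral_radial hn hm
  rw [← lintegral_indicator measurableSet_ball]
  calc _ = ∫⁻ x : EuclideanSpace ℝ (Fin n),
        (Iio R).indicator (fun r : ℝ => ENNReal.ofReal (r ^ (-c))) ‖x‖ := by
        refine lintegral_congr fun x => ?_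
        by_cases hx : ‖x‖ < R
        · rw [indicator_of_mem (by simpa using hx), indicator_of_mem (by simpa using hx)]
        · rw [indicator_of_notMem (by simpa using hx), indicator_of_notMem (by simpa using hx)]
    _ = _ := by
        rw [h]
        congr 1
        have e : ∀ r ∈ Ioi (0 : ℝ), ENNReal.ofReal (r ^ (n - 1)) *
            (Iio R).indicator (fun r : ℝ => ENNReal.ofReal (r ^ (-c))) r =
            (Iio R).indicator (fun r : ℝ => ENNReal.ofReal (r ^ ((n : ℝ) - c - 1))) r := by
          intro r hr
          have hr0 : 0 < r := hr
          by_cases hrR : r ∈ Iio R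
          · rw [indicator_of_mem hrR, indicator_of_mem hrR, ← ENNReal.ofReal_mul (by positivity),
              ← Real.rpow_natCast, ← Real.rpow_add hr0, Nat.cast_sub hn, Nat.cast_one]
            congr 2
            ring
          · rw [indicator_of_notMem hrR, indicator_of_notMem hrR, mul_zero]
        rw [setLIntegral_congr_fun measurableSet_Ioi e, lintegral_indicator measurableSet_Iio,
          Measure.restrict_restrict measurableSet_Iio, inter_comm, Ioi_inter_Iio,
          Measure.restrict_congr_set Ioo_ae_eq_Ioc,
          ← ofReal_integral_eq_lintegral_ofReal
            (intervalIntegral.intervalIntegrable_rpow' (by linarith)).1,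
          ← intervalIntegral.integral_of_le hR, integral_rpow (Or.inl (by linarith))]
        · rw [sub_add_cancel, Real.zero_rpow hcn.ne', sub_zero]
        · filter_upwards [ae_restrict_mem measurableSet_Ioc] with y hy
          exact Real.rpow_nonneg hy.1.le _

end Polar

section WeightedIsoperimetric
open Set Filter Topology
open scoped ENNReal Pointwise

variable {n : ℕ}

theorem exists_hasFDerivAt_radialPow {m : ℝ} (hm : 1 ≤ m) (y : EuclideanSpace ℝ (Fin n)) :
    ∃ L : EuclideanSpace ℝ (Fin n) →L[ℝ] EuclideanSpace ℝ (Fin n),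
      HasFDerivAt (radialPow m) L y ∧ ‖L‖ ≤ m * ‖y‖ ^ (m - 1) := by
  rcases hm.eq_or_lt with rfl | hm1
  · refine ⟨ContinuousLinearMap.id ℝ _, ?_, ?_⟩
    · have : radialPow (n := n) 1 = id := by ext y; simp [radialPow]
      rw [this]; exact hasFDerivAt_id y
    · simpa using ContinuousLinearMap.norm_id_le
  rcases eq_or_ne y 0 with rfl | hy
  · refine ⟨0, ?_, by simp; positivity⟩
    rw [hasFDerivAt_iff_isLittleO_nhds_zero]
    have h1 : (fun h : EuclideanSpace ℝ (Fin n) => ‖h‖ ^ (m - 1)) =o[𝓝 0] fun _ => (1 : ℝ) := by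
      rw [Asymptotics.isLittleO_one_iff]
      have hc : Continuous fun h : EuclideanSpace ℝ (Fin n) => ‖h‖ ^ (m - 1) :=
        continuous_norm.rpow_const fun _ => Or.inr (by linarith)
      have := hc.tendsto 0
      rwa [norm_zero, Real.zero_rpow (by linarith)] at this
    have h2 := h1.smul_isBigO (Asymptotics.isBigO_refl (fun h : EuclideanSpace ℝ (Fin n) => h)
        (𝓝 0))
    simpa [radialPow] using h2
  · have hy0 := norm_pos_iff.mpr hy
    have hd : HasFDerivAt (fun x : EuclideanSpace ℝ (Fin n) => ‖x‖) (fderiv ℝ norm y) y :=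
      ((contDiffAt_norm ℝ hy).differentiableAt one_ne_zero).hasFDerivAt
    have hn1 : ‖fderiv ℝ (norm : EuclideanSpace ℝ (Fin n) → ℝ) y‖ ≤ 1 := by
      simpa using norm_fderiv_le_of_lipschitz ℝ (x₀ := y)
        (lipschitzWith_one_norm (E := EuclideanSpace ℝ (Fin n)))
    have hp := hd.rpow_const (p := m - 1) (Or.inl hy0.ne')
    have hL := hp.smul (hasFDerivAt_id y)
    refine ⟨_, hL, ?_⟩
    refine (norm_add_le _ _).trans ?_
    have e1 : ‖‖y‖ ^ (m - 1) • ContinuousLinearMap.id ℝ (EuclideanSpace ℝ (Fin n))‖ ≤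
        ‖y‖ ^ (m - 1) := by
      rw [norm_smul, Real.norm_of_nonneg (by positivity)]
      exact mul_le_of_le_one_right (by positivity) ContinuousLinearMap.norm_id_le
    have e2 : ‖(((m - 1) * ‖y‖ ^ (m - 1 - 1)) • fderiv ℝ norm y).smulRight (id y)‖ ≤
        (m - 1) * ‖y‖ ^ (m - 1) := by
      rw [ContinuousLinearMap.norm_smulRight_apply, norm_smul,
        Real.norm_of_nonneg (mul_nonneg (by linarith) (by positivity)), id,
        Real.rpow_sub_one hy0.ne' (m - 1)]
      have : (m - 1) * (‖y‖ ^ (m - 1) / ‖y‖) * ‖fderiv ℝ norm y‖ * ‖y‖ =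
          (m - 1) * ‖y‖ ^ (m - 1) * ‖fderiv ℝ norm y‖ := by field_simp
      rw [this]
      exact mul_le_of_le_one_right (mul_nonneg (by linarith) (by positivity)) hn1
    linarith

theorem eventually_abs_le_of_hasFDerivAt {w : EuclideanSpace ℝ (Fin n) → ℝ}
    {x : EuclideanSpace ℝ (Fin n)} {L : EuclideanSpace ℝ (Fin n) →L[ℝ] ℝ} (h : HasFDerivAt w L x)
    {g η : ℝ} (hg : ‖L‖ ≤ g) (hη : 0 < η) :
    ∀ᶠ ε in 𝓝[>] (0 : ℝ), ∀ y, dist x y < ε → |w y| ≤ |w x| + ε * (g + η) := by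
  have h1 := (hasFDerivAt_iff_isLittleO.mp h).def hη
  obtain ⟨δ, hδ, hball⟩ := Metric.eventually_nhds_iff.mp h1
  filter_upwards [Ioo_mem_nhdsGT hδ] with ε hε y hy
  have h2 := hball (y := y) (by rw [dist_comm]; exact hy.trans hε.2)
  rw [dist_comm, dist_eq_norm] at hy
  have h3 : ‖L (y - x)‖ ≤ g * ‖y - x‖ := (L.le_opNorm _).trans (by gcongr)
  have h4 : |w y| ≤ |w x| + (‖w y - w x - L (y - x)‖ + ‖L (y - x)‖) := by
    have : w y = w x + ((w y - w x - L (y - x)) + L (y - x)) := by ring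
    calc |w y| = ‖w x + ((w y - w x - L (y - x)) + L (y - x))‖ := by rw [← this]; rfl
      _ ≤ _ := (norm_add_le _ _).trans (by gcongr; exact le_rfl; exact norm_add_le _ _)
  have h5 : 0 ≤ g := (norm_nonneg _).trans hg
  have h6 : (g + η) * ‖y - x‖ ≤ (g + η) * ε := by gcongr
  linarith

theorem setLIntegral_norm_rpow_le_ball {A : Set (EuclideanSpace ℝ (Fin n))}
    (hn : 1 ≤ n) (hA : MeasurableSet A) {R c : ℝ} (hR : 0 < R) (hc : 0 ≤ c)
    (hAR : volume A = volume (Metric.ball (0 : EuclideanSpace ℝ (Fin n)) R)) :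
    ∫⁻ x in A, ENNReal.ofReal (‖x‖ ^ (-c)) ≤
      ∫⁻ x in Metric.ball (0 : EuclideanSpace ℝ (Fin n)) R, ENNReal.ofReal (‖x‖ ^ (-c)) := by
  have : NeZero n := ⟨by omega⟩
  set B := Metric.ball (0 : EuclideanSpace ℝ (Fin n)) R
  have hB : MeasurableSet B := measurableSet_ball
  have hBf : volume B ≠ ∞ := measure_ball_lt_top.ne
  have hdiff : volume (A \ B) = volume (B \ A) := by
    have h1 := measure_sdiff_add_inter (μ := volume) A hB
    have h2 := measure_sdiff_add_inter (μ := volume) B hA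
    rw [hAR, ← h2, inter_comm A B] at h1
    exact (ENNReal.add_left_inj (ne_top_of_le_ne_top hBf (measure_mono inter_subset_left))).mp h1
  rw [← lintegral_inter_add_sdiff _ A hB, ← lintegral_inter_add_sdiff _ B hA, inter_comm A B]
  gcongr 1
  calc ∫⁻ x in A \ B, ENNReal.ofReal (‖x‖ ^ (-c))
      ≤ ∫⁻ x in A \ B, ENNReal.ofReal (R ^ (-c)) := by
        refine setLIntegral_mono measurable_const fun x hx => ?_
        have hx2 : R ≤ ‖x‖ := by simpa [B] using hx.2
        exact ENNReal.ofReal_le_ofReal (Real.rpow_le_rpow_of_nonpos hR hx2 (by linarith))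
    _ = ∫⁻ x in B \ A, ENNReal.ofReal (R ^ (-c)) := by
        rw [setLIntegral_const, setLIntegral_const, hdiff]
    _ ≤ ∫⁻ x in B \ A, ENNReal.ofReal (‖x‖ ^ (-c)) := by
        refine lintegral_mono_ae ?_
        have h0 : ∀ᵐ x : EuclideanSpace ℝ (Fin n), x ≠ 0 := by
          simp [ae_iff]
        filter_upwards [ae_restrict_mem (MeasurableSet.diff hB hA),
            ae_restrict_of_ae h0] with x hx hx0
        have hx2 : ‖x‖ < R := by simpa [B] using hx.1
        exact ENNReal.ofReal_le_ofReal
          (Real.rpow_le_rpow_of_nonpos (norm_pos_iff.mpr hx0) hx2.le (by linarith))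


theorem volume_ball_eq_ofReal_pow (hn : 1 ≤ n) {w R : ℝ} (hR : 0 ≤ R)
    (hBv : volume (Metric.ball (0 : EuclideanSpace ℝ (Fin n)) 1) = ENNReal.ofReal (w ^ n)) :
    volume (Metric.ball (0 : EuclideanSpace ℝ (Fin n)) R) = ENNReal.ofReal ((R * w) ^ n) := by
  have : NeZero n := ⟨by omega⟩
  rw [Measure.addHaar_ball _ _ hR, hBv, finrank_euclideanSpace_fin,
    ← ENNReal.ofReal_mul (by positivity), mul_pow]

theorem setLIntegral_norm_rpow_rpow_le (hn : 2 ≤ n) {w : ℝ} (hw : 0 < w)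
    (hBv : volume (Metric.ball (0 : EuclideanSpace ℝ (Fin n)) 1) = ENNReal.ofReal (w ^ n))
    {A : Set (EuclideanSpace ℝ (Fin n))} (hA : MeasurableSet A) (hAf : volume A ≠ ∞) {c τ : ℝ}
    (hc : 0 ≤ c) (hcn : c < n) (hτ : τ * (n - c) = n - 1) (hτ0 : 0 < τ) :
    ENNReal.ofReal ((n * w ^ n) ^ (1 - τ) * (n - c) ^ τ) *
      (∫⁻ x in A, ENNReal.ofReal (‖x‖ ^ (-c))) ^ τ ≤
      ENNReal.ofReal (n * w) * volume A ^ (1 - 1 / (n : ℝ)) := by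
  have hn0 : (0 : ℝ) < n := by positivity
  have hcn' : (0 : ℝ) < n - c := by linarith
  rcases eq_or_ne (volume A) 0 with h0 | h0
  · rw [setLIntegral_measure_zero _ _ h0, ENNReal.zero_rpow_of_pos hτ0, mul_zero]
    exact bot_le
  have hpos : 0 < (volume A).toReal := ENNReal.toReal_pos h0 hAf
  set R := (volume A).toReal ^ (1 / (n : ℝ)) / w with hR
  have hR0 : 0 < R := by positivity
  have hRw : R * w = (volume A).toReal ^ (1 / (n : ℝ)) := div_mul_cancel₀ _ hw.ne'
  have hAv : volume A = ENNReal.ofReal ((R * w) ^ n) := by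
    rw [hRw, ← Real.rpow_natCast, ← Real.rpow_mul hpos.le, one_div, inv_mul_cancel₀ hn0.ne',
      Real.rpow_one, ENNReal.ofReal_toReal hAf]
  have hAR : volume A = volume (Metric.ball (0 : EuclideanSpace ℝ (Fin n)) R) := by
    rw [hAv, volume_ball_eq_ofReal_pow (by omega) hR0.le hBv]
  have hle := setLIntegral_norm_rpow_le_ball (by omega) hA hR0 hc hAR
  rw [setLIntegral_ball_norm_rpow (by omega) hcn hR0.le, hBv, ← ENNReal.ofReal_natCast,
    ← ENNReal.ofReal_mul (by positivity), ← ENNReal.ofReal_mul (by positivity)] at hle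
  have hpow : volume A ^ (1 - 1 / (n : ℝ)) = ENNReal.ofReal ((R * w) ^ ((n : ℝ) - 1)) := by
    rw [hAv, ENNReal.ofReal_rpow_of_pos (by positivity), ← Real.rpow_natCast,
      ← Real.rpow_mul (by positivity)]
    congr 2
    field_simp
  refine (mul_le_mul_right (ENNReal.rpow_le_rpow hle hτ0.le) _).trans ?_
  rw [hpow, ENNReal.ofReal_rpow_of_pos (by positivity), ← ENNReal.ofReal_mul (by positivity),
    ← ENNReal.ofReal_mul (by positivity)]
  apply ENNReal.ofReal_le_ofReal (le_of_eq _)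
  have hS : (0 : ℝ) < n * w ^ n := by positivity
  rw [Real.mul_rpow hS.le (by positivity), Real.div_rpow (by positivity) hcn'.le,
    ← Real.rpow_mul hR0.le, mul_comm _ τ, hτ, Real.rpow_sub hS, Real.rpow_one,
    Real.mul_rpow hR0.le hw.le, Real.rpow_sub_one hw.ne', Real.rpow_natCast]
  field_simp

theorem lintegral_weighted_level_le (hn : 2 ≤ n) {w : ℝ} (hw : 0 < w)
    (hBv : volume (Metric.ball (0 : EuclideanSpace ℝ (Fin n)) 1) = ENNReal.ofReal (w ^ n))
    {α b θ : ℝ} (hα0 : 0 ≤ α) (hα : α < n - 1) (hbn : b < n) (hαb : n * α ≤ (n - 1) * b)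
    (hθ : θ * (n - b) = n - 1 - α) {u : EuclideanSpace ℝ (Fin n) → ℝ} (hu : ContDiff ℝ 1 u)
    (hc : HasCompactSupport u) {h : ℝ → ℝ≥0∞} (hh : Measurable h) :
    ∫⁻ t in Ioi (0 : ℝ), ENNReal.ofReal ((n * w ^ n) ^ (1 - θ) * (n - b) ^ θ) *
        (∫⁻ x in {x | t < |u x|}, ENNReal.ofReal (‖x‖ ^ (-b))) ^ θ * h t ≤
      ∫⁻ x, ENNReal.ofReal (‖fderiv ℝ u x‖ * ‖x‖ ^ (-α)) * h |u x| := by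
  have hn2 : (2 : ℝ) ≤ n := by exact_mod_cast hn
  have hn1 : (0 : ℝ) < n - 1 := by linarith
  have hbn' : (0 : ℝ) < n - b := by linarith
  have hθ0 : 0 < θ := by
    by_contra hcon
    nlinarith
  set m := (n - 1) / (n - 1 - α) with hm
  have hma : 0 < n - 1 - α := by linarith
  have hm1 : 1 ≤ m := by rw [hm, le_div_iff₀ hma]; linarith
  have hm0 : 0 < m := by linarith
  have hmα : m * (n - 1 - α) = n - 1 := div_mul_cancel₀ _ hma.ne'
  have huc := hu.continuous
  have hu' : Continuous (fderiv ℝ u) := hu.continuous_fderiv one_ne_zero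
  have hc' : HasCompactSupport (fderiv ℝ u) := hc.fderiv ℝ
  set f : EuclideanSpace ℝ (Fin n) → ℝ := fun y => |u (radialPow m y)| with hf
  set G : EuclideanSpace ℝ (Fin n) → ℝ :=
    fun y => ‖fderiv ℝ u (radialPow m y)‖ * (m * ‖y‖ ^ (m - 1)) with hG
  have hG0 : ∀ y, 0 ≤ G y := fun y => by positivity
  have hder : ∀ y, ∃ L : EuclideanSpace ℝ (Fin n) →L[ℝ] ℝ,
      HasFDerivAt (fun y => u (radialPow m y)) L y ∧ ‖L‖ ≤ G y := by
    intro y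
    obtain ⟨L, hL, hLn⟩ := exists_hasFDerivAt_radialPow hm1 y
    refine ⟨_, ((hu.differentiable one_ne_zero) _).hasFDerivAt.comp y hL, ?_⟩
    exact (ContinuousLinearMap.opNorm_comp_le _ _).trans
      (mul_le_mul_of_nonneg_left hLn (norm_nonneg _))
  obtain ⟨R₁, hR₁⟩ := hc.isCompact.isBounded.subset_ball (0 : EuclideanSpace ℝ (Fin n))
  set R := max R₁ 1 with hR
  have hsupp : ∀ x : EuclideanSpace ℝ (Fin n), R ≤ ‖x‖ → x ∉ tsupport u := by
    intro x hx hmem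
    have := hR₁ hmem
    rw [Metric.mem_ball, dist_zero_right] at this
    linarith [le_max_left R₁ 1]
  have hsuppm : ∀ y : EuclideanSpace ℝ (Fin n), R ≤ ‖y‖ → radialPow m y ∉ tsupport u := by
    intro y hy
    apply hsupp
    rw [norm_radialPow hm0]
    refine hy.trans ?_
    have : 1 ≤ ‖y‖ := (le_max_right R₁ 1).trans hy
    calc ‖y‖ = ‖y‖ ^ (1 : ℝ) := (Real.rpow_one _).symm
      _ ≤ _ := Real.rpow_le_rpow_of_exponent_le this hm1
  have hfs : ∀ y, R ≤ ‖y‖ → f y = 0 := by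
    intro y hy
    rw [hf]
    simp only
    rw [image_eq_zero_of_notMem_tsupport (hsuppm y hy), abs_zero]
  have hGs : ∀ y, R ≤ ‖y‖ → G y = 0 := by
    intro y hy
    have : fderiv ℝ u (radialPow m y) = 0 := by
      have h := hsuppm y hy
      by_contra hne
      exact h (support_fderiv_subset ℝ hne)
    rw [hG]
    simp [this]
  obtain ⟨C₀, hC₀⟩ := hu'.bounded_above_of_compact_support hc'
  have hC0 : 0 ≤ C₀ := (norm_nonneg _).trans (hC₀ 0)
  have hR1 : 1 ≤ R := le_max_right _ _
  set K : NNReal := ⟨C₀ * (m * R ^ (m - 1)), by positivity⟩ with hK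
  have hGK : ∀ y, G y ≤ K := by
    intro y
    rcases le_or_gt R ‖y‖ with hy | hy
    · rw [hGs y hy]; exact K.2
    · change _ ≤ C₀ * (m * R ^ (m - 1))
      have : ‖y‖ ^ (m - 1) ≤ R ^ (m - 1) :=
        Real.rpow_le_rpow (norm_nonneg _) hy.le (by linarith)
      have := hC₀ (radialPow m y)
      rw [hG]
      simp only
      gcongr
  have hwL : LipschitzWith K (fun y => u (radialPow m y)) := by
    refine lipschitzWith_of_nnnorm_fderiv_le (𝕜 := ℝ) (fun y => ?_) (fun y => ?_)
    · obtain ⟨L, hL, _⟩ := hder y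
      exact hL.differentiableAt
    · obtain ⟨L, hL, hLn⟩ := hder y
      rw [hL.fderiv]
      exact NNReal.coe_le_coe.mp (hLn.trans (hGK y))
  have hfL : LipschitzWith K f := by
    have := lipschitzWith_one_norm (E := ℝ) |>.comp hwL
    rwa [one_mul] at this
  have hΨm := measurable_radialPow (n := n) m
  have hGm : Measurable G :=
    (hu'.norm.measurable.comp hΨm).mul (by fun_prop)
  have hGi : ∫⁻ x, ENNReal.ofReal (G x) ≠ ∞ := by
    refine ne_top_of_le_ne_top
      (b := ∫⁻ x in Metric.ball (0 : EuclideanSpace ℝ (Fin n)) R, ENNReal.ofReal K) ?_ ?_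
    · rw [setLIntegral_const]
      exact ENNReal.mul_ne_top ENNReal.ofReal_ne_top measure_ball_lt_top.ne
    · rw [← lintegral_indicator measurableSet_ball]
      refine lintegral_mono fun y => ?_
      by_cases hy : y ∈ Metric.ball (0 : EuclideanSpace ℝ (Fin n)) R
      · rw [indicator_of_mem hy]
        exact ENNReal.ofReal_le_ofReal (hGK y)
      · rw [indicator_of_notMem hy, hGs y (by simpa using hy), ENNReal.ofReal_zero]
  have hslope : ∀ x, ∀ η > 0, ∀ᶠ ε in 𝓝[>] (0 : ℝ), ∀ y, dist x y < ε →
      f y ≤ f x + ε * (G x + η) := by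
    intro x η hη
    obtain ⟨L, hL, hLn⟩ := hder x
    exact eventually_abs_le_of_hasFDerivAt hL hLn hη
  have key := lintegral_level_rpow_mul_le hn hw hBv hfL hfs hG0 hGm hGi hslope hh
  have h0 : ∀ᵐ x : EuclideanSpace ℝ (Fin n), x ≠ 0 := by
    have : NeZero n := ⟨by omega⟩
    simp [ae_iff]
  have hRHS : ∫⁻ x, ENNReal.ofReal (‖fderiv ℝ u x‖ * ‖x‖ ^ (-α)) * h |u x| =
      ∫⁻ x, ENNReal.ofReal (G x) * h (f x) := by
    rw [lintegral_comp_radialPow (by omega) hm0 (by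
      exact (Measurable.ennreal_ofReal (hu'.norm.measurable.mul (by fun_prop))).mul
        (hh.comp huc.abs.measurable))]
    refine lintegral_congr_ae ?_
    filter_upwards [h0] with y hy
    have hy0 := norm_pos_iff.mpr hy
    rw [← mul_assoc, ← ENNReal.ofReal_mul (by positivity), norm_radialPow hm0,
      ← Real.rpow_mul hy0.le]
    congr 2
    rw [hG]
    simp only
    have : ‖y‖ ^ (m - 1) = ‖y‖ ^ (n * (m - 1)) * ‖y‖ ^ (m * -α) := by
      rw [← Real.rpow_add hy0]
      congr 1
      linarith
    rw [this]
    ring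
  have hV : ∀ t, ∫⁻ x in {x | t < |u x|}, ENNReal.ofReal (‖x‖ ^ (-b)) =
      ENNReal.ofReal m * ∫⁻ y in {y | t < f y}, ENNReal.ofReal (‖y‖ ^ (-(n - m * (n - b)))) := by
    intro t
    have hm2 : Measurable fun x : EuclideanSpace ℝ (Fin n) => ENNReal.ofReal (‖x‖ ^ (-b)) := by
      fun_prop
    have hms : MeasurableSet {x | t < |u x|} := measurableSet_lt measurable_const huc.abs.measurable
    have hms2 : MeasurableSet {y | t < f y} :=
      measurableSet_lt measurable_const hfL.continuous.measurable
    rw [← lintegral_indicator hms, lintegral_comp_radialPow (by omega) hm0 (hm2.indicator hms),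
      ← lintegral_const_mul _ (by fun_prop), ← lintegral_indicator hms2]
    refine lintegral_congr_ae ?_
    filter_upwards [h0] with y hy
    have hy0 := norm_pos_iff.mpr hy
    by_cases hyt : y ∈ {y | t < f y}
    · rw [indicator_of_mem hyt, indicator_of_mem (by exact hyt),
          ← ENNReal.ofReal_mul (by positivity),
        ← ENNReal.ofReal_mul hm0.le, norm_radialPow hm0, ← Real.rpow_mul hy0.le, mul_assoc,
        ← Real.rpow_add hy0]
      congr 3
      ring
    · rw [indicator_of_notMem hyt, indicator_of_notMem (by exact hyt), mul_zero]
  have hfin : ∀ t, 0 < t → volume {x | t < f x} ≠ ∞ := by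
    intro t ht
    refine ne_top_of_le_ne_top (measure_ball_lt_top (x := 0) (r := R)).ne
      (measure_mono fun x hx => ?_)
    by_contra hcon
    simp only [Metric.mem_ball, dist_zero_right, not_lt] at hcon
    have := hfs x hcon
    simp only [mem_ofPred_eq] at hx
    linarith
  rw [hRHS]
  refine le_trans (setLIntegral_mono' measurableSet_Ioi fun t ht => ?_) key
  gcongr ?_ * _
  rw [hV, ENNReal.mul_rpow_of_nonneg _ _ hθ0.le, ← mul_assoc,
    ENNReal.ofReal_rpow_of_pos hm0, ← ENNReal.ofReal_mul (by positivity)]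
  have hb' : 0 ≤ n - m * (n - b) := by
    rw [hm, div_mul_eq_mul_div, sub_nonneg, div_le_iff₀ hma]
    linarith
  have h9 := setLIntegral_norm_rpow_rpow_le hn hw hBv (A := {x | t < f x})
    (measurableSet_lt measurable_const hfL.continuous.measurable) (hfin t ht) hb'
    (by nlinarith [mul_pos hm0 hbn']) (τ := θ) (by
      rw [sub_sub_cancel, mul_left_comm, hθ, hmα]) hθ0
  refine le_trans (le_of_eq ?_) h9
  congr 2
  rw [sub_sub_cancel, Real.mul_rpow hm0.le hbn'.le]
  ring

end WeightedIsoperimetric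

section Rearrangement
open Set Filter Topology
open scoped ENNReal Pointwise

/-- The generalized inverse of the tail function `t ↦ m (t, ∞)` of a measure on `(0, ∞)`. -/
def tailInverse (m : Measure ℝ) (z : ℝ) : ℝ :=
  sSup {t | 0 ≤ t ∧ max z 0 < m.real (Ioi t)}

variable {m : Measure ℝ} [IsFiniteMeasure m] {M : ℝ}

theorem antitone_real_Ioi (m : Measure ℝ) [IsFiniteMeasure m] : Antitone fun t => m.real (Ioi t) :=
  fun _ _ h => measureReal_mono (Ioi_subset_Ioi h)

theorem exists_gt_lt_real_Ioi {t z : ℝ} (h : z < m.real (Ioi t)) :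
    ∃ t', t < t' ∧ z < m.real (Ioi t') := by
  have hU : (⋃ k : ℕ, Ioi (t + 1 / ((k : ℝ) + 1))) = Ioi t := by
    ext x
    simp only [mem_iUnion, mem_Ioi]
    constructor
    · rintro ⟨k, hk⟩
      have : (0 : ℝ) < 1 / ((k : ℝ) + 1) := by positivity
      linarith
    · intro hx
      obtain ⟨k, hk⟩ := exists_nat_one_div_lt (sub_pos.mpr hx)
      exact ⟨k, by linarith⟩
  have hmono : Monotone fun k : ℕ => Ioi (t + 1 / ((k : ℝ) + 1)) := by
    intro k l hkl
    apply Ioi_subset_Ioi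
    gcongr
  have ht := tendsto_measure_iUnion_atTop (μ := m) hmono
  rw [hU] at ht
  have ht' := (ENNReal.tendsto_toReal (measure_ne_top m _)).comp ht
  obtain ⟨k, hk⟩ := (ht'.eventually (lt_mem_nhds h)).exists
  exact ⟨t + 1 / ((k : ℝ) + 1), by
    have : (0 : ℝ) < 1 / ((k : ℝ) + 1) := by positivity
    linarith, hk⟩

theorem bddAbove_tailInverse_set (hM : m (Ioi M) = 0) (z : ℝ) :
    BddAbove {t | 0 ≤ t ∧ max z 0 < m.real (Ioi t)} := by
  refine ⟨M, fun t ht => ?_⟩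
  by_contra! hcon
  have h1 := antitone_real_Ioi m hcon.le
  simp only [measureReal_def, hM, ENNReal.toReal_zero] at h1
  have h2 := ht.2
  rw [measureReal_def] at h2
  linarith [le_max_right z 0]

theorem tailInverse_nonneg (m : Measure ℝ) (z : ℝ) : 0 ≤ tailInverse m z :=
  Real.sSup_nonneg fun _ ht => ht.1

theorem lt_tailInverse_iff (hM : m (Ioi M) = 0) {t z : ℝ} (ht : 0 ≤ t) (hz : 0 ≤ z) :
    t < tailInverse m z ↔ z < m.real (Ioi t) := by
  constructor
  · intro h
    rw [tailInverse] at h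
    have hne : {t | 0 ≤ t ∧ max z 0 < m.real (Ioi t)}.Nonempty := by
      by_contra hne
      rw [not_nonempty_iff_eq_empty] at hne
      rw [hne, Real.sSup_empty] at h
      linarith
    obtain ⟨t', ht', htt'⟩ := exists_lt_of_lt_csSup hne h
    exact ((le_max_left z 0).trans_lt ht'.2).trans_le (antitone_real_Ioi m htt'.le)
  · intro h
    obtain ⟨t', htt', ht'⟩ := exists_gt_lt_real_Ioi h
    refine htt'.trans_le (le_csSup (bddAbove_tailInverse_set hM z) ⟨ht.trans htt'.le, ?_⟩)
    rwa [max_eq_left hz]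

theorem antitone_tailInverse (hM : m (Ioi M) = 0) : Antitone (tailInverse m) := by
  intro z z' hzz
  refine Real.sSup_le (fun t ht => ?_) (tailInverse_nonneg m z)
  exact le_csSup (bddAbove_tailInverse_set hM z)
    ⟨ht.1, (max_le_max_right 0 hzz).trans_lt ht.2⟩

theorem map_tailInverse (h0 : m (Iic 0) = 0) (hM : m (Ioi M) = 0) :
    (volume.restrict (Ioo 0 (m.real univ))).map (tailInverse m) = m := by
  have hmeas := (antitone_tailInverse hM).measurable
  refine (Measure.ext_of_Iic _ _ fun a => ?_).symm
  rw [Measure.map_apply hmeas measurableSet_Iic, Measure.restrict_apply (hmeas measurableSet_Iic)]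
  rcases lt_or_ge a 0 with ha | ha
  · rw [measure_mono_null (Iic_subset_Iic.mpr ha.le) h0]
    have : tailInverse m ⁻¹' Iic a ∩ Ioo 0 (m.real univ) = ∅ := by
      ext z
      simp only [mem_inter_iff, mem_preimage, mem_Iic, mem_empty_iff_false, iff_false, not_and]
      intro h
      linarith [tailInverse_nonneg m z]
    rw [this, measure_empty]
  · have hsplit : m.real (Iic a) = m.real univ - m.real (Ioi a) := by
      have := measureReal_compl (μ := m) (measurableSet_Ioi (a := a))
      rwa [compl_Ioi] at this
    have hVa : (0 : ℝ) ≤ m.real (Ioi a) := measureReal_nonneg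
    have hset : tailInverse m ⁻¹' Iic a ∩ Ioo 0 (m.real univ) =
        Ioo 0 (m.real univ) ∩ Ici (m.real (Ioi a)) := by
      ext z
      simp only [mem_inter_iff, mem_preimage, mem_Iic, mem_Ioo, mem_Ici]
      constructor
      · rintro ⟨h1, h2⟩
        exact ⟨h2, not_lt.mp fun h => absurd ((lt_tailInverse_iff hM ha h2.1.le).mpr h)
            (not_lt.mpr h1)⟩
      · rintro ⟨h1, h2⟩
        exact ⟨not_lt.mp fun h => absurd ((lt_tailInverse_iff hM ha h1.1.le).mp h) (not_lt.mpr h2),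
            h1⟩
    rw [hset, ← ENNReal.ofReal_toReal (measure_ne_top m (Iic a))]
    change ENNReal.ofReal (m.real (Iic a)) = _
    rw [hsplit]
    rcases hVa.eq_or_lt with h | h
    · rw [← h, inter_eq_left.mpr fun z hz => hz.1.le, Real.volume_Ioo]
    · have : Ioo 0 (m.real univ) ∩ Ici (m.real (Ioi a)) = Ico (m.real (Ioi a)) (m.real univ) := by
        ext z
        simp only [mem_inter_iff, mem_Ioo, mem_Ici, mem_Ico]
        constructor
        · rintro ⟨h1, h2⟩; exact ⟨h2, h1.2⟩
        · rintro ⟨h1, h2⟩; exact ⟨⟨h.trans_le h1, h2⟩, h1⟩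
      rw [this, Real.volume_Ico]

end Rearrangement

section Transport
open Set Filter Topology
open scoped ENNReal Pointwise

variable {r : ℝ → ℝ} {Z₀ : ℝ}

theorem strictMonoOn_primitive_of_antitone (hr : Antitone r) (hpos : ∀ z ∈ Ico 0 Z₀, 0 < r z) :
    StrictMonoOn (fun z => ∫ x in (0 : ℝ)..z, r x) (Icc 0 Z₀) := by
  intro z hz z' hz' hlt
  have h1 : ∀ a b, IntervalIntegrable r volume a b := fun a b => hr.intervalIntegrable
  have h2 := intervalIntegral.integral_add_adjacent_intervals (h1 0 z) (h1 z z')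
  have h3 : 0 < ∫ x in z..z', r x :=
    intervalIntegral.intervalIntegral_pos_of_pos_on (h1 z z')
      (fun x hx => hpos x ⟨hz.1.trans hx.1.le, hx.2.trans_le hz'.2⟩) hlt
  simp only
  linarith

theorem lintegral_comp_primitive_of_antitone (hr : Antitone r)
    (hpos : ∀ z ∈ Ico 0 Z₀, 0 < r z) {Z : ℝ} (hZ : 0 ≤ Z) (hZ₀ : Z ≤ Z₀) (φ : ℝ → ℝ≥0∞) :
    ∫⁻ z in Ioo 0 Z, ENNReal.ofReal (r z) * φ (∫ x in (0 : ℝ)..z, r x) =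
      ∫⁻ y in Ioo 0 (∫ x in (0 : ℝ)..Z, r x), φ y := by
  set ξ : ℝ → ℝ := fun z => ∫ x in (0 : ℝ)..z, r x with hξ
  set D : Set ℝ := {z | ¬ContinuousAt r z} with hD
  have hDc : D.Countable := hr.countable_not_continuousAt
  have hint : ∀ a b, IntervalIntegrable r volume a b := fun a b => hr.intervalIntegrable
  have hmono : StrictMonoOn ξ (Icc 0 Z₀) := strictMonoOn_primitive_of_antitone hr hpos
  have hξc : Continuous ξ := intervalIntegral.continuous_primitive hint 0
  have hsub : Ioo 0 Z ⊆ Icc 0 Z₀ := fun z hz => ⟨hz.1.le, hz.2.le.trans hZ₀⟩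
  have hξ0 : ξ 0 = 0 := by simp [hξ]
  have hms : MeasurableSet (Ioo 0 Z \ D) := measurableSet_Ioo.diff hDc.measurableSet
  have hder : ∀ z ∈ Ioo 0 Z \ D, HasDerivWithinAt ξ (r z) (Ioo 0 Z \ D) z := by
    intro z hz
    have hzc : ContinuousAt r z := not_not.mp hz.2
    exact (intervalIntegral.integral_hasDerivAt_right (hint 0 z)
      (hr.measurable.stronglyMeasurable.stronglyMeasurableAtFilter) hzc).hasDerivWithinAt
  have hinj : InjOn ξ (Ioo 0 Z \ D) := hmono.injOn.mono (sdiff_subset.trans hsub)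
  have key := lintegral_image_eq_lintegral_abs_deriv_mul hms hder hinj φ
  have himg : ξ '' (Ioo 0 Z) = Ioo 0 (ξ Z) := by
    apply Subset.antisymm
    · rintro _ ⟨z, hz, rfl⟩
      refine ⟨?_, hmono (hsub hz) ⟨hZ, hZ₀⟩ hz.2⟩
      rw [← hξ0]
      exact hmono ⟨le_rfl, hZ.trans hZ₀⟩ (hsub hz) hz.1
    · have := intermediate_value_Ioo hZ hξc.continuousOn
      rwa [hξ0] at this
  have hae1 : (Ioo 0 Z \ D : Set ℝ) =ᵐ[volume] Ioo 0 Z :=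
    sdiff_null_ae_eq_self (hDc.measure_zero _)
  have hae2 : (ξ '' (Ioo 0 Z \ D) : Set ℝ) =ᵐ[volume] Ioo 0 (ξ Z) := by
    rw [← himg]
    have h1 : ξ '' (Ioo 0 Z) \ ξ '' D ⊆ ξ '' (Ioo 0 Z \ D) := by
      rintro _ ⟨⟨z, hz, rfl⟩, h⟩
      exact ⟨z, ⟨hz, fun hzD => h ⟨z, hzD, rfl⟩⟩, rfl⟩
    have h2 : (ξ '' (Ioo 0 Z) \ ξ '' D : Set ℝ) =ᵐ[volume] ξ '' (Ioo 0 Z) :=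
      sdiff_null_ae_eq_self ((hDc.image ξ).measure_zero _)
    refine Filter.EventuallyLE.antisymm (LE.le.eventuallyLE (image_mono sdiff_subset)) ?_
    exact h2.symm.le.trans (LE.le.eventuallyLE h1)
  rw [Measure.restrict_congr_set hae1, Measure.restrict_congr_set hae2] at key
  rw [key]
  refine setLIntegral_congr_fun measurableSet_Ioo fun z hz => ?_
  rw [abs_of_pos (hpos z ⟨hz.1.le, hz.2.trans_le hZ₀⟩)]

theorem setLIntegral_Ioo_comp_of_hasDerivAt {H H' : ℝ → ℝ} (hH : ∀ s, HasDerivAt H (H' s) s)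
    (hH' : ∀ s, 0 < H' s) (hH0 : H 0 = 0) {s : ℝ} (hs : 0 ≤ s) (φ : ℝ → ℝ≥0∞) :
    ∫⁻ y in Ioo 0 (H s), φ y = ∫⁻ σ in Ioo 0 s, ENNReal.ofReal (H' σ) * φ (H σ) := by
  have hmono : StrictMono H := strictMono_of_hasDerivAt_pos hH hH'
  have hc : Continuous H := continuous_iff_continuousAt.mpr fun s => (hH s).continuousAt
  have himg : H '' (Ioo 0 s) = Ioo 0 (H s) := by
    apply Subset.antisymm
    · rintro _ ⟨z, hz, rfl⟩
      exact ⟨hH0 ▸ hmono hz.1, hmono hz.2⟩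
    · have := intermediate_value_Ioo hs hc.continuousOn
      rwa [hH0] at this
  rw [← himg, lintegral_image_eq_lintegral_abs_deriv_mul measurableSet_Ioo
    (fun x _ => (hH x).hasDerivWithinAt) hmono.injective.injOn]
  refine setLIntegral_congr_fun measurableSet_Ioo fun z _ => ?_
  rw [abs_of_pos (hH' z)]

/-- The monotone map transporting the density `r` on `(0, Z₀)` to the density `H'`. -/
def transportMap (r H : ℝ → ℝ) (z : ℝ) : ℝ :=
  Function.invFun H (∫ x in (0 : ℝ)..z, r x)

variable {H H' : ℝ → ℝ} {Λ : ℝ}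

theorem transportMap_spec (hr : Antitone r) (hpos : ∀ z ∈ Ico 0 Z₀, 0 < r z)
    (hH : ∀ s, HasDerivAt H (H' s) s) (hH0 : H 0 = 0) (hΛ : 0 ≤ Λ)
    (hHΛ : H Λ = ∫ x in (0 : ℝ)..Z₀, r x) {z : ℝ} (hz : z ∈ Icc 0 Z₀) :
    H (transportMap r H z) = ∫ x in (0 : ℝ)..z, r x := by
  have hc : Continuous H := continuous_iff_continuousAt.mpr fun s => (hH s).continuousAt
  have hmono := (strictMonoOn_primitive_of_antitone hr hpos).monotoneOn
  have h0 : (0 : ℝ) ∈ Icc 0 Z₀ := ⟨le_rfl, hz.1.trans hz.2⟩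
  have h1 : (∫ x in (0 : ℝ)..z, r x) ∈ Icc (H 0) (H Λ) := by
    constructor
    · simpa [hH0] using hmono h0 hz hz.1
    · rw [hHΛ]
      exact hmono hz ⟨h0.2, le_rfl⟩ hz.2
  obtain ⟨s, _, hs⟩ := intermediate_value_Icc hΛ hc.continuousOn h1
  exact Function.invFun_eq ⟨s, hs⟩

theorem transportMap_monotoneOn (hr : Antitone r) (hpos : ∀ z ∈ Ico 0 Z₀, 0 < r z)
    (hH : ∀ s, HasDerivAt H (H' s) s) (hH' : ∀ s, 0 < H' s) (hH0 : H 0 = 0) (hΛ : 0 ≤ Λ)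
    (hHΛ : H Λ = ∫ x in (0 : ℝ)..Z₀, r x) : MonotoneOn (transportMap r H) (Icc 0 Z₀) := by
  have hmono : StrictMono H := strictMono_of_hasDerivAt_pos hH hH'
  intro z hz z' hz' hle
  rw [← hmono.le_iff_le, transportMap_spec hr hpos hH hH0 hΛ hHΛ hz,
    transportMap_spec hr hpos hH hH0 hΛ hHΛ hz']
  exact (strictMonoOn_primitive_of_antitone hr hpos).monotoneOn hz hz' hle

theorem transportMap_zero (hH : ∀ s, HasDerivAt H (H' s) s) (hH' : ∀ s, 0 < H' s) (hH0 : H 0 = 0) :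
    transportMap r H 0 = 0 := by
  have hmono : StrictMono H := strictMono_of_hasDerivAt_pos hH hH'
  rw [transportMap, intervalIntegral.integral_same]
  nth_rw 1 [← hH0]
  exact Function.leftInverse_invFun hmono.injective 0

theorem transportMap_right (hH : ∀ s, HasDerivAt H (H' s) s) (hH' : ∀ s, 0 < H' s)
    (hHΛ : H Λ = ∫ x in (0 : ℝ)..Z₀, r x) : transportMap r H Z₀ = Λ := by
  have hmono : StrictMono H := strictMono_of_hasDerivAt_pos hH hH'
  rw [transportMap, ← hHΛ]
  exact Function.leftInverse_invFun hmono.injective Λ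

theorem transportMap_nonneg (hr : Antitone r) (hpos : ∀ z ∈ Ico 0 Z₀, 0 < r z)
    (hH : ∀ s, HasDerivAt H (H' s) s) (hH' : ∀ s, 0 < H' s) (hH0 : H 0 = 0) (hΛ : 0 ≤ Λ)
    (hHΛ : H Λ = ∫ x in (0 : ℝ)..Z₀, r x) {z : ℝ} (hz : z ∈ Icc 0 Z₀) :
    0 ≤ transportMap r H z := by
  rw [← transportMap_zero (r := r) hH hH' hH0]
  exact transportMap_monotoneOn hr hpos hH hH' hH0 hΛ hHΛ ⟨le_rfl, hz.1.trans hz.2⟩ hz hz.1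

theorem lintegral_comp_transportMap (hr : Antitone r) (hpos : ∀ z ∈ Ico 0 Z₀, 0 < r z)
    (hH : ∀ s, HasDerivAt H (H' s) s) (hH' : ∀ s, 0 < H' s) (hH0 : H 0 = 0) (hΛ : 0 ≤ Λ)
    (hHΛ : H Λ = ∫ x in (0 : ℝ)..Z₀, r x) {Z : ℝ} (hZ : Z ∈ Icc 0 Z₀) (ψ : ℝ → ℝ≥0∞) :
    ∫⁻ z in Ioo 0 Z, ENNReal.ofReal (r z) * ψ (transportMap r H z) =
      ∫⁻ σ in Ioo 0 (transportMap r H Z), ENNReal.ofReal (H' σ) * ψ σ := by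
  have hmono : StrictMono H := strictMono_of_hasDerivAt_pos hH hH'
  have h1 := lintegral_comp_primitive_of_antitone hr hpos hZ.1 hZ.2 (ψ ∘ Function.invFun H)
  rw [← transportMap_spec hr hpos hH hH0 hΛ hHΛ hZ, setLIntegral_Ioo_comp_of_hasDerivAt hH hH' hH0
    (transportMap_nonneg hr hpos hH hH' hH0 hΛ hHΛ hZ)] at h1
  refine h1.trans (lintegral_congr fun σ => ?_)
  rw [Function.comp_apply, Function.leftInverse_invFun hmono.injective σ]

end Transport

section OneDimensional
open Set Filter Topology
open scoped ENNReal Pointwise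

variable {m : Measure ℝ} [IsFiniteMeasure m] {M : ℝ}

theorem tailInverse_pos (hM : m (Ioi M) = 0) (h0 : m (Iic 0) = 0) {z : ℝ}
    (hz : z ∈ Ico 0 (m.real univ)) : 0 < tailInverse m z := by
  rw [lt_tailInverse_iff hM le_rfl hz.1, measureReal_def, ← compl_Iic,
    measure_compl measurableSet_Iic (measure_ne_top _ _), h0, tsub_zero]
  exact hz.2

theorem lintegral_eq_tailInverse (hM : m (Ioi M) = 0) (h0 : m (Iic 0) = 0) {φ : ℝ → ℝ≥0∞}
    (hφ : Measurable φ) :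
    ∫⁻ t, φ t ∂m = ∫⁻ z in Ioo 0 (m.real univ), φ (tailInverse m z) := by
  rw [← lintegral_map hφ (antitone_tailInverse hM).measurable, map_tailInverse h0 hM]

theorem antitone_tailInverse_rpow (hM : m (Ioi M) = 0) {q : ℝ} (hq : 0 ≤ q) :
    Antitone fun z => tailInverse m z ^ q := fun _ _ h =>
  Real.rpow_le_rpow (tailInverse_nonneg m _) (antitone_tailInverse hM h) hq

theorem integral_tailInverse_rpow (hM : m (Ioi M) = 0) (h0 : m (Iic 0) = 0) {q : ℝ} (hq : 0 ≤ q) :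
    ENNReal.ofReal (∫ z in (0 : ℝ)..m.real univ, tailInverse m z ^ q) =
      ∫⁻ t, ENNReal.ofReal (t ^ q) ∂m := by
  rw [lintegral_eq_tailInverse hM h0 (by fun_prop),
    intervalIntegral.integral_of_le measureReal_nonneg,
    ofReal_integral_eq_lintegral_ofReal (antitone_tailInverse_rpow hM hq).intervalIntegrable.1,
    Measure.restrict_congr_set Ioo_ae_eq_Ioc]
  exact ae_of_all _ fun z => Real.rpow_nonneg (tailInverse_nonneg m z) q

theorem lintegral_Ioo_rpow {β y : ℝ} (hβ : 0 ≤ β) (hy : 0 ≤ y) :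
    ∫⁻ t in Ioo 0 y, ENNReal.ofReal (t ^ β) = ENNReal.ofReal (y ^ (β + 1) / (β + 1)) := by
  rw [Measure.restrict_congr_set Ioo_ae_eq_Ioc, ← ofReal_integral_eq_lintegral_ofReal
      (intervalIntegral.intervalIntegrable_rpow' (by linarith)).1,
    ← intervalIntegral.integral_of_le hy, integral_rpow (Or.inl (by linarith)),
    Real.zero_rpow (by linarith), sub_zero]
  filter_upwards [ae_restrict_mem measurableSet_Ioc] with y hy
  exact Real.rpow_nonneg hy.1.le _

theorem lintegral_transport_le (hM : m (Ioi M) = 0) (h0 : m (Iic 0) = 0) {q κ s c : ℝ}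
    {N : ℝ≥0∞} (hq : 0 < q) (hκ0 : 0 < κ) (hκ1 : κ < 1) (hs : 0 < s) (hqs : q * s + 1 = q * (1 - κ))
    (hineq : ∀ h : ℝ → ℝ≥0∞, Measurable h →
      ∫⁻ t in Ioi (0 : ℝ), ENNReal.ofReal c * m (Ioi t) ^ (1 - κ) * h t ≤
        N * (∫⁻ t, h t ^ (1 / s) ∂m) ^ s)
    {H H' : ℝ → ℝ} {Λ : ℝ} (hH : ∀ s, HasDerivAt H (H' s) s) (hH'c : Continuous H')
    (hH' : ∀ s, 0 < H' s) (hH0 : H 0 = 0) (hΛ : 0 ≤ Λ)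
    (hHΛ : H Λ = ∫ z in (0 : ℝ)..m.real univ, tailInverse m z ^ q) :
    ENNReal.ofReal (c / (q * (1 - κ))) * ∫⁻ σ in Ioo 0 Λ, ENNReal.ofReal (H' σ ^ (1 - κ)) ≤
      N * (∫⁻ σ in Ioo 0 Λ, ENNReal.ofReal (H' σ) * ENNReal.ofReal (σ ^ (κ / s))) ^ s := by
  set Z₀ := m.real univ with hZ₀
  set v := tailInverse m with hv
  set r : ℝ → ℝ := fun z => v z ^ q with hr
  have hvm : Measurable v := (antitone_tailInverse hM).measurable
  have hv0 : ∀ z, 0 ≤ v z := tailInverse_nonneg m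
  have hvpos : ∀ z ∈ Ico 0 Z₀, 0 < v z := fun z hz => tailInverse_pos hM h0 hz
  have hra : Antitone r := antitone_tailInverse_rpow hM hq.le
  have hrpos : ∀ z ∈ Ico 0 Z₀, 0 < r z := fun z hz => Real.rpow_pos_of_pos (hvpos z hz) q
  have hZ0 : 0 ≤ Z₀ := measureReal_nonneg
  set S := transportMap r H with hS
  have hSm : MonotoneOn S (Icc 0 Z₀) := transportMap_monotoneOn hra hrpos hH hH' hH0 hΛ hHΛ
  have hS0 : ∀ z ∈ Icc 0 Z₀, 0 ≤ S z := fun z hz =>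
    transportMap_nonneg hra hrpos hH hH' hH0 hΛ hHΛ hz
  have hSΛ : S Z₀ = Λ := transportMap_right hH hH' hHΛ
  have htr := fun {Z : ℝ} (hZ : Z ∈ Icc 0 Z₀) (ψ : ℝ → ℝ≥0∞) =>
    lintegral_comp_transportMap hra hrpos hH hH' hH0 hΛ hHΛ hZ ψ
  set V : ℝ → ℝ := fun t => m.real (Ioi t) with hV
  have hVmem : ∀ t, V t ∈ Icc 0 Z₀ := fun t =>
    ⟨measureReal_nonneg, measureReal_mono (subset_univ _)⟩
  have hSV : Antitone fun t => S (V t) := fun t t' h =>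
    hSm (hVmem t') (hVmem t) (antitone_real_Ioi m h)
  have hgal : ∀ {t z : ℝ}, 0 ≤ t → 0 ≤ z → (t < v z ↔ z < V t) := fun ht hz =>
    lt_tailInverse_iff hM ht hz
  set h : ℝ → ℝ≥0∞ := fun t => ENNReal.ofReal (t ^ (q * s)) * ENNReal.ofReal (S (V t) ^ κ) with hh
  have hhm : Measurable h := by
    exact (Measurable.ennreal_ofReal (by fun_prop)).mul
      (hSV.measurable.pow_const κ).ennreal_ofReal
  have hmain := hineq h hhm
  have hupper : ∫⁻ t, h t ^ (1 / s) ∂m ≤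
      ∫⁻ σ in Ioo 0 Λ, ENNReal.ofReal (H' σ) * ENNReal.ofReal (σ ^ (κ / s)) := by
    rw [← hSΛ, ← htr ⟨hZ0, le_rfl⟩ (fun σ => ENNReal.ofReal (σ ^ (κ / s))),
      lintegral_eq_tailInverse hM h0 (hhm.pow_const _)]
    refine setLIntegral_mono' measurableSet_Ioo fun z hz => ?_
    have hSz := hS0 _ (hVmem (v z))
    have hVz : V (v z) ≤ z := not_lt.mp fun hlt =>
      lt_irrefl _ ((hgal (hv0 z) hz.1.le).mpr hlt)
    rw [hh]
    simp only
    rw [ENNReal.mul_rpow_of_nonneg _ _ (by positivity),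
      ENNReal.ofReal_rpow_of_nonneg (Real.rpow_nonneg (hv0 z) _) (by positivity),
      ENNReal.ofReal_rpow_of_nonneg (Real.rpow_nonneg hSz _) (by positivity),
      ← Real.rpow_mul (hv0 z), ← Real.rpow_mul hSz, mul_one_div, mul_one_div,
      mul_div_cancel_right₀ _ hs.ne']
    refine mul_le_mul' le_rfl (ENNReal.ofReal_le_ofReal ?_)
    exact Real.rpow_le_rpow hSz (hSm (hVmem _) ⟨hz.1.le, hz.2.le⟩ hVz) (by positivity)
  set k : ℝ → ℝ≥0∞ := fun z => (ENNReal.ofReal (r z) * ENNReal.ofReal ((H' (S z))⁻¹)) ^ κ with hk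
  have hSae : AEMeasurable S (volume.restrict (Ioo 0 Z₀)) :=
    aemeasurable_restrict_of_monotoneOn measurableSet_Ioo (hSm.mono Ioo_subset_Icc_self)
  have hfae : AEMeasurable (fun z => ENNReal.ofReal (r z) * ENNReal.ofReal ((H' (S z))⁻¹))
      (volume.restrict (Ioo 0 Z₀)) :=
    (hra.measurable.ennreal_ofReal.aemeasurable).mul
      ((hH'c.measurable.comp_aemeasurable hSae).inv.ennreal_ofReal)
  have hkae : AEMeasurable k (volume.restrict (Ioo 0 Z₀)) := hfae.pow_const _
  have hholder : ∀ t, ∫⁻ z in Ioo 0 (V t), k z ≤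
      m (Ioi t) ^ (1 - κ) * ENNReal.ofReal (S (V t) ^ κ) := by
    intro t
    have hres : volume.restrict (Ioo 0 (V t)) ≤ volume.restrict (Ioo 0 Z₀) :=
      Measure.restrict_mono (Ioo_subset_Ioo_right (hVmem t).2) le_rfl
    have h1 := ENNReal.lintegral_mul_norm_pow_le (μ := volume.restrict (Ioo 0 (V t)))
      (hfae.mono_measure hres) (aemeasurable_const (b := (1 : ℝ≥0∞))) hκ0.le (sub_pos.mpr hκ1).le
      (by ring)
    simp only [ENNReal.one_rpow, mul_one] at h1
    refine h1.trans (le_of_eq ?_)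
    rw [htr (hVmem t) (fun σ => ENNReal.ofReal ((H' σ)⁻¹)), setLIntegral_const, one_mul,
      Real.volume_Ioo, sub_zero, mul_comm]
    congr 1
    · rw [hV]; simp only; rw [ofReal_measureReal]
    · have : ∀ σ, ENNReal.ofReal (H' σ) * ENNReal.ofReal ((H' σ)⁻¹) = 1 := fun σ => by
        rw [← ENNReal.ofReal_mul (hH' σ).le, mul_inv_cancel₀ (hH' σ).ne', ENNReal.ofReal_one]
      simp only [this]
      rw [setLIntegral_const, one_mul, Real.volume_Ioo, sub_zero,
        ENNReal.ofReal_rpow_of_nonneg (hS0 _ (hVmem t)) hκ0.le]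
  have hlower : ENNReal.ofReal (1 / (q * (1 - κ))) *
      ∫⁻ σ in Ioo 0 Λ, ENNReal.ofReal (H' σ ^ (1 - κ)) ≤
      ∫⁻ t in Ioi (0 : ℝ), m (Ioi t) ^ (1 - κ) * h t := by
    have hq1 : 0 < q * (1 - κ) := mul_pos hq (sub_pos.mpr hκ1)
    calc ENNReal.ofReal (1 / (q * (1 - κ))) * ∫⁻ σ in Ioo 0 Λ, ENNReal.ofReal (H' σ ^ (1 - κ))
        = ENNReal.ofReal (1 / (q * (1 - κ))) * ∫⁻ z in Ioo 0 Z₀,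
            ENNReal.ofReal (r z) * ENNReal.ofReal (H' (S z) ^ (-κ)) := by
          rw [htr ⟨hZ0, le_rfl⟩ (fun σ => ENNReal.ofReal (H' σ ^ (-κ))), ← hS, hSΛ]
          congr 1
          refine lintegral_congr fun σ => ?_
          rw [← ENNReal.ofReal_mul (hH' σ).le, sub_eq_add_neg, Real.rpow_add (hH' σ), Real.rpow_one]
      _ = ∫⁻ z in Ioo 0 Z₀, k z * ∫⁻ t in Ioo 0 (v z), ENNReal.ofReal (t ^ (q * s)) := by
          rw [← lintegral_const_mul' _ _ ENNReal.ofReal_ne_top]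
          refine setLIntegral_congr_fun measurableSet_Ioo fun z hz => ?_
          have hvz := hvpos z ⟨hz.1.le, hz.2⟩
          have hHz := hH' (S z)
          simp only [hk, hr]
          rw [lintegral_Ioo_rpow (by positivity) (hv0 z), hqs,
            ← ENNReal.ofReal_mul (by positivity), ← ENNReal.ofReal_mul (by positivity),
            ← ENNReal.ofReal_mul (by positivity), ENNReal.ofReal_rpow_of_pos (by positivity),
            ← ENNReal.ofReal_mul (by positivity), Real.mul_rpow (by positivity) (by positivity),
            ← Real.rpow_mul hvz.le, Real.inv_rpow hHz.le, Real.rpow_neg hHz.le]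
          congr 1
          have : v z ^ q = v z ^ (q * κ) * v z ^ (q * (1 - κ)) := by
            rw [← Real.rpow_add hvz]; congr 1; ring
          rw [this]
          ring
      _ = ∫⁻ z in Ioo 0 Z₀, ∫⁻ t in Ioi (0 : ℝ),
            (Iio (v z)).indicator (fun t => k z * ENNReal.ofReal (t ^ (q * s))) t := by
          refine lintegral_congr fun z => ?_
          rw [lintegral_indicator measurableSet_Iio, Measure.restrict_restrict measurableSet_Iio,
            inter_comm, Ioi_inter_Iio, lintegral_const_mul _ (by fun_prop)]
      _ = ∫⁻ t in Ioi (0 : ℝ), ∫⁻ z in Ioo 0 Z₀,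
            (Iio (v z)).indicator (fun t => k z * ENNReal.ofReal (t ^ (q * s))) t := by
          refine lintegral_lintegral_swap ?_
          have hset : MeasurableSet {x : ℝ × ℝ | x.2 < v x.1} :=
            measurableSet_lt measurable_snd (hvm.comp measurable_fst)
          have hm2 : AEMeasurable (fun x : ℝ × ℝ => k x.1 * ENNReal.ofReal (x.2 ^ (q * s)))
              ((volume.restrict (Ioo 0 Z₀)).prod (volume.restrict (Ioi 0))) :=
            (hkae.comp_quasiMeasurePreserving Measure.quasiMeasurePreserving_fst).mul
              (by fun_prop)
          exact hm2.indicator hset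
      _ = ∫⁻ t in Ioi (0 : ℝ), (∫⁻ z in Ioo 0 (V t), k z) * ENNReal.ofReal (t ^ (q * s)) := by
          refine setLIntegral_congr_fun measurableSet_Ioi fun t ht => ?_
          have ht0 : 0 < t := ht
          have e1 : ∀ z ∈ Ioo 0 Z₀,
              (Iio (v z)).indicator (fun t => k z * ENNReal.ofReal (t ^ (q * s))) t =
              (Iio (V t)).indicator (fun z => k z * ENNReal.ofReal (t ^ (q * s))) z := by
            intro z hz
            by_cases hlt : t < v z
            · rw [indicator_of_mem (by exact hlt),
                indicator_of_mem (by exact (hgal ht0.le hz.1.le).mp hlt)]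
            · rw [indicator_of_notMem (by exact hlt),
                indicator_of_notMem (by exact fun hc => hlt ((hgal ht0.le hz.1.le).mpr hc))]
          rw [setLIntegral_congr_fun measurableSet_Ioo e1, lintegral_indicator measurableSet_Iio,
            Measure.restrict_restrict measurableSet_Iio, inter_comm, Ioo_inter_Iio,
            min_eq_right (hVmem t).2, lintegral_mul_const' _ _ ENNReal.ofReal_ne_top]
      _ ≤ _ := by
          refine lintegral_mono fun t => ?_
          refine (mul_le_mul' (hholder t) le_rfl).trans (le_of_eq ?_)
          simp only [hh]
          ring
  calc _ = ENNReal.ofReal c * (ENNReal.ofReal (1 / (q * (1 - κ))) *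
        ∫⁻ σ in Ioo 0 Λ, ENNReal.ofReal (H' σ ^ (1 - κ))) := by
        rw [← mul_assoc, ← ENNReal.ofReal_mul' (by
          have := mul_pos hq (sub_pos.mpr hκ1); positivity), mul_one_div]
    _ ≤ ENNReal.ofReal c * ∫⁻ t in Ioi (0 : ℝ), m (Ioi t) ^ (1 - κ) * h t := by gcongr
    _ = ∫⁻ t in Ioi (0 : ℝ), ENNReal.ofReal c * m (Ioi t) ^ (1 - κ) * h t := by
        rw [← lintegral_const_mul' _ _ ENNReal.ofReal_ne_top]
        simp only [mul_assoc]
    _ ≤ _ := hmain.trans (by gcongr)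

end OneDimensional

section BetaIntegral
open Set Filter Topology
open scoped ENNReal Pointwise

theorem lintegral_rpow_mul_exp {A r : ℝ} (hA : 0 < A) (hr : 0 < r) :
    ∫⁻ t in Ioi (0 : ℝ), ENNReal.ofReal (t ^ (A - 1) * Real.exp (-(r * t))) =
      ENNReal.ofReal (Real.Gamma A * r ^ (-A)) := by
  have hval := Real.integral_rpow_mul_exp_neg_mul_Ioi hA hr
  have hG := Real.Gamma_pos_of_pos hA
  have hint : IntegrableOn (fun t : ℝ => t ^ (A - 1) * Real.exp (-(r * t))) (Ioi 0) :=
    not_imp_comm.1 integral_undef (by rw [hval]; positivity)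
  rw [← ofReal_integral_eq_lintegral_ofReal hint, hval, one_div, Real.inv_rpow hr.le,
    Real.rpow_neg hr.le, mul_comm]
  filter_upwards [ae_restrict_mem measurableSet_Ioi] with t ht
  have : 0 < t := ht
  positivity

theorem lintegral_rpow_mul_one_add_rpow_neg {x B : ℝ} (hx : 0 < x) (hxB : x < B) :
    ∫⁻ t in Ioi (0 : ℝ), ENNReal.ofReal (t ^ (x - 1) * (1 + t) ^ (-B)) =
      ENNReal.ofReal (Real.Gamma x * Real.Gamma (B - x) / Real.Gamma B) := by
  have hB : 0 < B := hx.trans hxB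
  have hGB := Real.Gamma_pos_of_pos hB
  have key : ENNReal.ofReal (Real.Gamma B) *
      ∫⁻ t in Ioi (0 : ℝ), ENNReal.ofReal (t ^ (x - 1) * (1 + t) ^ (-B)) =
      ENNReal.ofReal (Real.Gamma x * Real.Gamma (B - x)) := by
    calc _ = ∫⁻ t in Ioi (0 : ℝ), ∫⁻ s in Ioi (0 : ℝ), ENNReal.ofReal (t ^ (x - 1)) *
          ENNReal.ofReal (s ^ (B - 1) * Real.exp (-((1 + t) * s))) := by
          rw [← lintegral_const_mul' _ _ ENNReal.ofReal_ne_top]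
          refine setLIntegral_congr_fun measurableSet_Ioi fun t ht => ?_
          have ht0 : 0 < t := ht
          rw [lintegral_const_mul' _ _ ENNReal.ofReal_ne_top,
            lintegral_rpow_mul_exp hB (by positivity), ← ENNReal.ofReal_mul hGB.le,
            ← ENNReal.ofReal_mul (by positivity)]
          congr 1
          ring
      _ = ∫⁻ s in Ioi (0 : ℝ), ∫⁻ t in Ioi (0 : ℝ), ENNReal.ofReal (t ^ (x - 1)) *
          ENNReal.ofReal (s ^ (B - 1) * Real.exp (-((1 + t) * s))) :=
          lintegral_lintegral_swap (by unfold Function.uncurry; fun_prop)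
      _ = ∫⁻ s in Ioi (0 : ℝ), ENNReal.ofReal (Real.Gamma x) *
          ENNReal.ofReal (s ^ (B - x - 1) * Real.exp (-(1 * s))) := by
          refine setLIntegral_congr_fun measurableSet_Ioi fun s hs => ?_
          have hs0 : 0 < s := hs
          calc _ = ∫⁻ t in Ioi (0 : ℝ), ENNReal.ofReal (s ^ (B - 1) * Real.exp (-(1 * s))) *
                ENNReal.ofReal (t ^ (x - 1) * Real.exp (-(s * t))) := by
                refine setLIntegral_congr_fun measurableSet_Ioi fun t ht => ?_
                have ht0 : 0 < t := ht
                rw [← ENNReal.ofReal_mul (by positivity), ← ENNReal.ofReal_mul (by positivity),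
                  show -((1 + t) * s) = -(1 * s) + -(s * t) by ring, Real.exp_add]
                congr 1
                ring
            _ = _ := by
                rw [lintegral_const_mul' _ _ ENNReal.ofReal_ne_top,
                  lintegral_rpow_mul_exp hx hs0, ← ENNReal.ofReal_mul (by positivity),
                  ← ENNReal.ofReal_mul (Real.Gamma_pos_of_pos hx).le,
                  show B - x - 1 = (B - 1) + -x by ring, Real.rpow_add hs0]
                congr 1
                ring
      _ = _ := by
          rw [lintegral_const_mul' _ _ ENNReal.ofReal_ne_top,
            lintegral_rpow_mul_exp (sub_pos.mpr hxB) one_pos, Real.one_rpow, mul_one,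
            ← ENNReal.ofReal_mul (Real.Gamma_pos_of_pos hx).le]
  rw [ENNReal.ofReal_div_of_pos hGB, ← key, mul_comm,
    ENNReal.mul_div_cancel_right (ENNReal.ofReal_pos.mpr hGB).ne' ENNReal.ofReal_ne_top]

theorem lintegral_rpow_mul_one_add_rpow_rpow_neg {β A B : ℝ} (hβ : 0 < β) (hA : 0 < A)
    (hAB : A < β * B) :
    ∫⁻ r in Ioi (0 : ℝ), ENNReal.ofReal (r ^ (A - 1) * (1 + r ^ β) ^ (-B)) =
      ENNReal.ofReal (Real.Gamma (A / β) * Real.Gamma (B - A / β) / Real.Gamma B / β) := by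
  have hAβ : 0 < A / β := div_pos hA hβ
  have h := lintegral_rpow_mul_one_add_rpow_neg hAβ ((div_lt_iff₀' hβ).mpr hAB)
  rw [lintegral_Ioi_rpow_substitution hβ] at h
  rw [ENNReal.ofReal_div_of_pos hβ, ← h, ENNReal.eq_div_iff (ENNReal.ofReal_pos.mpr hβ).ne'
    ENNReal.ofReal_ne_top, ← lintegral_const_mul' _ _ ENNReal.ofReal_ne_top]
  refine setLIntegral_congr_fun measurableSet_Ioi fun r hr => ?_
  have hr0 : 0 < r := hr
  rw [← ENNReal.ofReal_mul hβ.le, ← ENNReal.ofReal_mul (by positivity), ← Real.rpow_mul hr0.le,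
    show A - 1 = (β - 1) + β * (A / β - 1) by field_simp; ring, Real.rpow_add hr0]
  congr 1
  ring

end BetaIntegral

section SharpTransport
open Set Filter Topology
open scoped ENNReal Pointwise

variable {m : Measure ℝ} [IsFiniteMeasure m] {M : ℝ}

theorem lintegral_Ioi_le_of_Ioo {f : ℝ → ℝ≥0∞} {C : ℝ≥0∞}
    (h : ∀ Λ : ℝ, 0 < Λ → ∫⁻ σ in Ioo 0 Λ, f σ ≤ C) : ∫⁻ σ in Ioi (0 : ℝ), f σ ≤ C := by
  have hU : Ioi (0 : ℝ) = ⋃ k : ℕ, Ioo (0 : ℝ) (k + 1) := by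
    ext t
    simp only [mem_Ioi, mem_iUnion, mem_Ioo]
    refine ⟨fun ht => ?_, fun ⟨_, h⟩ => h.1⟩
    obtain ⟨k, hk⟩ := exists_nat_gt t
    exact ⟨k, ht, by linarith⟩
  rw [hU, setLIntegral_iUnion_of_directed _ (Monotone.directed_le fun i j hij => by
    refine Ioo_subset_Ioo_right ?_
    have : (i : ℝ) ≤ j := by exact_mod_cast hij
    linarith)]
  exact iSup_le fun k => h _ (by positivity)

/-- The sharp one-dimensional inequality behind the Hardy–Sobolev inequality for `p > 1`. -/
theorem sharp_transport_le (hM : m (Ioi M) = 0) (h0 : m (Iic 0) = 0) {q κ s c : ℝ} {N : ℝ≥0∞}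
    (hq : 0 < q) (hκ0 : 0 < κ) (hκ1 : κ < 1) (hs : 0 < s) (hqs : q * s + 1 = q * (1 - κ))
    (hc : 0 ≤ c)
    (hineq : ∀ h : ℝ → ℝ≥0∞, Measurable h →
      ∫⁻ t in Ioi (0 : ℝ), ENNReal.ofReal c * m (Ioi t) ^ (1 - κ) * h t ≤
        N * (∫⁻ t, h t ^ (1 / s) ∂m) ^ s) :
    ENNReal.ofReal (c * (Real.Gamma (s / κ + 1) * Real.Gamma ((1 - s) / κ) /
      Real.Gamma (1 / κ)) ^ κ * (1 / (q * s)) ^ s) *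
        (∫⁻ t, ENNReal.ofReal (t ^ q) ∂m) ^ (1 / q) ≤ N := by
  have hF := integral_tailInverse_rpow hM h0 hq.le
  set F := ∫ z in (0 : ℝ)..m.real univ, tailInverse m z ^ q with hFdef
  rw [← hF]
  rcases le_or_gt F 0 with hF0 | hF0
  · rw [ENNReal.ofReal_of_nonpos hF0, ENNReal.zero_rpow_of_pos (by positivity), mul_zero]
    exact zero_le
  have hsκ : 1 - κ - s = 1 / q := by field_simp; linarith
  have hqpos : 0 < 1 / q := by positivity
  have hs1 : s < 1 := by linarith
  set e := κ / s with hee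
  have he0 : 0 < e := by rw [hee]; positivity
  have h1e : 1 / e = s / κ := by rw [hee, one_div_div]
  set D := 1 / κ with hD
  have hD0 : 0 < D := by positivity
  set G' : ℝ → ℝ := fun σ => (1 + |σ| ^ e) ^ (-D) with hG'
  have hbase : ∀ σ : ℝ, 0 < 1 + |σ| ^ e := fun σ => by positivity
  have hG'pos : ∀ σ, 0 < G' σ := fun σ => Real.rpow_pos_of_pos (hbase σ) _
  have hG'c : Continuous G' := by
    refine Continuous.rpow_const ?_ fun σ => Or.inl (hbase σ).ne'
    exact continuous_const.add (continuous_abs.rpow_const fun _ => Or.inr he0.le)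
  set G : ℝ → ℝ := fun x => ∫ σ in (0 : ℝ)..x, G' σ with hG
  have hGd : ∀ x, HasDerivAt G (G' x) x := fun x =>
    intervalIntegral.integral_hasDerivAt_right (hG'c.intervalIntegrable _ _)
      hG'c.stronglyMeasurable.stronglyMeasurableAtFilter hG'c.continuousAt
  set x := s / κ with hx
  set y := (1 - s) / κ with hy
  have hx0 : 0 < x := by positivity
  have hy1 : y - 1 = D / q := by
    rw [hy, hD]; field_simp; linarith
  have hy10 : 0 < y - 1 := by rw [hy1]; positivity
  have hxy : D - x = y := by rw [hD, hx, hy]; field_simp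
  set K := Real.Gamma (x + 1) * Real.Gamma y / Real.Gamma D with hK
  have hK0 : 0 < K := by
    have h1 := Real.Gamma_pos_of_pos (show 0 < x + 1 by linarith)
    have h2 := Real.Gamma_pos_of_pos (show 0 < y by linarith)
    have h3 := Real.Gamma_pos_of_pos hD0
    positivity
  have hGx : Real.Gamma (x + 1) = x * Real.Gamma x := Real.Gamma_add_one hx0.ne'
  have hGy : Real.Gamma y = (y - 1) * Real.Gamma (y - 1) := by
    rw [← Real.Gamma_add_one hy10.ne']; ring_nf
  have hGD : Real.Gamma D = (D - 1) * Real.Gamma (D - 1) := by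
    have hD1 : D - 1 ≠ 0 := by linarith
    rw [← Real.Gamma_add_one hD1]; ring_nf
  have hD1 : 0 < D - 1 := by linarith
  have hGDpos := Real.Gamma_pos_of_pos hD1
  have hGinf : ∫⁻ σ in Ioi (0 : ℝ), ENNReal.ofReal ((1 + σ ^ e) ^ (-D)) = ENNReal.ofReal K := by
    have h := lintegral_rpow_mul_one_add_rpow_rpow_neg (A := 1) (B := D) he0 one_pos (by
      rw [← div_lt_iff₀' he0, h1e]; linarith)
    simp only [sub_self, Real.rpow_zero, one_mul] at h
    rw [h, h1e, hxy, hK, hGx]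
    congr 1
    rw [div_eq_mul_one_div _ e, h1e]
    ring
  have hIinf : ∫⁻ σ in Ioi (0 : ℝ), ENNReal.ofReal ((1 + σ ^ e) ^ (-(D - 1))) =
      ENNReal.ofReal (K * (D - 1) / (y - 1)) := by
    have h := lintegral_rpow_mul_one_add_rpow_rpow_neg (A := 1) (B := D - 1) he0 one_pos (by
      rw [← div_lt_iff₀' he0, h1e]; linarith)
    simp only [sub_self, Real.rpow_zero, one_mul] at h
    rw [h, h1e, show D - 1 - x = y - 1 by linarith, hK, hGx, hGy, hGD, div_eq_mul_one_div _ e, h1e]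
    congr 1
    field_simp
  have hJinf : ∫⁻ σ in Ioi (0 : ℝ), ENNReal.ofReal (σ ^ e * (1 + σ ^ e) ^ (-D)) =
      ENNReal.ofReal (K * x / (y - 1)) := by
    have hA : (e + 1) / e = x + 1 := by
      rw [add_div, div_self he0.ne', h1e, add_comm]
    have h := lintegral_rpow_mul_one_add_rpow_rpow_neg (A := e + 1) (B := D) he0 (by positivity) (by
      rw [← div_lt_iff₀' he0, hA]; linarith)
    simp only [add_sub_cancel_right] at h
    rw [h, hA, show D - (x + 1) = y - 1 by linarith, hK, hGy, div_eq_mul_one_div _ e, h1e]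
    congr 1
    field_simp
  set L := F / K with hL
  have hL0 : 0 < L := by positivity
  have hmain : ∀ Λ : ℝ, 0 < Λ → ENNReal.ofReal (c / (q * (1 - κ)) * L ^ (1 / q)) *
      ∫⁻ σ in Ioo 0 Λ, ENNReal.ofReal ((1 + σ ^ e) ^ (-(D - 1))) ≤
      N * (ENNReal.ofReal (K * x / (y - 1))) ^ s := by
    intro Λ hΛ
    have hGΛ : 0 < G Λ :=
      intervalIntegral.intervalIntegral_pos_of_pos (hG'c.intervalIntegrable _ _) hG'pos hΛ
    have hGK : G Λ ≤ K := by
      rw [← ENNReal.ofReal_le_ofReal_iff hK0.le, hG, ← hGinf]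
      simp only
      rw [intervalIntegral.integral_of_le hΛ.le, ofReal_integral_eq_lintegral_ofReal
        (hG'c.intervalIntegrable _ _).1 (ae_of_all _ fun σ => (hG'pos σ).le)]
      refine (lintegral_mono_set Ioc_subset_Ioi_self).trans (le_of_eq ?_)
      refine setLIntegral_congr_fun measurableSet_Ioi fun σ hσ => ?_
      simp only [hG', abs_of_pos (show 0 < σ from hσ)]
    set l := F / G Λ with hl
    have hl0 : 0 < l := by positivity
    have hLl : L ≤ l := div_le_div_of_nonneg_left hF0.le hGΛ hGK
    have h := lintegral_transport_le hM h0 hq hκ0 hκ1 hs hqs hineq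
      (H := fun x => l * G x) (H' := fun x => l * G' x) (Λ := Λ)
      (fun x => (hGd x).const_mul l) (continuous_const.mul hG'c)
      (fun x => mul_pos hl0 (hG'pos x)) (by simp [hG]) hΛ.le (by
        show l * G Λ = _
        rw [hl, div_mul_cancel₀ _ hGΛ.ne'])
    have e1 : ∫⁻ σ in Ioo 0 Λ, ENNReal.ofReal ((l * G' σ) ^ (1 - κ)) =
        ENNReal.ofReal (l ^ (1 - κ)) *
          ∫⁻ σ in Ioo 0 Λ, ENNReal.ofReal ((1 + σ ^ e) ^ (-(D - 1))) := by
      rw [← lintegral_const_mul' _ _ ENNReal.ofReal_ne_top]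
      refine setLIntegral_congr_fun measurableSet_Ioo fun σ hσ => ?_
      rw [← ENNReal.ofReal_mul (by positivity), Real.mul_rpow hl0.le (hG'pos σ).le]
      simp only [hG', abs_of_pos hσ.1]
      have := hσ.1
      rw [← Real.rpow_mul (by positivity), hD]
      congr 3
      field_simp
    have e2 : ∫⁻ σ in Ioo 0 Λ, ENNReal.ofReal (l * G' σ) * ENNReal.ofReal (σ ^ (κ / s)) ≤
        ENNReal.ofReal l * ENNReal.ofReal (K * x / (y - 1)) := by
      rw [← hJinf, ← lintegral_const_mul' _ _ ENNReal.ofReal_ne_top]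
      refine le_trans (le_of_eq ?_)
        (lintegral_mono_set (show Ioo 0 Λ ⊆ Ioi 0 from Ioo_subset_Ioi_self))
      refine setLIntegral_congr_fun measurableSet_Ioo fun σ hσ => ?_
      have := hσ.1
      simp only [hG', abs_of_pos hσ.1]
      rw [← ENNReal.ofReal_mul (by positivity), ← ENNReal.ofReal_mul (by positivity), hee]
      congr 1
      ring
    rw [e1] at h
    have hls : ENNReal.ofReal (l ^ s) ≠ 0 := (ENNReal.ofReal_pos.mpr (by positivity)).ne'
    have h2 := h.trans (mul_le_mul' le_rfl (ENNReal.rpow_le_rpow e2 hs.le))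
    rw [ENNReal.mul_rpow_of_nonneg _ _ hs.le, ENNReal.ofReal_rpow_of_nonneg hl0.le hs.le] at h2
    rw [← ENNReal.mul_le_mul_iff_right hls ENNReal.ofReal_ne_top]
    refine le_trans ?_ (h2.trans (le_of_eq (by ring)))
    rw [← mul_assoc, ← mul_assoc]
    refine mul_le_mul' ?_ le_rfl
    have h1κ : 0 < 1 - κ := by linarith
    rw [← ENNReal.ofReal_mul (by positivity), ← ENNReal.ofReal_mul (by positivity)]
    refine ENNReal.ofReal_le_ofReal ?_
    rw [show 1 - κ = s + 1 / q by linarith, Real.rpow_add hl0]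
    have : L ^ (1 / q) ≤ l ^ (1 / q) := Real.rpow_le_rpow hL0.le hLl hqpos.le
    rw [show s + 1 / q = 1 - κ by linarith]
    calc l ^ s * (c / (q * (1 - κ)) * L ^ (1 / q))
        ≤ l ^ s * (c / (q * (1 - κ)) * l ^ (1 / q)) := by gcongr
      _ = _ := by ring
  have h1κ : 0 < 1 - κ := by linarith
  have hfin : ENNReal.ofReal (c / (q * (1 - κ)) * L ^ (1 / q)) *
      ENNReal.ofReal (K * (D - 1) / (y - 1)) ≤ N * (ENNReal.ofReal (K * x / (y - 1))) ^ s := by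
    rw [← hIinf, ← lintegral_const_mul' _ _ ENNReal.ofReal_ne_top]
    refine lintegral_Ioi_le_of_Ioo fun Λ hΛ => ?_
    rw [lintegral_const_mul' _ _ ENNReal.ofReal_ne_top]
    exact hmain Λ hΛ
  have hJ0 : 0 < K * x / (y - 1) := by positivity
  rw [ENNReal.ofReal_rpow_of_nonneg hJ0.le hs.le] at hfin
  have hJs : ENNReal.ofReal ((K * x / (y - 1)) ^ s) ≠ 0 :=
    (ENNReal.ofReal_pos.mpr (by positivity)).ne'
  rw [← ENNReal.mul_le_mul_iff_left hJs ENNReal.ofReal_ne_top]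
  refine le_trans (le_of_eq ?_) hfin
  rw [ENNReal.ofReal_rpow_of_pos hF0, ← ENNReal.ofReal_mul (by positivity),
    ← ENNReal.ofReal_mul (by positivity), ← ENNReal.ofReal_mul (by positivity)]
  congr 1
  have hxq : K * x / (y - 1) = K * (q * s) := by
    rw [hy1, hx, hD]; field_simp
  have hDq : (D - 1) / (y - 1) = q * (1 - κ) := by
    rw [hy1, hD]; field_simp
  rw [hxq, mul_div_assoc, hDq, hL, Real.div_rpow hF0.le hK0.le,
      Real.mul_rpow hK0.le (by positivity),
    Real.div_rpow zero_le_one (by positivity), Real.one_rpow]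
  have hKK : K = K ^ κ * K ^ s * K ^ (1 / q) := by
    rw [← Real.rpow_add hK0, ← Real.rpow_add hK0, show κ + s + 1 / q = 1 by linarith, Real.rpow_one]
  have p1 : 0 < (q * s) ^ s := by positivity
  have p2 : 0 < K ^ (1 / q) := by positivity
  calc c * K ^ κ * (1 / (q * s) ^ s) * F ^ (1 / q) * (K ^ s * (q * s) ^ s)
      = c * F ^ (1 / q) * (K ^ κ * K ^ s) := by field_simp
    _ = c * F ^ (1 / q) * (K / K ^ (1 / q)) := by
        congr 1
        rw [eq_div_iff p2.ne', ← hKK]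
    _ = _ := by field_simp

end SharpTransport

section LevelMeasure
open Set Filter Topology
open scoped ENNReal Pointwise

variable {n : ℕ} {u : EuclideanSpace ℝ (Fin n) → ℝ} {b : ℝ}

/-- The distribution of `|u|` on `{u ≠ 0}` with respect to `‖x‖ ^ (-b) dx`. -/
def levelMeasure (u : EuclideanSpace ℝ (Fin n) → ℝ) (b : ℝ) : Measure ℝ :=
  ((volume.withDensity fun x => ENNReal.ofReal (‖x‖ ^ (-b))).restrict {x | u x ≠ 0}).map
    fun x => |u x|

theorem lintegral_levelMeasure (hu : Continuous u) {h : ℝ → ℝ≥0∞} (hh : Measurable h) :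
    ∫⁻ t, h t ∂(levelMeasure u b) =
      ∫⁻ x in {x | u x ≠ 0}, ENNReal.ofReal (‖x‖ ^ (-b)) * h |u x| := by
  have hS : MeasurableSet {x | u x ≠ 0} := (isOpen_ne_fun hu continuous_const).measurableSet
  have hau : Measurable fun x => |u x| := hu.abs.measurable
  have hd : Measurable fun x : EuclideanSpace ℝ (Fin n) => ENNReal.ofReal (‖x‖ ^ (-b)) := by
    fun_prop
  rw [levelMeasure, lintegral_map hh hau, restrict_withDensity hS]
  exact lintegral_withDensity_eq_lintegral_mul _ hd (hh.comp hau)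

theorem levelMeasure_Ioi (hu : Continuous u) {t : ℝ} (ht : 0 ≤ t) :
    levelMeasure u b (Ioi t) = ∫⁻ x in {x | t < |u x|}, ENNReal.ofReal (‖x‖ ^ (-b)) := by
  have hau : Measurable fun x => |u x| := hu.abs.measurable
  have hset : (fun x => |u x|) ⁻¹' Ioi t ∩ {x | u x ≠ 0} = {x | t < |u x|} := by
    ext x
    simp only [mem_inter_iff, mem_preimage, mem_Ioi, mem_ofPred_eq, and_iff_left_iff_imp]
    intro h
    exact abs_pos.mp (ht.trans_lt h)
  have hS : MeasurableSet {x | t < |u x|} := (isOpen_lt continuous_const hu.abs).measurableSet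
  rw [levelMeasure, Measure.map_apply hau measurableSet_Ioi,
    Measure.restrict_apply (hau measurableSet_Ioi), hset, withDensity_apply _ hS]

theorem levelMeasure_Iic_zero (hu : Continuous u) : levelMeasure u b (Iic 0) = 0 := by
  have hau : Measurable fun x => |u x| := hu.abs.measurable
  have hset : (fun x => |u x|) ⁻¹' Iic 0 ∩ {x | u x ≠ 0} = ∅ := by
    ext x
    simp
  rw [levelMeasure, Measure.map_apply hau measurableSet_Iic,
    Measure.restrict_apply (hau measurableSet_Iic), hset, measure_empty]

theorem isFiniteMeasure_levelMeasure (hn : 1 ≤ n) (hbn : b < n) (hc : HasCompactSupport u)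
    (hu : Continuous u) : IsFiniteMeasure (levelMeasure u b) := by
  refine ⟨?_⟩
  obtain ⟨R, hR⟩ := hc.isBounded.subset_ball 0
  have hR0 : (0 : ℝ) ≤ max R 0 := le_max_right _ _
  have h1 := lintegral_levelMeasure (b := b) hu (h := fun _ => 1) measurable_const
  rw [lintegral_one] at h1
  simp only [mul_one] at h1
  rw [h1]
  calc _ ≤ ∫⁻ x in Metric.ball (0 : EuclideanSpace ℝ (Fin n)) (max R 0),
        ENNReal.ofReal (‖x‖ ^ (-b)) := by
        refine lintegral_mono_set fun x hx => ?_
        exact Metric.ball_subset_ball (le_max_left _ _) (hR (subset_tsupport _ hx))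
    _ < ∞ := by
        rw [setLIntegral_ball_norm_rpow hn hbn hR0]
        exact ENNReal.mul_lt_top (ENNReal.mul_lt_top (ENNReal.natCast_lt_top _)
          measure_ball_lt_top) ENNReal.ofReal_lt_top

theorem exists_levelMeasure_Ioi_eq_zero (hc : HasCompactSupport u) (hu : Continuous u) :
    ∃ M, levelMeasure u b (Ioi M) = 0 := by
  obtain ⟨M, hM⟩ := hc.exists_bound_of_continuous hu
  have hM0 : 0 ≤ M := (norm_nonneg _).trans (hM 0)
  refine ⟨M, ?_⟩
  have hset : {x | M < |u x|} = ∅ := by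
    ext x
    simpa using hM x
  rw [levelMeasure_Ioi hu hM0, hset, Measure.restrict_empty, lintegral_zero_measure]

theorem lintegral_rpow_levelMeasure (hu : Continuous u) {q : ℝ} (hq : 0 < q) :
    ∫⁻ t, ENNReal.ofReal (t ^ q) ∂(levelMeasure u b) =
      ∫⁻ x, ENNReal.ofReal (|u x| ^ q * ‖x‖ ^ (-b)) := by
  have hS : MeasurableSet {x | u x ≠ 0} := (isOpen_ne_fun hu continuous_const).measurableSet
  rw [lintegral_levelMeasure hu (by fun_prop), ← lintegral_indicator hS]
  refine lintegral_congr fun x => ?_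
  by_cases hx : u x = 0
  · rw [indicator_of_notMem (by simpa using hx), hx, abs_zero, Real.zero_rpow hq.ne', zero_mul,
      ENNReal.ofReal_zero]
  · rw [indicator_of_mem (by exact hx), ← ENNReal.ofReal_mul (by positivity), mul_comm]

theorem levelMeasure_ineq (hn : 2 ≤ n) {w : ℝ} (hw : 0 < w)
    (hBv : volume (Metric.ball (0 : EuclideanSpace ℝ (Fin n)) 1) = ENNReal.ofReal (w ^ n))
    {α θ : ℝ} (hα0 : 0 ≤ α) (hα : α < n - 1) (hbn : b < n) (hαb : n * α ≤ (n - 1) * b)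
    (hθ : θ * (n - b) = n - 1 - α) (hu : ContDiff ℝ 1 u) (hc : HasCompactSupport u)
    {h : ℝ → ℝ≥0∞} (hh : Measurable h) :
    ∫⁻ t in Ioi (0 : ℝ), ENNReal.ofReal ((n * w ^ n) ^ (1 - θ) * (n - b) ^ θ) *
        levelMeasure u b (Ioi t) ^ θ * h t ≤
      ∫⁻ x, ENNReal.ofReal (‖fderiv ℝ u x‖ * ‖x‖ ^ (-α)) * (Ioi 0).indicator h |u x| := by
  refine le_trans (le_of_eq ?_) (lintegral_weighted_level_le hn hw hBv hα0 hα hbn hαb hθ hu hc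
    (hh.indicator measurableSet_Ioi))
  refine setLIntegral_congr_fun measurableSet_Ioi fun t ht => ?_
  rw [indicator_of_mem ht, levelMeasure_Ioi hu.continuous (le_of_lt ht)]

theorem lintegral_gradient_mul_le (hn : 2 ≤ n) {p s a : ℝ} (hp : 1 < p) (hs : s = 1 - 1 / p)
    (hu : ContDiff ℝ 1 u) {h : ℝ → ℝ≥0∞} (hh : Measurable h) :
    ∫⁻ x, ENNReal.ofReal (‖fderiv ℝ u x‖ * ‖x‖ ^ (-(a / p + b * s))) *
        (Ioi 0).indicator h |u x| ≤
      (∫⁻ x, ENNReal.ofReal (‖fderiv ℝ u x‖ ^ p * ‖x‖ ^ (-a))) ^ (1 / p) *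
        (∫⁻ t, h t ^ (1 / s) ∂(levelMeasure u b)) ^ s := by
  have hp0 : 0 < p := by linarith
  have hp1 : 1 / p < 1 := by rw [div_lt_one hp0]; exact hp
  have hs0 : 0 < s := by linarith
  have hpq : p.HolderConjugate (1 / s) := by
    rw [Real.holderConjugate_iff]
    refine ⟨hp, ?_⟩
    rw [one_div, inv_inv, hs, one_div]
    ring
  have hfd : Measurable fun x => ‖fderiv ℝ u x‖ :=
    (hu.continuous_fderiv one_ne_zero).norm.measurable
  have hau : Measurable fun x => |u x| := hu.continuous.abs.measurable
  set k := (Ioi (0 : ℝ)).indicator h with hk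
  have hkm : Measurable k := hh.indicator measurableSet_Ioi
  have hx0 : ∀ᵐ x : EuclideanSpace ℝ (Fin n), x ≠ 0 := by
    have : Nonempty (Fin n) := ⟨⟨0, by omega⟩⟩
    rw [ae_iff]
    simp
  have hmain := ENNReal.lintegral_mul_le_Lp_mul_Lq volume hpq
    (f := fun x => ENNReal.ofReal (‖fderiv ℝ u x‖ * ‖x‖ ^ (-(a / p))))
    (g := fun x => ENNReal.ofReal (‖x‖ ^ (-(b * s))) * k |u x|)
    (by fun_prop) (by fun_prop)
  rw [one_div_one_div] at hmain
  calc _ = ∫⁻ x, ((fun x => ENNReal.ofReal (‖fderiv ℝ u x‖ * ‖x‖ ^ (-(a / p)))) *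
        (fun x => ENNReal.ofReal (‖x‖ ^ (-(b * s))) * k |u x|)) x := by
        refine lintegral_congr_ae ?_
        filter_upwards [hx0] with x hx
        have hx' : 0 < ‖x‖ := norm_pos_iff.mpr hx
        simp only [Pi.mul_apply]
        rw [← mul_assoc, ← ENNReal.ofReal_mul (by positivity), neg_add, Real.rpow_add hx']
        congr 2
        ring
    _ ≤ _ := hmain
    _ = _ := by
        congr 2
        · congr 1
          funext x
          rw [ENNReal.ofReal_rpow_of_nonneg (by positivity) hp0.le,
            Real.mul_rpow (by positivity) (by positivity), ← Real.rpow_mul (norm_nonneg _)]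
          congr 3
          field_simp
        · have hS : MeasurableSet {x | u x ≠ 0} :=
            (isOpen_ne_fun hu.continuous continuous_const).measurableSet
          rw [lintegral_levelMeasure hu.continuous (hh.pow_const _), ← lintegral_indicator hS]
          refine lintegral_congr fun x => ?_
          rw [ENNReal.mul_rpow_of_nonneg _ _ (by positivity),
            ENNReal.ofReal_rpow_of_nonneg (by positivity) (by positivity),
            ← Real.rpow_mul (norm_nonneg _)]
          by_cases hx : u x = 0
          · rw [indicator_of_notMem (by simpa using hx), hk, hx, indicator_of_notMem (by simp),
              ENNReal.zero_rpow_of_pos (by positivity), mul_zero]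
          · rw [indicator_of_mem (by exact hx), hk,
              indicator_of_mem (show |u x| ∈ Ioi 0 from abs_pos.mpr hx)]
            congr 3
            field_simp

end LevelMeasure

section LintegralHardySobolev
open Set Filter Topology
open scoped ENNReal Pointwise

theorem lintegral_rpow_le_lintegral_tail {m : Measure ℝ} [IsFiniteMeasure m] {M : ℝ}
    (hM : m (Ioi M) = 0) (h0 : m (Iic 0) = 0) {q : ℝ} (hq : 1 < q) :
    (∫⁻ x, ENNReal.ofReal (x ^ q) ∂m) ^ (1 / q) ≤ ∫⁻ t in Ioi (0 : ℝ), m (Ioi t) ^ (1 / q) := by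
  have hq0 : 0 < q := by linarith
  have hq1 : 1 / q < 1 := by rwa [div_lt_one hq0]
  set A := ∫⁻ x, ENNReal.ofReal (x ^ q) ∂m with hA
  have hpos : ∀ᵐ x ∂m, 0 < x := by
    rw [ae_iff]
    convert h0 using 2
    ext x
    simp
  have hleM : ∀ᵐ x ∂m, x ≤ M := by
    rw [ae_iff]
    convert hM using 2
    ext x
    simp
  have hAfin : A ≠ ∞ := by
    refine ne_top_of_le_ne_top (b := ENNReal.ofReal (M ^ q) * m univ)
      (ENNReal.mul_ne_top ENNReal.ofReal_ne_top (measure_ne_top _ _)) ?_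
    rw [← lintegral_const]
    refine lintegral_mono_ae ?_
    filter_upwards [hpos, hleM] with x hx hxM
    exact ENNReal.ofReal_le_ofReal (Real.rpow_le_rpow hx.le hxM hq0.le)
  rcases eq_or_ne A 0 with hA0 | hA0
  · rw [hA0, ENNReal.zero_rpow_of_pos (by positivity)]
    exact zero_le
  have key : A ≤ A ^ (1 - 1 / q) * ∫⁻ t in Ioi (0 : ℝ), m (Ioi t) ^ (1 / q) := by
    calc A = ∫⁻ x, (∫⁻ t in Ioi (0 : ℝ),
          (Iio x).indicator (fun _ => ENNReal.ofReal (x ^ q) ^ (1 - 1 / q)) t) ∂m := by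
          refine lintegral_congr_ae ?_
          filter_upwards [hpos] with x hx
          rw [lintegral_indicator measurableSet_Iio, Measure.restrict_restrict measurableSet_Iio,
            inter_comm, Ioi_inter_Iio, setLIntegral_const, Real.volume_Ioo, sub_zero,
            ENNReal.ofReal_rpow_of_nonneg (by positivity) (by linarith),
            ← ENNReal.ofReal_mul (by positivity), ← Real.rpow_mul hx.le]
          congr 1
          rw [← Real.rpow_add_one hx.ne']
          congr 1
          field_simp
          ring
      _ = ∫⁻ t in Ioi (0 : ℝ), ∫⁻ x,
          (Iio x).indicator (fun _ => ENNReal.ofReal (x ^ q) ^ (1 - 1 / q)) t ∂m := by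
          refine lintegral_lintegral_swap ?_
          have hset : MeasurableSet {x : ℝ × ℝ | x.2 < x.1} :=
            measurableSet_lt measurable_snd measurable_fst
          have hm2 : Measurable (fun x : ℝ × ℝ => ENNReal.ofReal (x.1 ^ q) ^ (1 - 1 / q)) := by
            fun_prop
          exact (hm2.indicator hset).aemeasurable
      _ ≤ ∫⁻ t in Ioi (0 : ℝ), A ^ (1 - 1 / q) * m (Ioi t) ^ (1 / q) := by
          refine lintegral_mono fun t => ?_
          have h1 := ENNReal.lintegral_mul_norm_pow_le (μ := m)
            (f := fun x => ENNReal.ofReal (x ^ q)) (g := (Ioi t).indicator 1)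
            (by fun_prop) (aemeasurable_one.indicator measurableSet_Ioi)
            (sub_pos.mpr hq1).le (by positivity : 0 ≤ 1 / q) (by ring)
          rw [lintegral_indicator_one measurableSet_Ioi] at h1
          refine le_trans (lintegral_mono fun x => le_of_eq ?_) h1
          by_cases hx : t < x
          · rw [indicator_of_mem (by exact hx), indicator_of_mem (by exact hx), Pi.one_apply,
              ENNReal.one_rpow, mul_one]
          · rw [indicator_of_notMem (by exact hx), indicator_of_notMem (by exact hx),
              ENNReal.zero_rpow_of_pos (by positivity), mul_zero]
      _ = _ := lintegral_const_mul' _ _ (ENNReal.rpow_ne_top_of_nonneg (by linarith) hAfin)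
  have hB0 : A ^ (1 - 1 / q) ≠ 0 := by
    rw [Ne, ENNReal.rpow_eq_zero_iff]
    tauto
  have hBt : A ^ (1 - 1 / q) ≠ ∞ := ENNReal.rpow_ne_top_of_nonneg (by linarith) hAfin
  rw [← ENNReal.mul_le_mul_iff_right hB0 hBt]
  refine le_trans (le_of_eq ?_) key
  rw [← ENNReal.rpow_add _ _ hA0 hAfin, sub_add_cancel, ENNReal.rpow_one]

variable {n : ℕ} {u : EuclideanSpace ℝ (Fin n) → ℝ} {a b p q w : ℝ}

/-- The sharp Hardy–Sobolev inequality for `p > 1`, in terms of lower Lebesgue integrals. -/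
theorem lintegral_hardy_sobolev_of_one_lt (hw : 0 < w)
    (hBv : volume (Metric.ball (0 : EuclideanSpace ℝ (Fin n)) 1) = ENNReal.ofReal (w ^ n))
    (hp : 1 < p) (hpn : p < n) (ha : 0 ≤ a) (han : a < n - p) (hb1 : a * n / (n - p) ≤ b)
    (hb2 : b < a + p) (hq : q = (n - b) * p / (n - p - a)) {κ s : ℝ}
    (hκ : κ = 1 / p - 1 / q) (hs : s = 1 - 1 / p)
    (hu : ContDiff ℝ 1 u) (hc : HasCompactSupport u) :
    ENNReal.ofReal ((n * w ^ n) ^ κ * (n - b) ^ (1 - κ) * (Real.Gamma (s / κ + 1) *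
      Real.Gamma ((1 - s) / κ) / Real.Gamma (1 / κ)) ^ κ * (1 / (q * s)) ^ s) *
        (∫⁻ x, ENNReal.ofReal (|u x| ^ q * ‖x‖ ^ (-b))) ^ (1 / q) ≤
      (∫⁻ x, ENNReal.ofReal (‖fderiv ℝ u x‖ ^ p * ‖x‖ ^ (-a))) ^ (1 / p) := by
  have hn : 2 ≤ n := by
    have : (1 : ℝ) < n := by linarith
    have : 1 < n := by exact_mod_cast this
    omega
  have hp0 : 0 < p := by linarith
  have hnp : 0 < (n : ℝ) - p := by linarith
  have hnpa : 0 < (n : ℝ) - p - a := by linarith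
  have hbn : b < n := by linarith
  have hnb : 0 < (n : ℝ) - b := by linarith
  have hq0 : 0 < q := by rw [hq]; positivity
  have hb0 : 0 ≤ b := le_trans (by positivity) hb1
  have hs0 : 0 < s := by rw [hs, sub_pos, div_lt_one hp0]; exact hp
  have hκ' : κ = (p + a - b) / ((n - b) * p) := by
    rw [hκ, hq]; field_simp; ring
  have hpab : 0 < p + a - b := by linarith
  have hκ0 : 0 < κ := by rw [hκ']; positivity
  have hκ1 : κ < 1 := by
    have : 0 < 1 / q := by positivity
    linarith [show s = 1 - 1 / p from hs]
  have := isFiniteMeasure_levelMeasure (b := b) (by omega) hbn hc hu.continuous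
  obtain ⟨M, hM⟩ := exists_levelMeasure_Ioi_eq_zero (b := b) hc hu.continuous
  have hqs : q * s + 1 = q * (1 - κ) := by
    rw [hs, hκ]; field_simp; ring
  have hαb : n * (a / p + b * s) ≤ (n - 1) * b := by
    rw [div_le_iff₀ hnp] at hb1
    have e : (n - 1) * b - n * (a / p + b * s) = (b * (n - p) - a * n) / p := by
      rw [hs]; field_simp; ring
    have : 0 ≤ (b * (n - p) - a * n) / p := div_nonneg (by linarith) hp0.le
    linarith
  have hθ : (1 - κ) * (n - b) = n - 1 - (a / p + b * s) := by
    rw [hκ', hs]; field_simp; ring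
  have hα : a / p + b * s < n - 1 := by
    have : 0 < (1 - κ) * (n - b) := mul_pos (by linarith) hnb
    linarith
  rw [← lintegral_rpow_levelMeasure hu.continuous hq0]
  refine sharp_transport_le hM (levelMeasure_Iic_zero hu.continuous) hq0 hκ0 hκ1 hs0 hqs
    (by positivity) fun h hh => ?_
  refine le_trans ?_ (lintegral_gradient_mul_le hn hp hs hu hh)
  have := levelMeasure_ineq hn hw hBv (by positivity) hα hbn hαb hθ hu hc hh
  rwa [show 1 - (1 - κ) = κ by ring] at this

/-- The sharp Hardy–Sobolev inequality for `p = 1`, in terms of lower Lebesgue integrals. -/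
theorem lintegral_hardy_sobolev_one (hw : 0 < w)
    (hBv : volume (Metric.ball (0 : EuclideanSpace ℝ (Fin n)) 1) = ENNReal.ofReal (w ^ n))
    (hn : (1 : ℝ) < n) (ha : 0 ≤ a) (han : a < n - 1) (hb1 : a * n / (n - 1) ≤ b)
    (hb2 : b < a + 1) (hq : q = (n - b) / (n - 1 - a)) (hu : ContDiff ℝ 1 u)
    (hc : HasCompactSupport u) :
    ENNReal.ofReal ((n * w ^ n) ^ (1 - 1 / q) * (n - b) ^ (1 / q)) *
        (∫⁻ x, ENNReal.ofReal (|u x| ^ q * ‖x‖ ^ (-b))) ^ (1 / q) ≤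
      ∫⁻ x, ENNReal.ofReal (‖fderiv ℝ u x‖ * ‖x‖ ^ (-a)) := by
  have hn' : 2 ≤ n := by
    have : 1 < n := by exact_mod_cast hn
    omega
  have hbn : b < n := by linarith
  have hna : 0 < (n : ℝ) - 1 - a := by linarith
  have hn1 : 0 < (n : ℝ) - 1 := by linarith
  have hnb : 0 < (n : ℝ) - b := by linarith
  have hq1 : 1 < q := by rw [hq, one_lt_div hna]; linarith
  have := isFiniteMeasure_levelMeasure (b := b) (by omega) hbn hc hu.continuous
  obtain ⟨M, hM⟩ := exists_levelMeasure_Ioi_eq_zero (b := b) hc hu.continuous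
  rw [← lintegral_rpow_levelMeasure hu.continuous (by linarith)]
  refine (mul_le_mul' le_rfl (lintegral_rpow_le_lintegral_tail hM
    (levelMeasure_Iic_zero hu.continuous) hq1)).trans ?_
  rw [← lintegral_const_mul' _ _ ENNReal.ofReal_ne_top]
  have h := levelMeasure_ineq hn' hw hBv ha han hbn
    (by rw [div_le_iff₀ hn1] at hb1; linarith)
    (show 1 / q * (n - b) = n - 1 - a by rw [hq]; field_simp) hu hc
    (h := fun _ => 1) measurable_const
  simp only [mul_one] at h
  refine h.trans (lintegral_mono fun x => ?_)
  exact mul_le_of_le_one_right zero_le (indicator_le_self' (fun _ _ => zero_le) _)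

end LintegralHardySobolev

section SharpConstant
open Set Filter Topology
open scoped ENNReal Pointwise

variable {n : ℕ} {u : EuclideanSpace ℝ (Fin n) → ℝ} {a b p q κ s : ℝ}

/-- The area of the unit sphere in `ℝⁿ`. -/
def sphereArea (n : ℕ) : ℝ := 2 * π ^ ((n : ℝ) / 2) / Real.Gamma ((n : ℝ) / 2)

theorem sphereArea_pos (hn : 1 ≤ n) : 0 < sphereArea n := by
  have h : (0 : ℝ) < n := by exact_mod_cast hn
  have := Real.Gamma_pos_of_pos (show 0 < (n : ℝ) / 2 by positivity)
  have := Real.pi_pos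
  unfold sphereArea
  positivity

theorem natCast_mul_volume_ball (hn : 1 ≤ n) :
    n * volume (Metric.ball (0 : EuclideanSpace ℝ (Fin n)) 1) = ENNReal.ofReal (sphereArea n) := by
  have : Nonempty (Fin n) := ⟨⟨0, hn⟩⟩
  have h : (0 : ℝ) < n := by exact_mod_cast hn
  have hG := Real.Gamma_pos_of_pos (show 0 < (n : ℝ) / 2 by positivity)
  rw [EuclideanSpace.volume_ball, ENNReal.ofReal_one, one_pow, one_mul, Fintype.card_fin,
    ← ENNReal.ofReal_natCast n, ← ENNReal.ofReal_mul h.le, sphereArea,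
    Real.Gamma_add_one (by positivity), Real.sqrt_eq_rpow, ← Real.rpow_mul_natCast Real.pi_pos.le]
  congr 1
  rw [show 1 / 2 * (n : ℝ) = n / 2 by ring]
  field_simp

theorem exists_ball_radius (hn : 1 ≤ n) : ∃ w : ℝ, 0 < w ∧
    volume (Metric.ball (0 : EuclideanSpace ℝ (Fin n)) 1) = ENNReal.ofReal (w ^ n) ∧
      n * w ^ n = sphereArea n := by
  have h : (0 : ℝ) < n := by exact_mod_cast hn
  have hS := sphereArea_pos hn
  have hd : 0 < sphereArea n / n := by positivity
  have hpow : ((sphereArea n / n) ^ (1 / (n : ℝ))) ^ n = sphereArea n / n := by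
    rw [← Real.rpow_mul_natCast hd.le, one_div_mul_cancel h.ne', Real.rpow_one]
  refine ⟨(sphereArea n / n) ^ (1 / (n : ℝ)), by positivity, ?_, ?_⟩
  · rw [hpow, ENNReal.ofReal_div_of_pos h, ← natCast_mul_volume_ball hn, ENNReal.ofReal_natCast,
      mul_comm, ENNReal.mul_div_cancel_right (by exact_mod_cast (by omega : n ≠ 0))
        (ENNReal.natCast_ne_top n)]
  · rw [hpow]
    field_simp

/-- The reciprocal of the sharp Hardy–Sobolev constant. -/
def sharpRecip (S n b q κ s : ℝ) : ℝ :=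
  S ^ κ * (n - b) ^ (1 - κ) * (Real.Gamma (s / κ + 1) *
      Real.Gamma ((1 - s) / κ) / Real.Gamma (1 / κ)) ^ κ * (1 / (q * s)) ^ s

theorem sharpRecip_one {S n b q : ℝ} (hq : 1 < q) :
    sharpRecip S n b q (1 - 1 / q) 0 = S ^ (1 - 1 / q) * (n - b) ^ (1 / q) := by
  have hq1 : 0 < 1 - 1 / q := by
    have := (div_lt_one (by linarith)).mpr hq
    linarith
  have := Real.Gamma_pos_of_pos (show 0 < 1 / (1 - 1 / q) by positivity)
  rw [sharpRecip, zero_div, zero_add, Real.Gamma_one, sub_zero, one_mul, div_self this.ne',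
    Real.one_rpow, Real.rpow_zero, mul_one, mul_one]
  congr 2
  ring

theorem mul_sharpRecip (hp : 1 ≤ p) (hpn : p < n) (han : a < n - p)
    (hbn : b < n) (hb2 : b < a + p) (hq : q = (n - b) * p / (n - p - a))
    (hκ : κ = 1 / p - 1 / q) (hs : s = 1 - 1 / p) :
    (Real.Gamma (p * q / (q - p)) /
        (Real.Gamma (q / (q - p)) * Real.Gamma (p * (q - 1) / (q - p)))) ^ (1 / p - 1 / q) *
      ((p - 1) / (n - p - a)) ^ (1 - 1 / p) *
      (Real.Gamma ((n : ℝ) / 2) /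
        (2 * π ^ ((n : ℝ) / 2) * ((n : ℝ) - b) ^ ((n - p - a) / (p + a - b)))) ^
          ((p + a - b) / ((n - b) * p)) * sharpRecip (sphereArea n) n b q κ s = 1 ∧
    0 < sharpRecip (sphereArea n) n b q κ s := by
  have hn : 1 ≤ n := by
    have : (0 : ℝ) < n := by linarith
    exact_mod_cast this
  have hn0 : (0 : ℝ) < n := by exact_mod_cast hn
  have hp0 : 0 < p := by linarith
  have hpab : 0 < p + a - b := by linarith
  have hnpa : 0 < (n : ℝ) - p - a := by linarith
  have hnb : 0 < (n : ℝ) - b := by linarith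
  have hq0 : 0 < q := by rw [hq]; positivity
  have hκ' : κ = (p + a - b) / ((n - b) * p) := by
    rw [hκ, hq]; field_simp; ring
  have hκ0 : 0 < κ := by rw [hκ']; positivity
  have hqp : q - p = κ * (p * q) := by rw [hκ]; field_simp
  have e1 : p * q / (q - p) = 1 / κ := by rw [hqp]; field_simp
  have e2 : q / (q - p) = (1 - s) / κ := by rw [hqp, hs]; field_simp; ring
  have e3 : p * (q - 1) / (q - p) = s / κ + 1 := by
    rw [hqp, hs, div_add_one hκ0.ne', div_eq_div_iff (by positivity) hκ0.ne', hκ]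
    field_simp
    ring
  have hs0 : 0 ≤ s := by
    rw [hs, sub_nonneg, div_le_one hp0]; exact hp
  have hs1 : 0 < 1 - s := by rw [hs]; simp [hp0]
  rw [e1, e2, e3, ← hκ, ← hs, ← hκ']
  set K := Real.Gamma (s / κ + 1) * Real.Gamma ((1 - s) / κ) / Real.Gamma (1 / κ) with hK
  have hK0 : 0 < K := by
    have h1 := Real.Gamma_pos_of_pos (show 0 < s / κ + 1 by positivity)
    have h2 := Real.Gamma_pos_of_pos (show 0 < (1 - s) / κ by positivity)
    have h3 := Real.Gamma_pos_of_pos (show 0 < 1 / κ by positivity)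
    positivity
  have hS := sphereArea_pos hn
  have hKK : Real.Gamma (1 / κ) / (Real.Gamma ((1 - s) / κ) * Real.Gamma (s / κ + 1)) = K⁻¹ := by
    rw [hK, inv_div, mul_comm (Real.Gamma ((1 - s) / κ))]
  have hSS : Real.Gamma ((n : ℝ) / 2) /
      (2 * π ^ ((n : ℝ) / 2) * ((n : ℝ) - b) ^ ((n - p - a) / (p + a - b))) =
      (sphereArea n * ((n : ℝ) - b) ^ ((n - p - a) / (p + a - b)))⁻¹ := by
    rw [sphereArea, mul_inv, inv_div, ← div_eq_mul_inv, div_div]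
  have hnbκ : (((n : ℝ) - b) ^ ((n - p - a) / (p + a - b))) ^ κ = (n - b) ^ (1 / q) := by
    rw [← Real.rpow_mul hnb.le, hκ', hq]
    congr 1
    field_simp
  have hss : ((p - 1) / (n - p - a)) ^ s * (1 / (q * s)) ^ s * (n - b) ^ s = 1 := by
    rcases hs0.eq_or_lt with h0 | h0
    · rw [← h0]; simp
    · have hp1 : 0 < p - 1 := by
        have h1 : 1 / p < 1 := by linarith
        rw [div_lt_one hp0] at h1
        linarith
      rw [← Real.mul_rpow (by positivity) (by positivity),
        ← Real.mul_rpow (by positivity) (by positivity)]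
      convert Real.one_rpow s
      have : q * s = (n - b) * (p - 1) / (n - p - a) := by
        rw [hq, hs]; field_simp
      rw [this]
      field_simp
  have hexp : ((n : ℝ) - b) ^ (1 - κ) = (n - b) ^ (1 / q) * (n - b) ^ s := by
    rw [← Real.rpow_add hnb]
    congr 1
    rw [hκ, hs]; ring
  have p1 : 0 < K ^ κ := by positivity
  have p2 : 0 < sphereArea n ^ κ := by positivity
  have p3 : 0 < ((n : ℝ) - b) ^ (1 / q) := by positivity
  have hval : K⁻¹ ^ κ * ((p - 1) / (n - p - a)) ^ s *
      (sphereArea n * ((n : ℝ) - b) ^ ((n - p - a) / (p + a - b)))⁻¹ ^ κ *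
        sharpRecip (sphereArea n) n b q κ s = 1 := by
    rw [sharpRecip, ← hK, hexp, Real.inv_rpow hK0.le, Real.inv_rpow (by positivity),
      Real.mul_rpow hS.le (by positivity), hnbκ]
    calc _ = (((p - 1) / (n - p - a)) ^ s * (1 / (q * s)) ^ s * (n - b) ^ s) *
          ((K ^ κ)⁻¹ * K ^ κ) * ((sphereArea n ^ κ * (n - b) ^ (1 / q))⁻¹ *
            (sphereArea n ^ κ * (n - b) ^ (1 / q))) := by ring
      _ = 1 := by rw [hss, inv_mul_cancel₀ p1.ne', inv_mul_cancel₀ (by positivity)]; norm_num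
  refine ⟨by rw [hKK, hSS]; exact hval, ?_⟩
  have hnn : 0 ≤ sharpRecip (sphereArea n) n b q κ s := by
    rw [sharpRecip, ← hK]
    positivity
  refine lt_of_le_of_ne hnn fun h => ?_
  rw [← h, mul_zero] at hval
  exact zero_ne_one hval

end SharpConstant

section UpperBound
open Set Filter Topology
open scoped ENNReal Pointwise

variable {n : ℕ} {u : EuclideanSpace ℝ (Fin n) → ℝ} {a b p q κ s : ℝ}

theorem lintegral_hardy_sobolev (hp : 1 ≤ p) (hpn : p < n) (ha : 0 ≤ a) (han : a < n - p)
    (hb1 : a * n / (n - p) ≤ b) (hb2 : b < a + p) (hq : q = (n - b) * p / (n - p - a))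
    (hκ : κ = 1 / p - 1 / q) (hs : s = 1 - 1 / p)
    (hu : ContDiff ℝ 1 u) (hc : HasCompactSupport u) :
    ENNReal.ofReal (sharpRecip (sphereArea n) n b q κ s) *
        (∫⁻ x, ENNReal.ofReal (|u x| ^ q * ‖x‖ ^ (-b))) ^ (1 / q) ≤
      (∫⁻ x, ENNReal.ofReal (‖fderiv ℝ u x‖ ^ p * ‖x‖ ^ (-a))) ^ (1 / p) := by
  have hn : 1 ≤ n := by
    have : (0 : ℝ) < n := by linarith
    exact_mod_cast this
  obtain ⟨w, hw, hBv, hS⟩ := exists_ball_radius hn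
  rw [← hS]
  rcases hp.eq_or_lt with rfl | hp1
  · have hnpa : 0 < (n : ℝ) - 1 - a := by linarith
    have hq1 : 1 < q := by rw [hq, lt_div_iff₀ hnpa]; linarith
    rw [div_one, sub_self] at hs
    rw [div_one] at hκ
    rw [mul_one] at hq
    rw [hs, hκ, sharpRecip_one hq1]
    simp only [Real.rpow_one, div_one, ENNReal.rpow_one]
    exact lintegral_hardy_sobolev_one hw hBv hpn ha han hb1 hb2 hq hu hc
  · exact lintegral_hardy_sobolev_of_one_lt hw hBv hp1 hpn ha han hb1 hb2 hq hκ hs hu hc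

theorem integral_rpow_mul_norm_rpow {f : EuclideanSpace ℝ (Fin n) → ℝ} (hf : Measurable f)
    (hf0 : ∀ x, 0 ≤ f x) (r c : ℝ) :
    ∫ x, f x ^ r * ‖x‖ ^ c = (∫⁻ x, ENNReal.ofReal (f x ^ r * ‖x‖ ^ c)).toReal := by
  refine integral_eq_lintegral_of_nonneg_ae (ae_of_all _ fun x => ?_)
    (Measurable.aestronglyMeasurable (by fun_prop))
  exact mul_nonneg (Real.rpow_nonneg (hf0 x) _) (by positivity)

theorem lintegral_gradient_lt_top (hn : 1 ≤ n) (hp : 0 < p) (han : a < n)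
    (hu : ContDiff ℝ 1 u) (hc : HasCompactSupport u) :
    ∫⁻ x, ENNReal.ofReal (‖fderiv ℝ u x‖ ^ p * ‖x‖ ^ (-a)) < ∞ := by
  have hc' : HasCompactSupport (fderiv ℝ u) := hc.fderiv ℝ
  obtain ⟨R, hR⟩ := hc'.isBounded.subset_ball 0
  obtain ⟨L, hL⟩ := hc'.exists_bound_of_continuous (hu.continuous_fderiv one_ne_zero)
  have hR0 : (0 : ℝ) ≤ max R 0 := le_max_right _ _
  calc ∫⁻ x, ENNReal.ofReal (‖fderiv ℝ u x‖ ^ p * ‖x‖ ^ (-a))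
      ≤ ∫⁻ x in Metric.ball (0 : EuclideanSpace ℝ (Fin n)) (max R 0),
        ENNReal.ofReal (L ^ p) * ENNReal.ofReal (‖x‖ ^ (-a)) := by
        rw [← lintegral_indicator measurableSet_ball]
        refine lintegral_mono fun x => ?_
        by_cases hx : x ∈ Metric.ball (0 : EuclideanSpace ℝ (Fin n)) (max R 0)
        · rw [indicator_of_mem hx, ← ENNReal.ofReal_mul' (by positivity)]
          refine ENNReal.ofReal_le_ofReal (mul_le_mul_of_nonneg_right ?_ (by positivity))
          exact Real.rpow_le_rpow (norm_nonneg _) (hL x) hp.le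
        · have h0 : fderiv ℝ u x = 0 := by
            by_contra h
            exact hx (Metric.ball_subset_ball (le_max_left _ _) (hR (subset_tsupport _ h)))
          rw [h0, norm_zero, Real.zero_rpow hp.ne', zero_mul, ENNReal.ofReal_zero]
          exact zero_le
    _ < ∞ := by
        rw [lintegral_const_mul' _ _ ENNReal.ofReal_ne_top, setLIntegral_ball_norm_rpow hn han hR0]
        exact ENNReal.mul_lt_top ENNReal.ofReal_lt_top (ENNReal.mul_lt_top (ENNReal.mul_lt_top
          (ENNReal.natCast_lt_top _) measure_ball_lt_top) ENNReal.ofReal_lt_top)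

theorem hardy_sobolev (hp : 1 ≤ p) (hpn : p < n) (ha : 0 ≤ a) (han : a < n - p)
    (hb1 : a * n / (n - p) ≤ b) (hb2 : b < a + p) (hq : q = (n - b) * p / (n - p - a))
    (hκ : κ = 1 / p - 1 / q) (hs : s = 1 - 1 / p)
    (hA : 0 ≤ sharpRecip (sphereArea n) n b q κ s)
    (hu : ContDiff ℝ 1 u) (hc : HasCompactSupport u) :
    sharpRecip (sphereArea n) n b q κ s *
        (∫ x, |u x| ^ q * ‖x‖ ^ (-b)) ^ (1 / q) ≤
      (∫ x, ‖fderiv ℝ u x‖ ^ p * ‖x‖ ^ (-a)) ^ (1 / p) := by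
  have hn : 1 ≤ n := by
    have : (0 : ℝ) < n := by linarith
    exact_mod_cast this
  have hp0 : 0 < p := by linarith
  rw [integral_rpow_mul_norm_rpow hu.continuous.abs.measurable (fun x => abs_nonneg (u x)),
    integral_rpow_mul_norm_rpow (hu.continuous_fderiv one_ne_zero).norm.measurable
      (fun x => norm_nonneg _)]
  have h := lintegral_hardy_sobolev hp hpn ha han hb1 hb2 hq hκ hs hu hc
  have hG := (lintegral_gradient_lt_top hn hp0 (show a < n by linarith) hu hc).ne
  have h2 := ENNReal.toReal_mono (ENNReal.rpow_ne_top_of_nonneg (by positivity) hG) h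
  rwa [ENNReal.toReal_mul, ENNReal.toReal_ofReal hA, ← ENNReal.toReal_rpow,
    ← ENNReal.toReal_rpow] at h2

end UpperBound

section RadialTest
open Set Filter Topology
open scoped ENNReal Pointwise ContDiff

variable {n : ℕ} {g : ℝ → ℝ} {δ R : ℝ}

/-- The radial function whose radial derivative is `-g` and which vanishes on `‖x‖ = R`. -/
def radialTest (n : ℕ) (g : ℝ → ℝ) (R : ℝ) (x : EuclideanSpace ℝ (Fin n)) : ℝ :=
  ∫ t in ‖x‖..R, g t

theorem hasDerivAt_integral_left (hg : Continuous g) (r : ℝ) :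
    HasDerivAt (fun r => ∫ t in r..R, g t) (-g r) r :=
  intervalIntegral.integral_hasDerivAt_left (hg.intervalIntegrable _ _)
    hg.stronglyMeasurable.stronglyMeasurableAtFilter hg.continuousAt

theorem contDiff_integral_left (hg : ContDiff ℝ ∞ g) :
    ContDiff ℝ ∞ (fun r => ∫ t in r..R, g t) := by
  rw [contDiff_infty_iff_deriv]
  refine ⟨fun r => (hasDerivAt_integral_left hg.continuous r).differentiableAt, ?_⟩
  rw [show deriv (fun r => ∫ t in r..R, g t) = fun r => -g r from
    funext fun r => (hasDerivAt_integral_left hg.continuous r).deriv]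
  exact hg.neg

theorem radialTest_eventuallyEq (hg : Continuous g) (hδ : 0 < δ) (hgδ : ∀ t ≤ δ, g t = 0) :
    radialTest n g R =ᶠ[𝓝 0] fun _ => ∫ t in (0 : ℝ)..R, g t := by
  filter_upwards [Metric.ball_mem_nhds _ hδ] with y hy
  rw [mem_ball_zero_iff] at hy
  have h0 : ∫ t in (0 : ℝ)..‖y‖, g t = 0 := by
    refine intervalIntegral.integral_zero_ae (ae_of_all _ fun t ht => hgδ t ?_)
    rw [uIoc_of_le (norm_nonneg y)] at ht
    exact ht.2.trans hy.le
  rw [← intervalIntegral.integral_add_adjacent_intervals (hg.intervalIntegrable 0 ‖y‖)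
    (hg.intervalIntegrable ‖y‖ R), h0, zero_add, radialTest]

theorem contDiff_radialTest (hg : ContDiff ℝ ∞ g) (hδ : 0 < δ) (hgδ : ∀ t ≤ δ, g t = 0) :
    ContDiff ℝ ∞ (radialTest n g R) := by
  rw [contDiff_iff_contDiffAt]
  intro x
  rcases eq_or_ne x 0 with rfl | hx
  · exact contDiffAt_const.congr_of_eventuallyEq (radialTest_eventuallyEq hg.continuous hδ hgδ)
  · exact (contDiff_integral_left hg).contDiffAt.comp x (contDiffAt_norm ℝ hx)

theorem norm_fderiv_radialTest_le (hg : Continuous g) (hg0 : ∀ t, 0 ≤ g t) (hδ : 0 < δ)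
    (hgδ : ∀ t ≤ δ, g t = 0) (x : EuclideanSpace ℝ (Fin n)) :
    ‖fderiv ℝ (radialTest n g R) x‖ ≤ g ‖x‖ := by
  rcases eq_or_ne x 0 with rfl | hx
  · rw [(radialTest_eventuallyEq hg hδ hgδ).fderiv_eq, fderiv_fun_const]
    simpa using hg0 0
  · have hd : DifferentiableAt ℝ (fun y : EuclideanSpace ℝ (Fin n) => ‖y‖) x :=
      (contDiffAt_norm ℝ hx (n := 1)).differentiableAt one_ne_zero
    have h := (hasDerivAt_integral_left (R := R) hg ‖x‖).comp_hasFDerivAt x hd.hasFDerivAt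
    have h' : HasFDerivAt (radialTest n g R) (-g ‖x‖ • fderiv ℝ (fun y => ‖y‖) x) x := h
    rw [h'.fderiv, norm_smul, norm_neg, Real.norm_of_nonneg (hg0 _)]
    refine mul_le_of_le_one_right (hg0 _) ?_
    simpa using norm_fderiv_le_of_lipschitz ℝ (x₀ := x)
      (lipschitzWith_one_norm (E := EuclideanSpace ℝ (Fin n)))

theorem ofReal_integral_left (hg : Continuous g) (hg0 : ∀ t, 0 ≤ g t) (hgR : ∀ t ≥ R, g t = 0)
    (r : ℝ) : 0 ≤ ∫ t in r..R, g t ∧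
      ENNReal.ofReal (∫ t in r..R, g t) = ∫⁻ t in Ioi r, ENNReal.ofReal (g t) := by
  rcases le_total r R with hr | hr
  · refine ⟨intervalIntegral.integral_nonneg_of_forall hr hg0, ?_⟩
    rw [intervalIntegral.integral_of_le hr, ofReal_integral_eq_lintegral_ofReal
      (hg.intervalIntegrable _ _).1 (ae_of_all _ hg0), ← Ioc_union_Ioi_eq_Ioi hr,
      lintegral_union measurableSet_Ioi (Ioc_disjoint_Ioi le_rfl),
      setLIntegral_congr_fun measurableSet_Ioi (g := fun _ => 0) fun t ht => by
        simp [hgR t (le_of_lt ht)]]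
    simp
  · have h0 : ∫ t in r..R, g t = 0 := by
      refine intervalIntegral.integral_zero_ae (ae_of_all _ fun t ht => hgR t ?_)
      rw [uIoc_of_ge hr] at ht
      exact ht.1.le
    refine ⟨h0.ge, ?_⟩
    rw [h0, setLIntegral_congr_fun measurableSet_Ioi (g := fun _ => 0) fun t ht => by
        simp [hgR t (hr.trans (le_of_lt ht))]]
    simp

theorem hasCompactSupport_radialTest (hgR : ∀ t ≥ R, g t = 0) :
    HasCompactSupport (radialTest n g R) := by
  refine HasCompactSupport.intro (isCompact_closedBall 0 R) fun x hx => ?_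
  rw [mem_closedBall_zero_iff, not_le] at hx
  refine intervalIntegral.integral_zero_ae (ae_of_all _ fun t ht => hgR t ?_)
  rw [uIoc_of_ge hx.le] at ht
  exact ht.1.le

theorem lintegral_radial_rpow (hn : 1 ≤ n) {φ : ℝ → ℝ≥0∞} (hφ : Measurable φ) (c : ℝ) :
    ∫⁻ x : EuclideanSpace ℝ (Fin n), φ ‖x‖ * ENNReal.ofReal (‖x‖ ^ (-c)) =
      ENNReal.ofReal (sphereArea n) *
        ∫⁻ r in Ioi (0 : ℝ), ENNReal.ofReal (r ^ ((n : ℝ) - c - 1)) * φ r := by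
  rw [lintegral_radial (φ := fun r => φ r * ENNReal.ofReal (r ^ (-c))) hn (by fun_prop),
    natCast_mul_volume_ball hn]
  congr 1
  refine setLIntegral_congr_fun measurableSet_Ioi fun r hr => ?_
  have hr0 : 0 < r := hr
  rw [mul_comm (φ r), ← mul_assoc, ← ENNReal.ofReal_mul (by positivity),
    ← Real.rpow_natCast, ← Real.rpow_add hr0]
  congr 3
  push_cast [hn]
  ring

/-- Testing an inequality for lower Lebesgue integrals with a radial function. -/
theorem radial_ineq_of_test {C : ℝ≥0∞} {a b p q : ℝ} (hn : 1 ≤ n) (hp : 0 < p) (hq : 0 < q)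
    (hC : ∀ u : EuclideanSpace ℝ (Fin n) → ℝ, ContDiff ℝ ∞ u → HasCompactSupport u →
      (∫⁻ x, ENNReal.ofReal (|u x| ^ q * ‖x‖ ^ (-b))) ^ (1 / q) ≤
        C * (∫⁻ x, ENNReal.ofReal (‖fderiv ℝ u x‖ ^ p * ‖x‖ ^ (-a))) ^ (1 / p))
    (hg : ContDiff ℝ ∞ g) (hg0 : ∀ t, 0 ≤ g t) (hδ : 0 < δ) (hgδ : ∀ t ≤ δ, g t = 0)
    (hgR : ∀ t ≥ R, g t = 0) :
    (ENNReal.ofReal (sphereArea n) * ∫⁻ r in Ioi (0 : ℝ), ENNReal.ofReal (r ^ ((n : ℝ) - b - 1)) *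
        (∫⁻ t in Ioi r, ENNReal.ofReal (g t)) ^ q) ^ (1 / q) ≤
      C * (ENNReal.ofReal (sphereArea n) *
        ∫⁻ r in Ioi (0 : ℝ), ENNReal.ofReal (r ^ ((n : ℝ) - a - 1)) *
          ENNReal.ofReal (g r) ^ p) ^ (1 / p) := by
  have hm : Measurable fun r => ∫⁻ t in Ioi r, ENNReal.ofReal (g t) := by
    refine Antitone.measurable fun r r' h => ?_
    exact lintegral_mono_set (Ioi_subset_Ioi h)
  have hgm := hg.continuous.measurable
  rw [← lintegral_radial_rpow hn (hm.pow_const q), ← lintegral_radial_rpow hn (by fun_prop)]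
  refine le_trans (le_of_eq ?_) ((hC (radialTest n g R) (contDiff_radialTest hg hδ hgδ)
    (hasCompactSupport_radialTest hgR)).trans ?_)
  · congr 1
    refine lintegral_congr fun x => ?_
    obtain ⟨h1, h2⟩ := ofReal_integral_left hg.continuous hg0 hgR ‖x‖
    rw [← h2, ENNReal.ofReal_rpow_of_nonneg h1 hq.le, ← ENNReal.ofReal_mul (by positivity),
      radialTest, abs_of_nonneg h1]
  · refine mul_le_mul' le_rfl (ENNReal.rpow_le_rpow (lintegral_mono fun x => ?_) (by positivity))
    rw [ENNReal.ofReal_mul (by positivity), ← ENNReal.ofReal_rpow_of_nonneg (norm_nonneg _) hp.le]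
    refine mul_le_mul' (ENNReal.rpow_le_rpow (ENNReal.ofReal_le_ofReal ?_) hp.le) le_rfl
    exact norm_fderiv_radialTest_le hg.continuous hg0 hδ hgδ x

/-- A smooth cutoff which is `1` on `[N⁻¹, N]` and vanishes outside `[(2 * N)⁻¹, N + 1]`. -/
def annularCutoff (N r : ℝ) : ℝ :=
  Real.smoothTransition (2 * N * r - 1) * Real.smoothTransition (N + 1 - r)

theorem radial_ineq_of_contDiffOn {C : ℝ≥0∞} {a b p q : ℝ} (hn : 1 ≤ n) (hp : 0 < p) (hq : 0 < q)
    (hC : ∀ u : EuclideanSpace ℝ (Fin n) → ℝ, ContDiff ℝ ∞ u → HasCompactSupport u →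
      (∫⁻ x, ENNReal.ofReal (|u x| ^ q * ‖x‖ ^ (-b))) ^ (1 / q) ≤
        C * (∫⁻ x, ENNReal.ofReal (‖fderiv ℝ u x‖ ^ p * ‖x‖ ^ (-a))) ^ (1 / p))
    (hg : ContDiffOn ℝ ∞ g (Ioi 0)) (hgm : Measurable g) (hg0 : ∀ t > 0, 0 ≤ g t) :
    (ENNReal.ofReal (sphereArea n) * ∫⁻ r in Ioi (0 : ℝ), ENNReal.ofReal (r ^ ((n : ℝ) - b - 1)) *
        (∫⁻ t in Ioi r, ENNReal.ofReal (g t)) ^ q) ^ (1 / q) ≤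
      C * (ENNReal.ofReal (sphereArea n) *
        ∫⁻ r in Ioi (0 : ℝ), ENNReal.ofReal (r ^ ((n : ℝ) - a - 1)) *
          ENNReal.ofReal (g r) ^ p) ^ (1 / p) := by
  set I : ℕ → Set ℝ := fun k => Icc ((k : ℝ) + 1)⁻¹ (k + 1) with hI
  have hImono : Monotone I := fun i j hij => by
    have hij' : (i : ℝ) ≤ j := by exact_mod_cast hij
    exact Icc_subset_Icc (inv_anti₀ (by positivity) (by linarith)) (by linarith)
  set φ : ℕ → ℝ → ℝ≥0∞ := fun k t => (I k).indicator (fun t => ENNReal.ofReal (g t)) t with hφ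
  have hφm : ∀ k, Measurable (φ k) := fun k => hgm.ennreal_ofReal.indicator measurableSet_Icc
  have hφmono : Monotone φ := fun i j hij t =>
    indicator_le_indicator_of_subset (hImono hij) (fun _ => zero_le) t
  have htail : ∀ r : ℝ, 0 < r → Tendsto (fun k => ∫⁻ t in Ioi r, φ k t) atTop
      (𝓝 (∫⁻ t in Ioi r, ENNReal.ofReal (g t))) := fun r hr => by
    refine lintegral_tendsto_of_tendsto_of_monotone (fun k => (hφm k).aemeasurable)
      (ae_of_all _ fun t i j hij => hφmono hij t) ?_
    filter_upwards [ae_restrict_mem measurableSet_Ioi] with t ht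
    have ht0 : 0 < t := hr.trans ht
    refine tendsto_const_nhds.congr' ?_
    obtain ⟨k, hk⟩ := exists_nat_ge (max t t⁻¹)
    filter_upwards [eventually_ge_atTop k] with j hj
    have hj' : (k : ℝ) ≤ j := by exact_mod_cast hj
    have h1 := (le_max_left _ _).trans hk
    have h2 := (le_max_right _ _).trans hk
    simp only [hφ]
    rw [indicator_of_mem]
    exact ⟨inv_le_of_inv_le₀ ht0 (by linarith), by linarith⟩
  have htm : ∀ k, Measurable fun r => ∫⁻ t in Ioi r, φ k t := fun k =>
    Antitone.measurable fun r r' h => lintegral_mono_set (Ioi_subset_Ioi h)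
  have hlim : Tendsto (fun k => (ENNReal.ofReal (sphereArea n) * ∫⁻ r in Ioi (0 : ℝ),
      ENNReal.ofReal (r ^ ((n : ℝ) - b - 1)) * (∫⁻ t in Ioi r, φ k t) ^ q) ^ (1 / q)) atTop
      (𝓝 ((ENNReal.ofReal (sphereArea n) * ∫⁻ r in Ioi (0 : ℝ),
        ENNReal.ofReal (r ^ ((n : ℝ) - b - 1)) *
          (∫⁻ t in Ioi r, ENNReal.ofReal (g t)) ^ q) ^ (1 / q))) := by
    refine (ENNReal.continuous_rpow_const.tendsto _).comp
      (ENNReal.Tendsto.const_mul ?_ (Or.inr ENNReal.ofReal_ne_top))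
    refine lintegral_tendsto_of_tendsto_of_monotone
      (fun k => (Measurable.mul (by fun_prop) ((htm k).pow_const q)).aemeasurable)
      (ae_of_all _ fun r i j hij => ?_) ?_
    · exact mul_le_mul' le_rfl (ENNReal.rpow_le_rpow (lintegral_mono (hφmono hij)) hq.le)
    · filter_upwards [ae_restrict_mem measurableSet_Ioi] with r hr
      exact ENNReal.Tendsto.const_mul
        ((ENNReal.continuous_rpow_const.tendsto _).comp (htail r hr))
        (Or.inr ENNReal.ofReal_ne_top)
  refine le_of_tendsto hlim (Eventually.of_forall fun k => ?_)
  set N : ℝ := k + 1 with hN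
  have hN0 : 0 < N := by positivity
  set G : ℝ → ℝ := fun r => annularCutoff N r * g r with hG
  have hcut0 : ∀ r ≤ (2 * N)⁻¹, annularCutoff N r = 0 := fun r hr => by
    rw [annularCutoff, Real.smoothTransition.zero_of_nonpos, zero_mul]
    rw [← one_div, le_div_iff₀ (by positivity)] at hr
    linarith
  have hcutR : ∀ r ≥ N + 1, annularCutoff N r = 0 := fun r hr => by
    rw [annularCutoff, Real.smoothTransition.zero_of_nonpos (x := N + 1 - r) (by linarith),
      mul_zero]
  have hcutnn : ∀ r, 0 ≤ annularCutoff N r := fun r =>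
    mul_nonneg (Real.smoothTransition.nonneg _) (Real.smoothTransition.nonneg _)
  have hcutle : ∀ r, annularCutoff N r ≤ 1 := fun r =>
    mul_le_one₀ (Real.smoothTransition.le_one _) (Real.smoothTransition.nonneg _)
      (Real.smoothTransition.le_one _)
  have hcut1 : ∀ r ∈ I k, annularCutoff N r = 1 := fun r hr => by
    have h1 : N⁻¹ ≤ r := hr.1
    rw [← one_div, div_le_iff₀ hN0] at h1
    rw [annularCutoff, Real.smoothTransition.one_of_one_le (by linarith),
      Real.smoothTransition.one_of_one_le (by linarith [hr.2]), one_mul]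
  have hcutC : ContDiff ℝ ∞ (annularCutoff N) :=
    (Real.smoothTransition.contDiff.comp (by fun_prop)).mul
      (Real.smoothTransition.contDiff.comp (by fun_prop))
  have hδ : 0 < (2 * N)⁻¹ := by positivity
  have hGC : ContDiff ℝ ∞ G := by
    rw [contDiff_iff_contDiffAt]
    intro r
    rcases lt_or_ge r (2 * N)⁻¹ with hr | hr
    · refine (contDiffAt_const (c := (0 : ℝ))).congr_of_eventuallyEq ?_
      filter_upwards [Iio_mem_nhds hr] with t ht
      simp only [hG]
      rw [hcut0 t (le_of_lt ht), zero_mul]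
    · exact hcutC.contDiffAt.mul (hg.contDiffAt (Ioi_mem_nhds (hδ.trans_le hr)))
  have hGnn : ∀ t, 0 ≤ G t := fun t => by
    rcases le_or_gt t 0 with ht | ht
    · simp only [hG]
      rw [hcut0 t (ht.trans hδ.le), zero_mul]
    · exact mul_nonneg (hcutnn t) (hg0 t ht)
  refine le_trans ?_ ((radial_ineq_of_test hn hp hq hC hGC hGnn hδ
    (fun t ht => by simp only [hG]; rw [hcut0 t ht, zero_mul])
    (fun t ht => by simp only [hG]; rw [hcutR t ht, zero_mul])).trans ?_)
  · gcongr with r t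
    simp only [hφ]
    by_cases ht : t ∈ I k
    · rw [indicator_of_mem ht]
      simp only [hG]
      rw [hcut1 t ht, one_mul]
    · rw [indicator_of_notMem ht]
      exact zero_le
  · refine mul_le_mul' le_rfl (ENNReal.rpow_le_rpow (mul_le_mul' le_rfl ?_) (by positivity))
    refine setLIntegral_mono' measurableSet_Ioi fun r hr => ?_
    refine mul_le_mul' le_rfl (ENNReal.rpow_le_rpow (ENNReal.ofReal_le_ofReal ?_) hp.le)
    exact mul_le_of_le_one_left (hg0 r hr) (hcutle r)

end RadialTest

section Sharpness
open Set Filter Topology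
open scoped ENNReal Pointwise ContDiff

variable {n : ℕ} {a b p q κ s c : ℝ}

theorem lintegral_ineq_of_integral_ineq (hp : 1 ≤ p) (hpn : p < n) (ha : 0 ≤ a) (han : a < n - p)
    (hb1 : a * n / (n - p) ≤ b) (hb2 : b < a + p) (hq : q = (n - b) * p / (n - p - a))
    (hκ : κ = 1 / p - 1 / q) (hs : s = 1 - 1 / p)
    (hA : 0 < sharpRecip (sphereArea n) n b q κ s)
    (hc : ∀ u : EuclideanSpace ℝ (Fin n) → ℝ, ContDiff ℝ ∞ u → HasCompactSupport u →
      (∫ x, |u x| ^ q * ‖x‖ ^ (-b)) ^ (1 / q) ≤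
        c * (∫ x, ‖fderiv ℝ u x‖ ^ p * ‖x‖ ^ (-a)) ^ (1 / p))
    (u : EuclideanSpace ℝ (Fin n) → ℝ) (hu : ContDiff ℝ ∞ u) (hcu : HasCompactSupport u) :
    (∫⁻ x, ENNReal.ofReal (|u x| ^ q * ‖x‖ ^ (-b))) ^ (1 / q) ≤
      ENNReal.ofReal c *
        (∫⁻ x, ENNReal.ofReal (‖fderiv ℝ u x‖ ^ p * ‖x‖ ^ (-a))) ^ (1 / p) := by
  have hn : 1 ≤ n := by
    have : (0 : ℝ) < n := by linarith
    exact_mod_cast this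
  have hp0 : 0 < p := by linarith
  have hq0 : 0 < q := by
    rw [hq]
    exact div_pos (mul_pos (by linarith) hp0) (by linarith)
  have hu1 : ContDiff ℝ 1 u := hu.of_le (by exact_mod_cast le_top)
  have h := lintegral_hardy_sobolev hp hpn ha han hb1 hb2 hq hκ hs hu1 hcu
  have hG := (lintegral_gradient_lt_top hn hp0 (show a < n by linarith) hu1 hcu).ne
  have h1 := hc u hu hcu
  rw [integral_rpow_mul_norm_rpow (f := fun x => |u x|) hu.continuous.measurable.norm
      (fun x => abs_nonneg _),
    integral_rpow_mul_norm_rpow (hu1.continuous_fderiv one_ne_zero).measurable.norm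
      (fun x => norm_nonneg _)] at h1
  set F := ∫⁻ x, ENNReal.ofReal (|u x| ^ q * ‖x‖ ^ (-b)) with hF
  set G := ∫⁻ x, ENNReal.ofReal (‖fderiv ℝ u x‖ ^ p * ‖x‖ ^ (-a)) with hGdef
  have hGr : G ^ (1 / p) ≠ ⊤ := ENNReal.rpow_ne_top_of_nonneg (by positivity) hG
  have hFr : F ^ (1 / q) ≠ ⊤ := fun hF => by
    rw [hF, ENNReal.mul_top (by simpa using hA)] at h
    exact hGr (top_le_iff.mp h)
  rw [← ENNReal.ofReal_toReal hFr, ← ENNReal.ofReal_toReal hGr, ← ENNReal.toReal_rpow,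
    ← ENNReal.toReal_rpow, ← ENNReal.ofReal_mul' (by positivity)]
  exact ENNReal.ofReal_le_ofReal h1

theorem hasDerivAt_one_add_rpow_rpow_neg {β γ t : ℝ} (ht : 0 < t) :
    HasDerivAt (fun t : ℝ => -(1 + t ^ β) ^ (-γ))
      (γ * β * t ^ (β - 1) * (1 + t ^ β) ^ (-γ - 1)) t := by
  have h := (((Real.hasDerivAt_rpow_const (p := β) (Or.inl ht.ne')).const_add 1).rpow_const
    (p := -γ) (Or.inl (by positivity))).neg
  rw [show γ * β * t ^ (β - 1) * (1 + t ^ β) ^ (-γ - 1) =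
    -(β * t ^ (β - 1) * -γ * (1 + t ^ β) ^ (-γ - 1)) by ring]
  exact h

theorem lintegral_Ioi_bliss_deriv {β γ r : ℝ} (hβ : 0 < β) (hγ : 0 < γ) (hr : 0 < r) :
    ∫⁻ t in Ioi r, ENNReal.ofReal (γ * β * t ^ (β - 1) * (1 + t ^ β) ^ (-γ - 1)) =
      ENNReal.ofReal ((1 + r ^ β) ^ (-γ)) := by
  have hd : ∀ t ∈ Ici r, HasDerivAt (fun t : ℝ => -(1 + t ^ β) ^ (-γ))
      (γ * β * t ^ (β - 1) * (1 + t ^ β) ^ (-γ - 1)) t := fun t ht =>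
    hasDerivAt_one_add_rpow_rpow_neg (hr.trans_le ht)
  have hnn : ∀ t ∈ Ioi r, 0 ≤ γ * β * t ^ (β - 1) * (1 + t ^ β) ^ (-γ - 1) := fun t ht => by
    have : 0 < t := hr.trans ht
    positivity
  have hlim : Tendsto (fun t : ℝ => -(1 + t ^ β) ^ (-γ)) atTop (𝓝 0) := by
    rw [← neg_zero]
    exact ((tendsto_rpow_neg_atTop hγ).comp
      (tendsto_atTop_add_const_left _ 1 (tendsto_rpow_atTop hβ))).neg
  rw [← ofReal_integral_eq_lintegral_ofReal (integrableOn_Ioi_deriv_of_nonneg' hd hnn hlim)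
    ((ae_restrict_iff' measurableSet_Ioi).mpr (ae_of_all _ hnn)),
    integral_Ioi_of_hasDerivAt_of_nonneg' hd hnn hlim]
  congr 1
  ring

theorem bliss_energy_eq {S β γ t B : ℝ} (hS : 0 < S) (hβ : 0 < β) (hγ : 0 < γ) (ht : 0 < t)
    (hB : 0 < B) (hp : 0 < p) (hκ : κ = 1 / p - 1 / q) (hs : s = 1 - 1 / p) :
    (S * ((γ * β) ^ p * (B * (t * γ) / γ / β))) ^ (1 / p) =
      S ^ κ * (β * (t * γ)) ^ (1 - κ) * (t * γ * B) ^ κ * (1 / t) ^ s *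
        (S * (B / β)) ^ (1 / q) := by
  obtain ⟨S, rfl⟩ : ∃ z, S = Real.exp z := ⟨_, (Real.exp_log hS).symm⟩
  obtain ⟨β, rfl⟩ : ∃ z, β = Real.exp z := ⟨_, (Real.exp_log hβ).symm⟩
  obtain ⟨γ, rfl⟩ : ∃ z, γ = Real.exp z := ⟨_, (Real.exp_log hγ).symm⟩
  obtain ⟨t, rfl⟩ : ∃ z, t = Real.exp z := ⟨_, (Real.exp_log ht).symm⟩
  obtain ⟨B, rfl⟩ : ∃ z, B = Real.exp z := ⟨_, (Real.exp_log hB).symm⟩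
  simp only [← Real.exp_mul, ← Real.exp_add, ← Real.exp_sub, one_div (Real.exp _), ← Real.exp_neg]
  rw [Real.exp_eq_exp, hκ, hs]
  field_simp
  ring

theorem one_le_mul_sharpRecip_of_one_lt (hp : 1 < p) (hpn : p < n) (han : a < n - p)
    (hbn : b < n) (hb2 : b < a + p) (hq : q = (n - b) * p / (n - p - a))
    (hκ : κ = 1 / p - 1 / q) (hs : s = 1 - 1 / p)
    (hC : ∀ u : EuclideanSpace ℝ (Fin n) → ℝ, ContDiff ℝ ∞ u → HasCompactSupport u →
      (∫⁻ x, ENNReal.ofReal (|u x| ^ q * ‖x‖ ^ (-b))) ^ (1 / q) ≤ ENNReal.ofReal c *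
        (∫⁻ x, ENNReal.ofReal (‖fderiv ℝ u x‖ ^ p * ‖x‖ ^ (-a))) ^ (1 / p)) :
    1 ≤ c * sharpRecip (sphereArea n) n b q κ s := by
  have hn : 1 ≤ n := by
    have : (0 : ℝ) < n := by linarith
    exact_mod_cast this
  have hp0 : 0 < p := by linarith
  have hp1 : 0 < p - 1 := by linarith
  have hpab : 0 < p + a - b := by linarith
  have hnpa : 0 < (n : ℝ) - p - a := by linarith
  have hnb : 0 < (n : ℝ) - b := by linarith
  have hq0 : 0 < q := by rw [hq]; positivity
  have hS := sphereArea_pos hn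
  set β := (p + a - b) / (p - 1) with hβ
  set γ := (n - p - a) / (p + a - b) with hγ
  have hβ0 : 0 < β := by positivity
  have hγ0 : 0 < γ := by positivity
  have hs0 : 0 < s := by
    rw [hs, sub_pos, div_lt_one hp0]
    exact hp
  have hκ' : κ = (p + a - b) / ((n - b) * p) := by
    rw [hκ, hq]; field_simp; ring
  have hκ0 : 0 < κ := by rw [hκ']; positivity
  set x := s / κ with hx
  have hx0 : 0 < x := by positivity
  have hxt : x = q * s * γ := by
    rw [hx, hκ', hs, hq, hγ]; field_simp
  have hβx : (n : ℝ) - b = β * x := by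
    rw [hx, hβ, hκ', hs]; field_simp
  have hy : (1 - s) / κ = γ + 1 := by
    rw [hκ', hs, hγ]; field_simp; ring
  have hD : γ * q = 1 / κ := by
    rw [hκ', hq, hγ]; field_simp
  have hDp : (γ + 1) * p = 1 / κ := by
    rw [hκ', hγ]; field_simp; ring
  have hDx : 1 / κ - x = γ + 1 := by
    rw [← hy, hx]; ring
  have hM : n - a + (β - 1) * p = β * (x + 1) := by
    rw [mul_add, ← hβx, hβ]; field_simp; ring
  set B := Real.Gamma x * Real.Gamma (γ + 1) / Real.Gamma (1 / κ) with hB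
  have hB0 : 0 < B := by
    have h1 := Real.Gamma_pos_of_pos hx0
    have h2 := Real.Gamma_pos_of_pos (show 0 < γ + 1 by positivity)
    have h3 := Real.Gamma_pos_of_pos (show 0 < 1 / κ by positivity)
    positivity
  have key := radial_ineq_of_contDiffOn (q := q)
    (g := fun t : ℝ => γ * β * t ^ (β - 1) * (1 + t ^ β) ^ (-γ - 1)) hn hp0 hq0 hC ?_ (by fun_prop)
    (fun t ht => by positivity)
  · have hL : ∫⁻ r in Ioi (0 : ℝ), ENNReal.ofReal (r ^ ((n : ℝ) - b - 1)) *
        (∫⁻ t in Ioi r, ENNReal.ofReal (γ * β * t ^ (β - 1) * (1 + t ^ β) ^ (-γ - 1))) ^ q =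
        ENNReal.ofReal (B / β) := by
      have h := lintegral_rpow_mul_one_add_rpow_rpow_neg hβ0 hnb (B := 1 / κ)
        (by rw [hβx]; exact mul_lt_mul_of_pos_left (by linarith) hβ0)
      rw [hβx, mul_div_cancel_left₀ _ hβ0.ne', hDx] at h
      rw [← h]
      refine setLIntegral_congr_fun measurableSet_Ioi fun r hr => ?_
      have hr0 : 0 < r := hr
      rw [lintegral_Ioi_bliss_deriv hβ0 hγ0 hr0, ENNReal.ofReal_rpow_of_nonneg (by positivity)
        hq0.le, ← ENNReal.ofReal_mul (by positivity), ← Real.rpow_mul (by positivity), neg_mul, hD,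
        hβx]
    have hR : ∫⁻ r in Ioi (0 : ℝ), ENNReal.ofReal (r ^ ((n : ℝ) - a - 1)) *
        ENNReal.ofReal (γ * β * r ^ (β - 1) * (1 + r ^ β) ^ (-γ - 1)) ^ p =
        ENNReal.ofReal ((γ * β) ^ p * (B * (q * s * γ) / γ / β)) := by
      have h := lintegral_rpow_mul_one_add_rpow_rpow_neg (A := β * (x + 1)) hβ0 (by positivity)
        (B := 1 / κ) (mul_lt_mul_of_pos_left (by linarith) hβ0)
      rw [mul_div_cancel_left₀ _ hβ0.ne', show 1 / κ - (x + 1) = γ by linarith] at h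
      have hBM : Real.Gamma (x + 1) * Real.Gamma γ / Real.Gamma (1 / κ) / β =
          B * (q * s * γ) / γ / β := by
        rw [← hxt, hB, Real.Gamma_add_one hx0.ne', Real.Gamma_add_one hγ0.ne']
        field_simp
      rw [hBM] at h
      rw [ENNReal.ofReal_mul (by positivity), ← h, ← lintegral_const_mul _ (by fun_prop)]
      refine setLIntegral_congr_fun measurableSet_Ioi fun r hr => ?_
      have hr0 : 0 < r := hr
      rw [ENNReal.ofReal_rpow_of_nonneg (by positivity) hp0.le,
        ← ENNReal.ofReal_mul (by positivity), ← ENNReal.ofReal_mul (by positivity),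
        Real.mul_rpow (by positivity) (by positivity), Real.mul_rpow (by positivity)
        (by positivity),
        ← Real.rpow_mul hr0.le, ← Real.rpow_mul (by positivity),
        show (-γ - 1) * p = -(1 / κ) by rw [← hDp]; ring, ← hM,
        show (n : ℝ) - a + (β - 1) * p - 1 = (n - a - 1) + (β - 1) * p by ring, Real.rpow_add hr0]
      congr 1
      ring
    have hqs : 0 < q * s := by positivity
    rw [hL, hR, ← ENNReal.ofReal_mul hS.le, ← ENNReal.ofReal_mul hS.le,
      ENNReal.ofReal_rpow_of_nonneg (by positivity) (by positivity),
      ENNReal.ofReal_rpow_of_nonneg (by positivity) (by positivity),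
      ← ENNReal.ofReal_mul' (by positivity), bliss_energy_eq hS hβ0 hγ0 hqs hB0 hp0 hκ hs] at key
    have hpos : 0 < (sphereArea n * (B / β)) ^ (1 / q) := by positivity
    have hsharp : sharpRecip (sphereArea n) n b q κ s = sphereArea n ^ κ *
        (β * (q * s * γ)) ^ (1 - κ) * (q * s * γ * B) ^ κ * (1 / (q * s)) ^ s := by
      rw [sharpRecip, ← hx, hy, Real.Gamma_add_one hx0.ne', ← hxt, hβx, hB]
      congr 3
      ring
    rw [← hsharp, ENNReal.ofReal_le_ofReal_iff', ← mul_assoc] at key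
    rcases key with h | h
    · exact (le_mul_iff_one_le_left hpos).mp h
    · exact absurd h hpos.not_ge
  · intro t ht
    have ht0 : (0 : ℝ) < t := ht
    refine ContDiffAt.contDiffWithinAt ?_
    refine (contDiffAt_const.mul (Real.contDiffAt_rpow_const_of_ne ht0.ne')).mul ?_
    exact (contDiffAt_const.add (Real.contDiffAt_rpow_const_of_ne ht0.ne')).rpow_const_of_ne
      (by positivity)

theorem sphere_ineq_of_radial_ineq {ε : ℝ} (hn : 1 ≤ n) (hε : 0 < ε) (hε1 : ε < 1)
    (han : a < n - 1) (hbn : b < n) (hq : 0 < q)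
    (hC : ∀ u : EuclideanSpace ℝ (Fin n) → ℝ, ContDiff ℝ ∞ u → HasCompactSupport u →
      (∫⁻ x, ENNReal.ofReal (|u x| ^ q * ‖x‖ ^ (-b))) ^ (1 / q) ≤ ENNReal.ofReal c *
        (∫⁻ x, ENNReal.ofReal (‖fderiv ℝ u x‖ ^ (1 : ℝ) * ‖x‖ ^ (-a))) ^ (1 / (1 : ℝ))) :
    (sphereArea n * ((1 - ε) ^ ((n : ℝ) - b) / (n - b))) ^ (1 / q) ≤
      c * (sphereArea n * (1 + ε) ^ ((n : ℝ) - a - 1)) := by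
  have hS := sphereArea_pos hn
  have hnb : 0 < (n : ℝ) - b := by linarith
  have hε' : 0 < 1 - ε := by linarith
  let φ : ContDiffBump (1 : ℝ) := ⟨ε / 2, ε, by positivity, by linarith⟩
  have hsupp : ∀ t, t ∉ Metric.ball (1 : ℝ) ε → φ.normed volume t = 0 := fun t ht => by
    rw [← Function.notMem_support, φ.support_normed_eq]
    exact ht
  have hint : ∫⁻ t, ENNReal.ofReal (φ.normed volume t) = 1 := by
    rw [← ofReal_integral_eq_lintegral_ofReal φ.integrable_normed
      (ae_of_all _ φ.nonneg_normed), φ.integral_normed, ENNReal.ofReal_one]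
  have key := radial_ineq_of_contDiffOn (g := φ.normed volume)
      hn one_pos hq hC (φ.contDiff_normed.contDiffOn)
    φ.continuous_normed.measurable (fun t _ => φ.nonneg_normed t)
  have hL : ENNReal.ofReal ((1 - ε) ^ ((n : ℝ) - b) / (n - b)) ≤
      ∫⁻ r in Ioi (0 : ℝ), ENNReal.ofReal (r ^ ((n : ℝ) - b - 1)) *
        (∫⁻ t in Ioi r, ENNReal.ofReal (φ.normed volume t)) ^ q := by
    have hI : ∫ r in (0 : ℝ)..(1 - ε), r ^ ((n : ℝ) - b - 1) =
        (1 - ε) ^ ((n : ℝ) - b) / (n - b) := by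
      rw [integral_rpow (Or.inl (by linarith)), sub_add_cancel, Real.zero_rpow hnb.ne', sub_zero]
    rw [← hI, intervalIntegral.integral_of_le hε'.le, ofReal_integral_eq_lintegral_ofReal
      ((intervalIntegrable_iff_integrableOn_Ioc_of_le hε'.le).mp
        (intervalIntegral.intervalIntegrable_rpow' (by linarith)))
      ((ae_restrict_iff' measurableSet_Ioc).mpr
        (ae_of_all _ fun r hr => Real.rpow_nonneg hr.1.le _))]
    refine (setLIntegral_mono' measurableSet_Ioc fun r hr => ?_).trans
      (lintegral_mono_set Ioc_subset_Ioi_self)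
    have h1 : ∫⁻ t in Ioi r, ENNReal.ofReal (φ.normed volume t) = 1 := by
      rw [← hint]
      refine setLIntegral_eq_of_support_subset ?_
      intro t ht
      by_contra hr'
      refine ht ?_
      refine (congrArg ENNReal.ofReal (hsupp t fun hb => ?_)).trans ENNReal.ofReal_zero
      rw [Real.ball_eq_Ioo] at hb
      exact hr' (hr.2.trans_lt hb.1)
    rw [h1, ENNReal.one_rpow, mul_one]
  have hR : ∫⁻ r in Ioi (0 : ℝ), ENNReal.ofReal (r ^ ((n : ℝ) - a - 1)) *
      ENNReal.ofReal (φ.normed volume r) ^ (1 : ℝ) ≤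
      ENNReal.ofReal ((1 + ε) ^ ((n : ℝ) - a - 1)) := by
    calc _ ≤ ∫⁻ r in Ioi (0 : ℝ), ENNReal.ofReal ((1 + ε) ^ ((n : ℝ) - a - 1)) *
          ENNReal.ofReal (φ.normed volume r) := by
          refine setLIntegral_mono' measurableSet_Ioi fun r hr => ?_
          have hr0 : (0 : ℝ) < r := hr
          rw [ENNReal.rpow_one]
          by_cases hb : r ∈ Metric.ball (1 : ℝ) ε
          · rw [Real.ball_eq_Ioo] at hb
            gcongr
            · linarith
            · exact hb.2.le
          · rw [hsupp r hb, ENNReal.ofReal_zero, mul_zero, mul_zero]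
      _ ≤ ∫⁻ r, ENNReal.ofReal ((1 + ε) ^ ((n : ℝ) - a - 1)) *
          ENNReal.ofReal (φ.normed volume r) := setLIntegral_le_lintegral _ _
      _ = _ := by rw [lintegral_const_mul' _ _ ENNReal.ofReal_ne_top, hint, mul_one]
  have h := (ENNReal.rpow_le_rpow (mul_le_mul' le_rfl hL) (by positivity)).trans
    (key.trans (mul_le_mul' le_rfl (ENNReal.rpow_le_rpow (mul_le_mul' le_rfl hR) (by positivity))))
  rw [div_one, ENNReal.rpow_one, ← ENNReal.ofReal_mul hS.le, ← ENNReal.ofReal_mul hS.le,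
    ENNReal.ofReal_rpow_of_nonneg (by positivity) (by positivity),
    ← ENNReal.ofReal_mul' (by positivity), ENNReal.ofReal_le_ofReal_iff'] at h
  rcases h with h | h
  · exact h
  · exact absurd h (not_le.mpr (by positivity))

theorem one_le_mul_sharpRecip_one (hn : 1 ≤ n) (han : a < n - 1) (hbn : b < n) (hq : 1 < q)
    (hC : ∀ u : EuclideanSpace ℝ (Fin n) → ℝ, ContDiff ℝ ∞ u → HasCompactSupport u →
      (∫⁻ x, ENNReal.ofReal (|u x| ^ q * ‖x‖ ^ (-b))) ^ (1 / q) ≤ ENNReal.ofReal c *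
        (∫⁻ x, ENNReal.ofReal (‖fderiv ℝ u x‖ ^ (1 : ℝ) * ‖x‖ ^ (-a))) ^ (1 / (1 : ℝ))) :
    1 ≤ c * sharpRecip (sphereArea n) n b q (1 - 1 / q) 0 := by
  have hS := sphereArea_pos hn
  have hnb : 0 < (n : ℝ) - b := by linarith
  have hq0 : 0 < q := by linarith
  have hlim : (sphereArea n * (1 / (n - b))) ^ (1 / q) ≤ c * sphereArea n := by
    have hl : Tendsto (fun ε : ℝ => (sphereArea n * ((1 - ε) ^ ((n : ℝ) - b) / (n - b))) ^ (1 / q))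
        (𝓝[>] 0) (𝓝 ((sphereArea n * (1 / (n - b))) ^ (1 / q))) := by
      have : ContinuousAt (fun ε : ℝ =>
          (sphereArea n * ((1 - ε) ^ ((n : ℝ) - b) / (n - b))) ^ (1 / q)) 0 := by
        refine ContinuousAt.rpow_const ?_ (Or.inr (by positivity))
        refine continuousAt_const.mul (ContinuousAt.div_const ?_ _)
        exact ContinuousAt.rpow_const (by fun_prop) (Or.inr hnb.le)
      simpa using this.tendsto.mono_left nhdsWithin_le_nhds
    have hr : Tendsto (fun ε : ℝ => c * (sphereArea n * (1 + ε) ^ ((n : ℝ) - a - 1)))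
        (𝓝[>] 0) (𝓝 (c * sphereArea n)) := by
      have : ContinuousAt (fun ε : ℝ => c * (sphereArea n * (1 + ε) ^ ((n : ℝ) - a - 1))) 0 := by
        refine continuousAt_const.mul (continuousAt_const.mul ?_)
        exact ContinuousAt.rpow_const (by fun_prop) (Or.inr (by linarith))
      simpa using this.tendsto.mono_left nhdsWithin_le_nhds
    refine le_of_tendsto_of_tendsto hl hr ?_
    filter_upwards [Ioo_mem_nhdsGT one_pos] with ε hε
    exact sphere_ineq_of_radial_ineq hn hε.1 hε.2 han hbn hq0 hC
  have hX : 0 < (sphereArea n) ^ (1 / q) := by positivity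
  have hY : 0 < ((n : ℝ) - b) ^ (1 / q) := by positivity
  rw [Real.mul_rpow hS.le (by positivity), Real.div_rpow zero_le_one hnb.le, Real.one_rpow,
    mul_one_div, div_le_iff₀ hY] at hlim
  rw [sharpRecip_one hq, Real.rpow_sub hS, Real.rpow_one]
  calc (1 : ℝ) = sphereArea n ^ (1 / q) / sphereArea n ^ (1 / q) := (div_self hX.ne').symm
    _ ≤ c * sphereArea n * (n - b) ^ (1 / q) / sphereArea n ^ (1 / q) := by gcongr
    _ = _ := by ring

end Sharpness

/-- The sharp Hardy–Sobolev inequality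
`( ∫ |u|^q |x|^{−b} dx )^{1/q} ≤ C ( ∫ |∇u|^p |x|^{−a} dx )^{1/p}`
with `q = (n−b)p/(n−p−a)`, where the constant `C` is best possible. -/
theorem hardy_sobolev_sharp
    (n : ℕ) (p a b q : ℝ) (hp : 1 ≤ p) (hpn : p < n)
    (ha : 0 ≤ a) (han : a < n - p) (hb1 : a * n / (n - p) ≤ b) (hb2 : b < a + p)
    (hq : q = (n - b) * p / (n - p - a))
    (Cst : ℝ)
    (hCst : Cst = (Real.Gamma (p * q / (q - p)) /
        (Real.Gamma (q / (q - p)) * Real.Gamma (p * (q - 1) / (q - p)))) ^ (1 / p - 1 / q) *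
      ((p - 1) / (n - p - a)) ^ (1 - 1 / p) *
      (Real.Gamma ((n : ℝ) / 2) /
        (2 * π ^ ((n : ℝ) / 2) * ((n : ℝ) - b) ^ ((n - p - a) / (p + a - b)))) ^
          ((p + a - b) / ((n - b) * p))) :
    (∀ u : EuclideanSpace ℝ (Fin n) → ℝ, ContDiff ℝ (⊤ : ℕ∞) u → HasCompactSupport u →
      (∫ x : EuclideanSpace ℝ (Fin n), |u x| ^ q * ‖x‖ ^ (-b)) ^ (1 / q) ≤
        Cst * (∫ x : EuclideanSpace ℝ (Fin n), ‖fderiv ℝ u x‖ ^ p * ‖x‖ ^ (-a)) ^ (1 / p)) ∧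
    (∀ c : ℝ,
      (∀ u : EuclideanSpace ℝ (Fin n) → ℝ, ContDiff ℝ (⊤ : ℕ∞) u → HasCompactSupport u →
        (∫ x : EuclideanSpace ℝ (Fin n), |u x| ^ q * ‖x‖ ^ (-b)) ^ (1 / q) ≤
          c * (∫ x : EuclideanSpace ℝ (Fin n), ‖fderiv ℝ u x‖ ^ p * ‖x‖ ^ (-a)) ^ (1 / p)) →
      Cst ≤ c) := by
  have hn : 1 ≤ n := by
    have : (0 : ℝ) < n := by linarith
    exact_mod_cast this
  have hbn : b < n := by linarith
  obtain ⟨hone, hpos⟩ := mul_sharpRecip hp hpn han hbn hb2 hq rfl rfl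
  rw [← hCst] at hone
  refine ⟨fun u hu hc => ?_, fun c hc => ?_⟩
  · have h := hardy_sobolev hp hpn ha han hb1 hb2 hq rfl rfl hpos.le
      (hu.of_le (by exact_mod_cast le_top)) hc
    have hC0 : 0 ≤ Cst := by
      by_contra! hneg
      linarith [mul_neg_of_neg_of_pos hneg hpos]
    calc _ = Cst * (sharpRecip (sphereArea n) n b q (1 / p - 1 / q) (1 - 1 / p) *
          (∫ x : EuclideanSpace ℝ (Fin n), |u x| ^ q * ‖x‖ ^ (-b)) ^ (1 / q)) := by
          rw [← mul_assoc, hone, one_mul]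
      _ ≤ _ := mul_le_mul_of_nonneg_left h hC0
  · have hC := lintegral_ineq_of_integral_ineq hp hpn ha han hb1 hb2 hq rfl rfl hpos hc
    refine le_of_mul_le_mul_right (hone.trans_le ?_) hpos
    rcases hp.eq_or_lt with rfl | hp1
    · have hq1 : 1 < q := by
        rw [hq, mul_one, one_lt_div (by linarith)]
        linarith
      rw [one_div_one, sub_self]
      exact one_le_mul_sharpRecip_one hn (by linarith) hbn hq1 hC
    · exact one_le_mul_sharpRecip_of_one_lt hp1 hpn han hbn hb2 hq rfl rfl hC
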